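/- Let K = Q(√-1) or Q(√-3) and p a prime with p ≥ 5. There exists a symmetric Hermitian modular form F_{p−1} ∈ M_{p−1}^{(s)}(U_2(O_K), ν_{p−1})_{Z_(p)} of degree 2 and weight p−1 with p-integral Fourier coefficients such that F_{p−1} ≡ 1 (mod p), i.e. a_{F_{p−1}}(0) ≡ 1 (mod p) and a_{F_{p−1}}(H) ≡ 0 (mod p) for all H ≠ 0. -/

import Mathlib

open Complex Matrix
open scoped ComplexOrder

noncomputable section

/-- `√d_K` for an imaginary quadratic discriminant `d < 0`,
taken as `√|d| · i` in the upper half plane. -/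
def sqrtD (d : ℤ) : ℂ := Real.sqrt (-d) * Complex.I

/-- The ring of integers `O_K = ℤ[(d + √d)/2]` of the imaginary quadratic field of
discriminant `d`, viewed as a subset of `ℂ`. -/
def ringInt (d : ℤ) : Set ℂ :=
  {z | ∃ a b : ℤ, z = (a : ℂ) + (b : ℂ) * (((d : ℂ) + sqrtD d) / 2)}

/-- The inverse different `D_K⁻¹ = O_K / √d_K`. -/
def invDiff (d : ℤ) : Set ℂ := {z | sqrtD d * z ∈ ringInt d}

/-- The Hermitian upper half-space of degree 2:
`Z` with `(Z - ᵗZ̄)/(2i)` positive definite. -/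
def HermitianUpperHalfSpace : Set (Matrix (Fin 2) (Fin 2) ℂ) :=
  {Z | ((Z - Zᴴ).map (fun w => w / (2 * Complex.I))).PosDef}

/-- The lattice `Λ₂(K)`: Hermitian matrices with integral diagonal and
`√d_K ·`(off-diagonal entries) in `O_K`. -/
def LambdaH (d : ℤ) : Set (Matrix (Fin 2) (Fin 2) ℂ) :=
  {H | H.IsHermitian ∧ (∀ i, ∃ n : ℤ, H i i = (n : ℂ)) ∧
    ∀ i j, sqrtD d * H i j ∈ ringInt d}

/-- Semi-positive elements of `Λ₂(K)`, the index set of Fourier expansions. -/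
def HermLattice (d : ℤ) : Set (Matrix (Fin 2) (Fin 2) ℂ) :=
  {H | H ∈ LambdaH d ∧ H.PosSemidef}

/-- The symplectic-form matrix `J₂ = [[0, -1], [1, 0]]` (2×2 blocks). -/
def J2 : Matrix (Fin 2 ⊕ Fin 2) (Fin 2 ⊕ Fin 2) ℂ :=
  Matrix.fromBlocks 0 (-1) 1 0

/-- The Hermitian modular group `U₂(O_K)`:
matrices with entries in `O_K` satisfying `ᵗM̄ J₂ M = J₂`. -/
def HermitianModularGroup (d : ℤ) : Set (Matrix (Fin 2 ⊕ Fin 2) (Fin 2 ⊕ Fin 2) ℂ) :=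
  {M | (∀ i j, M i j ∈ ringInt d) ∧ Mᴴ * J2 * M = J2}

/-- The fractional-linear action `Z ↦ (AZ + B)(CZ + D)⁻¹`. -/
def matAct (M : Matrix (Fin 2 ⊕ Fin 2) (Fin 2 ⊕ Fin 2) ℂ)
    (Z : Matrix (Fin 2) (Fin 2) ℂ) : Matrix (Fin 2) (Fin 2) ℂ :=
  (M.toBlocks₁₁ * Z + M.toBlocks₁₂) * (M.toBlocks₂₁ * Z + M.toBlocks₂₂)⁻¹

/-- The character `ν_k`: `det^{k/2}` for `K = ℚ(√-1)` (i.e. `d = -4`, `k` even),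
and `det^k` for `K = ℚ(√-3)` (i.e. `d = -3`). -/
def nuChar (d k : ℤ) (M : Matrix (Fin 2 ⊕ Fin 2) (Fin 2 ⊕ Fin 2) ℂ) : ℂ :=
  if d = -4 then M.det ^ (k / 2) else M.det ^ k

/-- A Hermitian modular form of degree 2, weight `k` and character `ν_k` for `U₂(O_K)`,
bundled with its Fourier expansion over the semi-positive part of `Λ₂(K)`. -/
structure HermitianModularForm (d k : ℤ) where
  toFun : Matrix (Fin 2) (Fin 2) ℂ → ℂ
  coeff : Matrix (Fin 2) (Fin 2) ℂ → ℂ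
  holo : DifferentiableOn ℂ (fun Z : Fin 2 → Fin 2 → ℂ => toFun (Matrix.of Z))
    {Z | Matrix.of Z ∈ HermitianUpperHalfSpace}
  transform : ∀ M ∈ HermitianModularGroup d, ∀ Z ∈ HermitianUpperHalfSpace,
    toFun (matAct M Z) =
      nuChar d k M * (M.toBlocks₂₁ * Z + M.toBlocks₂₂).det ^ k * toFun Z
  coeff_supported : ∀ H, coeff H ≠ 0 → H ∈ HermLattice d
  expansion : ∀ Z ∈ HermitianUpperHalfSpace,
    HasSum (fun H : HermLattice d =>
      coeff H * Complex.exp (2 * Real.pi * Complex.I * ((H : Matrix (Fin 2) (Fin 2) ℂ) * Z).trace))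
      (toFun Z)

/-- A Hermitian modular form is symmetric if `f(ᵗZ) = f(Z)`. -/
def IsSymmetricHMF {d k : ℤ} (f : HermitianModularForm d k) : Prop :=
  ∀ Z ∈ HermitianUpperHalfSpace, f.toFun Zᵀ = f.toFun Z

/-- `z` is a `p`-integral rational number: `z = a/b` with `p ∤ b`. -/
def IsPIntegral (p : ℕ) (z : ℂ) : Prop :=
  ∃ a b : ℤ, ¬ (p : ℤ) ∣ b ∧ (b : ℂ) * z = (a : ℂ)

/-- `z ≡ w (mod p^l)` in the local ring `ℤ_(p)`, i.e. `(z - w)/p^l` is `p`-integral. -/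
def ModCongr (p l : ℕ) (z w : ℂ) : Prop :=
  IsPIntegral p ((z - w) / (p : ℂ) ^ l)


/-- The lexicographic order on `Λ₂(K)` used to define `ord_p`:
compare first `tr H`, then the `(1,1)`-entry `m`, then (for off-diagonal entry
`(a + b i)/2`) first `a`, then `b`. -/
def lexLt (H H' : Matrix (Fin 2) (Fin 2) ℂ) : Prop :=
  H.trace.re < H'.trace.re ∨
    (H.trace = H'.trace ∧
      ((H 0 0).re < (H' 0 0).re ∨
        (H 0 0 = H' 0 0 ∧
          ((H 0 1).re < (H' 0 1).re ∨
            ((H 0 1).re = (H' 0 1).re ∧ (H 0 1).im < (H' 0 1).im)))))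

/-- The Siegel upper half-space of degree `n`: symmetric complex matrices with
positive definite imaginary part. -/
def SiegelUpperHalfSpace (n : ℕ) : Set (Matrix (Fin n) (Fin n) ℂ) :=
  {Z | Z.IsSymm ∧ ((Z - Zᴴ).map (fun w => w / (2 * Complex.I))).PosDef}

/-- The symplectic-form matrix over `ℤ` in degree `n`. -/
def Jn (n : ℕ) : Matrix (Fin n ⊕ Fin n) (Fin n ⊕ Fin n) ℤ :=
  Matrix.fromBlocks 0 (-1) 1 0

/-- The Siegel modular group `Γ_n = Sp_n(ℤ)` (as a set of `2n × 2n` integer matrices). -/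
def SiegelModularGroup (n : ℕ) : Set (Matrix (Fin n ⊕ Fin n) (Fin n ⊕ Fin n) ℤ) :=
  {M | Mᵀ * Jn n * M = Jn n}

/-- The fractional-linear action of an integral symplectic matrix on the Siegel
upper half-space. -/
def matActS {n : ℕ} (M : Matrix (Fin n ⊕ Fin n) (Fin n ⊕ Fin n) ℤ)
    (Z : Matrix (Fin n) (Fin n) ℂ) : Matrix (Fin n) (Fin n) ℂ :=
  ((M.map (fun a => (a : ℂ))).toBlocks₁₁ * Z + (M.map (fun a => (a : ℂ))).toBlocks₁₂) *
    ((M.map (fun a => (a : ℂ))).toBlocks₂₁ * Z + (M.map (fun a => (a : ℂ))).toBlocks₂₂)⁻¹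

/-- The index lattice of Fourier expansions of Siegel modular forms of level `N`:
semi-positive symmetric rational matrices `T` with `N·T` half-integral,
i.e. `T ∈ (1/N)Λ_n`. -/
def SiegelLattice (n : ℕ) (N : ℕ) : Set (Matrix (Fin n) (Fin n) ℚ) :=
  {T | T.IsSymm ∧ (∀ i, ∃ a : ℤ, (N : ℚ) * T i i = (a : ℚ)) ∧
    (∀ i j, ∃ a : ℤ, 2 * (N : ℚ) * T i j = (a : ℚ)) ∧
    (T.map (fun q => (q : ℝ))).PosSemidef}

/-- A Siegel modular form of degree `n` and weight `k` for a subgroup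
`Γ ⊆ Γ_n = Sp_n(ℤ)` of level `N`, bundled with its Fourier expansion. For the
full modular group take `Γ = SiegelModularGroup n` and `N = 1`. -/
structure SiegelModularForm (n : ℕ) (k : ℤ)
    (Γ : Set (Matrix (Fin n ⊕ Fin n) (Fin n ⊕ Fin n) ℤ)) (N : ℕ) where
  toFun : Matrix (Fin n) (Fin n) ℂ → ℂ
  coeff : Matrix (Fin n) (Fin n) ℚ → ℂ
  holo : DifferentiableOn ℂ (fun Z : Fin n → Fin n → ℂ => toFun (Matrix.of Z))
    {Z | Matrix.of Z ∈ SiegelUpperHalfSpace n}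
  transform : ∀ M ∈ Γ, ∀ Z ∈ SiegelUpperHalfSpace n,
    toFun (matActS M Z) =
      ((M.map (fun a => (a : ℂ))).toBlocks₂₁ * Z +
        (M.map (fun a => (a : ℂ))).toBlocks₂₂).det ^ k * toFun Z
  coeff_supported : ∀ T, coeff T ≠ 0 → T ∈ SiegelLattice n N
  expansion : ∀ Z ∈ SiegelUpperHalfSpace n,
    HasSum (fun T : SiegelLattice n N =>
      coeff T * Complex.exp (2 * Real.pi * Complex.I *
        (((T : Matrix (Fin n) (Fin n) ℚ).map (fun q => (q : ℂ))) * Z).trace))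
      (toFun Z)


/-- A Hermitian cusp form (degree 2, class number one field): the Fourier
coefficients vanish off the positive definite part of the lattice. -/
def IsCuspHMF {d k : ℤ} (f : HermitianModularForm d k) : Prop :=
  ∀ H, ¬ H.PosDef → f.coeff H = 0

/-- `H0 = ord_p f`: `H0` is the minimal element of `Λ₂(K)`, in the lexicographic
order `lexLt`, whose Fourier coefficient is not divisible by `p`. -/
def IsOrdP (p : ℕ) {d k : ℤ} (f : HermitianModularForm d k)
    (H0 : Matrix (Fin 2) (Fin 2) ℂ) : Prop :=
  H0 ∈ HermLattice d ∧ ¬ ModCongr p 1 (f.coeff H0) 0 ∧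
    ∀ H ∈ HermLattice d, lexLt H H0 → ModCongr p 1 (f.coeff H) 0

/-! ### Arithmetic of the ring of integers -/

/-- The second basis element `(d + √d)/2` of the ring of integers. -/
def omegaD (d : ℤ) : ℂ := ((d : ℂ) + sqrtD d) / 2

/-- The norm form of the basis `1, (d + √d)/2`. -/
def normForm (d a b : ℤ) : ℤ := a ^ 2 + d * a * b + (d ^ 2 - d) / 4 * b ^ 2

lemma mem_ringInt {d : ℤ} {z : ℂ} :
    z ∈ ringInt d ↔ ∃ a b : ℤ, z = (a : ℂ) + (b : ℂ) * omegaD d := Iff.rfl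

lemma sqrtD_sq {d : ℤ} (hd : d = -4 ∨ d = -3) : sqrtD d ^ 2 = d := by
  have h : (0 : ℝ) ≤ -d := by rcases hd with rfl | rfl <;> norm_num
  have h2 : ((Real.sqrt (-d) : ℝ) : ℂ) ^ 2 = -d := by
    rw [← Complex.ofReal_pow, Real.sq_sqrt h]; push_cast; ring
  rw [sqrtD, mul_pow, h2, Complex.I_sq]; ring

lemma conj_sqrtD (d : ℤ) : (starRingEnd ℂ) (sqrtD d) = -sqrtD d := by
  simp [sqrtD]

lemma sqrtD_ne_zero {d : ℤ} (hd : d = -4 ∨ d = -3) : sqrtD d ≠ 0 := by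
  intro h
  have := sqrtD_sq hd
  rw [h] at this
  rcases hd with rfl | rfl <;> norm_num at this

lemma omegaD_sq {d : ℤ} (hd : d = -4 ∨ d = -3) :
    omegaD d ^ 2 = d * omegaD d - ((d ^ 2 - d) / 4 : ℤ) := by
  have h := sqrtD_sq hd
  have h4 : (((d ^ 2 - d) / 4 : ℤ) : ℂ) = (d ^ 2 - d) / 4 := by
    rcases hd with rfl | rfl <;> norm_num
  rw [h4, omegaD]
  linear_combination h / 4

lemma conj_omegaD (d : ℤ) : (starRingEnd ℂ) (omegaD d) = d - omegaD d := by
  simp only [omegaD, map_div₀, map_add, conj_sqrtD, map_intCast, map_ofNat]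
  ring

lemma sqrtD_eq (d : ℤ) : sqrtD d = 2 * omegaD d - d := by
  simp only [omegaD]; ring

lemma omegaD_im {d : ℤ} (hd : d = -4 ∨ d = -3) : 0 < (omegaD d).im := by
  have h : (0 : ℝ) < -d := by rcases hd with rfl | rfl <;> norm_num
  have : (omegaD d).im = Real.sqrt (-d) / 2 := by
    simp [omegaD, sqrtD]
  rw [this]
  have := Real.sqrt_pos.mpr h
  positivity

lemma ringInt_coord_injective {d : ℤ} (hd : d = -4 ∨ d = -3) {a b a' b' : ℤ}
    (h : (a : ℂ) + b * omegaD d = a' + b' * omegaD d) : a = a' ∧ b = b' := by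
  have him := congrArg Complex.im h
  have hw := omegaD_im hd
  simp only [Complex.add_im, Complex.intCast_im, Complex.mul_im, Complex.intCast_re, zero_mul,
    add_zero, zero_add] at him
  have hb : b = b' := by exact_mod_cast mul_right_cancel₀ hw.ne' him
  subst hb
  exact ⟨by exact_mod_cast add_right_cancel h, rfl⟩

lemma ringInt_int (d n : ℤ) : (n : ℂ) ∈ ringInt d := ⟨n, 0, by simp⟩
lemma ringInt_zero (d : ℤ) : (0 : ℂ) ∈ ringInt d := ⟨0, 0, by simp⟩
lemma ringInt_one (d : ℤ) : (1 : ℂ) ∈ ringInt d := ⟨1, 0, by simp⟩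

lemma ringInt_add {d : ℤ} {x y : ℂ} (hx : x ∈ ringInt d) (hy : y ∈ ringInt d) :
    x + y ∈ ringInt d := by
  obtain ⟨a, b, rfl⟩ := hx
  obtain ⟨a', b', rfl⟩ := hy
  exact ⟨a + a', b + b', by push_cast; ring⟩

lemma ringInt_neg {d : ℤ} {x : ℂ} (hx : x ∈ ringInt d) : -x ∈ ringInt d := by
  obtain ⟨a, b, rfl⟩ := hx
  exact ⟨-a, -b, by push_cast; ring⟩

lemma ringInt_mul {d : ℤ} (hd : d = -4 ∨ d = -3) {x y : ℂ} (hx : x ∈ ringInt d)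
    (hy : y ∈ ringInt d) : x * y ∈ ringInt d := by
  obtain ⟨a, b, rfl⟩ := mem_ringInt.1 hx
  obtain ⟨a', b', rfl⟩ := mem_ringInt.1 hy
  refine mem_ringInt.2 ⟨a * a' - b * b' * ((d ^ 2 - d) / 4), a * b' + b * a' + b * b' * d, ?_⟩
  push_cast
  linear_combination (b * b' : ℂ) * omegaD_sq hd

lemma ringInt_conj {d : ℤ} {x : ℂ} (hx : x ∈ ringInt d) :
    (starRingEnd ℂ) x ∈ ringInt d := by
  obtain ⟨a, b, rfl⟩ := mem_ringInt.1 hx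
  refine mem_ringInt.2 ⟨a + b * d, -b, ?_⟩
  simp only [map_add, map_mul, map_intCast, conj_omegaD]
  push_cast; ring

lemma ringInt_sqrtD (d : ℤ) : sqrtD d ∈ ringInt d :=
  mem_ringInt.2 ⟨-d, 2, by rw [sqrtD_eq]; push_cast; ring⟩

lemma ringInt_mul_conj {d : ℤ} (hd : d = -4 ∨ d = -3) (a b : ℤ) :
    ((a : ℂ) + b * omegaD d) * (starRingEnd ℂ) ((a : ℂ) + b * omegaD d) = normForm d a b := by
  simp only [map_add, map_mul, map_intCast, conj_omegaD, normForm]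
  push_cast
  linear_combination (-(b : ℂ) ^ 2) * omegaD_sq hd

lemma normSq_ringInt {d : ℤ} (hd : d = -4 ∨ d = -3) (a b : ℤ) :
    Complex.normSq ((a : ℂ) + b * omegaD d) = normForm d a b := by
  have h := ringInt_mul_conj hd a b
  rw [Complex.mul_conj] at h
  exact_mod_cast h

lemma normSq_nat {d : ℤ} (hd : d = -4 ∨ d = -3) {x : ℂ} (hx : x ∈ ringInt d) :
    ∃ n : ℕ, Complex.normSq x = n := by
  obtain ⟨a, b, rfl⟩ := mem_ringInt.1 hx
  have h := normSq_ringInt hd a b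
  have h0 : 0 ≤ normForm d a b := by exact_mod_cast h ▸ Complex.normSq_nonneg _
  refine ⟨(normForm d a b).toNat, ?_⟩
  rw [h]
  exact_mod_cast (congrArg (Int.cast : ℤ → ℝ) (Int.toNat_of_nonneg h0)).symm

lemma one_le_normSq {d : ℤ} (hd : d = -4 ∨ d = -3) {x : ℂ} (hx : x ∈ ringInt d) (h0 : x ≠ 0) :
    1 ≤ Complex.normSq x := by
  obtain ⟨n, hn⟩ := normSq_nat hd hx
  have := Complex.normSq_pos.2 h0
  rw [hn] at this ⊢
  exact_mod_cast this

lemma ringInt_approx {d : ℤ} (hd : d = -4 ∨ d = -3) (y : ℂ) :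
    ∃ q ∈ ringInt d, Complex.normSq (y - q) < 1 := by
  set w := (omegaD d).im with hw
  have hwpos : 0 < w := omegaD_im hd
  have hw2 : w ^ 2 ≤ 1 := by
    have : w = Real.sqrt (-d) / 2 := by simp [hw, omegaD, sqrtD]
    have h : (0 : ℝ) ≤ -d := by rcases hd with rfl | rfl <;> norm_num
    rw [this, div_pow, Real.sq_sqrt h]
    rcases hd with rfl | rfl <;> norm_num
  set b := round (y.im / w) with hb
  set a := round (y.re - b * (omegaD d).re) with ha
  refine ⟨a + b * omegaD d, ⟨a, b, rfl⟩, ?_⟩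
  have h1 := abs_sub_round (y.im / w)
  have h2 := abs_sub_round (y.re - b * (omegaD d).re)
  rw [← hb] at h1
  rw [← ha] at h2
  have him : (y - (a + b * omegaD d)).im = (y.im / w - b) * w := by
    simp [← hw]; field_simp
  have hre : (y - (a + b * omegaD d)).re = y.re - b * (omegaD d).re - a := by
    simp; ring
  rw [Complex.normSq_apply, him, hre]
  have h1' : (y.im / w - b) ^ 2 ≤ 1 / 4 := by
    rw [← sq_abs]; nlinarith [abs_nonneg (y.im / w - b)]
  have h2' : (y.re - b * (omegaD d).re - a) ^ 2 ≤ 1 / 4 := by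
    rw [← sq_abs]; nlinarith [abs_nonneg (y.re - b * (omegaD d).re - a)]
  nlinarith [sq_nonneg w, sq_nonneg (y.im / w - b)]

lemma ringInt_euclid {d : ℤ} (hd : d = -4 ∨ d = -3) (a : ℂ) {b : ℂ} (hb : b ≠ 0) :
    ∃ q ∈ ringInt d, Complex.normSq (a - q * b) < Complex.normSq b := by
  obtain ⟨q, hq, h⟩ := ringInt_approx hd (a / b)
  refine ⟨q, hq, ?_⟩
  have : a - q * b = (a / b - q) * b := by field_simp
  rw [this, Complex.normSq_mul]
  have := Complex.normSq_pos.2 hb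
  nlinarith

/-! ### Generators of the Hermitian modular group -/

/-- Translation matrices. -/
def translM (S : Matrix (Fin 2) (Fin 2) ℂ) : Matrix (Fin 2 ⊕ Fin 2) (Fin 2 ⊕ Fin 2) ℂ :=
  fromBlocks 1 S 0 1

/-- Block diagonal matrices. -/
def diagM (U V : Matrix (Fin 2) (Fin 2) ℂ) : Matrix (Fin 2 ⊕ Fin 2) (Fin 2 ⊕ Fin 2) ℂ :=
  fromBlocks U 0 0 V

/-- The inversion in the first diagonal variable. -/
def invM : Matrix (Fin 2 ⊕ Fin 2) (Fin 2 ⊕ Fin 2) ℂ :=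
  fromBlocks !![0, 0; 0, 1] !![-1, 0; 0, 0] !![1, 0; 0, 0] !![0, 0; 0, 1]

/-- Products of translations, block diagonal matrices and the partial inversion. -/
inductive IsGenerated (d : ℤ) : Matrix (Fin 2 ⊕ Fin 2) (Fin 2 ⊕ Fin 2) ℂ → Prop
  | transl (S) (hS : S.IsHermitian) (hO : ∀ i j, S i j ∈ ringInt d) : IsGenerated d (translM S)
  | diag (U V) (hU : ∀ i j, U i j ∈ ringInt d) (hV : ∀ i j, V i j ∈ ringInt d)
      (h : Uᴴ * V = 1) : IsGenerated d (diagM U V)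
  | inv : IsGenerated d invM
  | mul (M N) : IsGenerated d M → IsGenerated d N → IsGenerated d (M * N)

lemma hermitian_group_mul {d : ℤ} (hd : d = -4 ∨ d = -3)
    {M N : Matrix (Fin 2 ⊕ Fin 2) (Fin 2 ⊕ Fin 2) ℂ}
    (hM : M ∈ HermitianModularGroup d) (hN : N ∈ HermitianModularGroup d) :
    M * N ∈ HermitianModularGroup d := by
  refine ⟨fun i j => ?_, ?_⟩
  · rw [Matrix.mul_apply]
    exact Finset.sum_induction _ (· ∈ ringInt d) (fun _ _ => ringInt_add) (ringInt_zero d)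
      (fun k _ => ringInt_mul hd (hM.1 _ _) (hN.1 _ _))
  · calc (M * N)ᴴ * J2 * (M * N) = Nᴴ * (Mᴴ * J2 * M) * N := by
          simp only [conjTranspose_mul, Matrix.mul_assoc]
      _ = J2 := by rw [hM.2, hN.2]

lemma fromBlocks_mem_ringInt {d : ℤ} {A B C D : Matrix (Fin 2) (Fin 2) ℂ}
    (hA : ∀ i j, A i j ∈ ringInt d) (hB : ∀ i j, B i j ∈ ringInt d)
    (hC : ∀ i j, C i j ∈ ringInt d) (hD : ∀ i j, D i j ∈ ringInt d) :
    ∀ i j, fromBlocks A B C D i j ∈ ringInt d := by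
  rintro (i | i) (j | j) <;> simp [hA, hB, hC, hD]

lemma ringInt_matrix_one (d : ℤ) (i j : Fin 2) :
    (1 : Matrix (Fin 2) (Fin 2) ℂ) i j ∈ ringInt d := by
  rw [Matrix.one_apply]; split_ifs
  exacts [ringInt_one d, ringInt_zero d]

lemma ringInt_matrix_zero (d : ℤ) (i j : Fin 2) :
    (0 : Matrix (Fin 2) (Fin 2) ℂ) i j ∈ ringInt d := ringInt_zero d

lemma ringInt_matrix_of {d : ℤ} {a b c e : ℂ} (ha : a ∈ ringInt d) (hb : b ∈ ringInt d)
    (hc : c ∈ ringInt d) (he : e ∈ ringInt d) (i j : Fin 2) :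
    !![a, b; c, e] i j ∈ ringInt d := by
  fin_cases i <;> fin_cases j <;> simpa

lemma translM_mem {d : ℤ} {S : Matrix (Fin 2) (Fin 2) ℂ} (hS : S.IsHermitian)
    (hO : ∀ i j, S i j ∈ ringInt d) : translM S ∈ HermitianModularGroup d := by
  refine ⟨fromBlocks_mem_ringInt (ringInt_matrix_one d) hO (ringInt_matrix_zero d)
    (ringInt_matrix_one d), ?_⟩
  simp [translM, J2, fromBlocks_conjTranspose, fromBlocks_multiply, hS.eq]

lemma diagM_mem {d : ℤ} {U V : Matrix (Fin 2) (Fin 2) ℂ}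
    (hU : ∀ i j, U i j ∈ ringInt d) (hV : ∀ i j, V i j ∈ ringInt d)
    (h : Uᴴ * V = 1) : diagM U V ∈ HermitianModularGroup d := by
  refine ⟨fromBlocks_mem_ringInt hU (ringInt_matrix_zero d) (ringInt_matrix_zero d) hV, ?_⟩
  have h' : Vᴴ * U = 1 := by simpa using congrArg conjTranspose h
  simp [diagM, J2, fromBlocks_conjTranspose, fromBlocks_multiply, h, h']

lemma invM_mem (d : ℤ) : invM ∈ HermitianModularGroup d := by
  refine ⟨fromBlocks_mem_ringInt ?_ ?_ ?_ ?_, ?_⟩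
  · exact ringInt_matrix_of (ringInt_zero d) (ringInt_zero d) (ringInt_zero d) (ringInt_one d)
  · exact ringInt_matrix_of (ringInt_neg (ringInt_one d)) (ringInt_zero d) (ringInt_zero d)
      (ringInt_zero d)
  · exact ringInt_matrix_of (ringInt_one d) (ringInt_zero d) (ringInt_zero d) (ringInt_zero d)
  · exact ringInt_matrix_of (ringInt_zero d) (ringInt_zero d) (ringInt_zero d) (ringInt_one d)
  · rw [invM, J2, fromBlocks_conjTranspose, fromBlocks_multiply, fromBlocks_multiply]
    congr 1 <;> ext i j <;> fin_cases i <;> fin_cases j <;>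
      simp [Matrix.mul_apply, Fin.sum_univ_two]

lemma IsGenerated.mem {d : ℤ} (hd : d = -4 ∨ d = -3)
    {M : Matrix (Fin 2 ⊕ Fin 2) (Fin 2 ⊕ Fin 2) ℂ} (h : IsGenerated d M) :
    M ∈ HermitianModularGroup d := by
  induction h with
  | transl S hS hO => exact translM_mem hS hO
  | diag U V hU hV h => exact diagM_mem hU hV h
  | inv => exact invM_mem d
  | mul M N _ _ h1 h2 => exact hermitian_group_mul hd h1 h2

lemma IsGenerated.exists_inv {d : ℤ}
    {M : Matrix (Fin 2 ⊕ Fin 2) (Fin 2 ⊕ Fin 2) ℂ} (h : IsGenerated d M) :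
    ∃ N, IsGenerated d N ∧ N * M = 1 := by
  induction h with
  | transl S hS hO =>
    refine ⟨translM (-S), .transl _ hS.neg fun i j => ringInt_neg (hO i j), ?_⟩
    simp [translM, fromBlocks_multiply]
  | diag U V hU hV h =>
    refine ⟨diagM Vᴴ Uᴴ, .diag _ _ (fun i j => ringInt_conj (hV j i))
      (fun i j => ringInt_conj (hU j i)) ?_, ?_⟩
    · rw [conjTranspose_conjTranspose]; exact mul_eq_one_comm.1 h
    · have h' : Vᴴ * U = 1 := by simpa using congrArg conjTranspose h
      simp [diagM, fromBlocks_multiply, h, h']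
  | inv =>
    refine ⟨invM * (invM * invM), .mul _ _ .inv (.mul _ _ .inv .inv), ?_⟩
    simp only [invM, fromBlocks_multiply]
    rw [← fromBlocks_one]
    congr 1 <;> ext i j <;> fin_cases i <;> fin_cases j <;>
      simp
  | mul M N _ _ h1 h2 =>
    obtain ⟨M', hM', hM⟩ := h1
    obtain ⟨N', hN', hN⟩ := h2
    refine ⟨N' * M', .mul _ _ hN' hM', ?_⟩
    rw [Matrix.mul_assoc, ← Matrix.mul_assoc M', hM, Matrix.one_mul, hN]

lemma IsGenerated.of_mul_left {d : ℤ} {g M : Matrix (Fin 2 ⊕ Fin 2) (Fin 2 ⊕ Fin 2) ℂ}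
    (hg : IsGenerated d g) (h : IsGenerated d (g * M)) : IsGenerated d M := by
  obtain ⟨N, hN, hNg⟩ := hg.exists_inv
  have := IsGenerated.mul _ _ hN h
  rwa [← Matrix.mul_assoc, hNg, Matrix.one_mul] at this

/-- The coordinate exchange. -/
def swapM : Matrix (Fin 2 ⊕ Fin 2) (Fin 2 ⊕ Fin 2) ℂ := diagM !![0, 1; 1, 0] !![0, 1; 1, 0]

lemma isGenerated_swapM (d : ℤ) : IsGenerated d swapM := by
  have h := ringInt_matrix_of (ringInt_zero d) (ringInt_one d) (ringInt_one d) (ringInt_zero d)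
  refine .diag _ _ h h ?_
  ext i j; fin_cases i <;> fin_cases j <;> simp [Matrix.mul_apply, Fin.sum_univ_two]

/-- The inversion in the second diagonal variable. -/
def invM' : Matrix (Fin 2 ⊕ Fin 2) (Fin 2 ⊕ Fin 2) ℂ :=
  fromBlocks !![1, 0; 0, 0] !![0, 0; 0, -1] !![0, 0; 0, 1] !![1, 0; 0, 0]

lemma isGenerated_invM' (d : ℤ) : IsGenerated d invM' := by
  have : invM' = swapM * (invM * swapM) := by
    simp only [invM', invM, swapM, diagM, fromBlocks_multiply]
    congr 1 <;> ext i j <;> fin_cases i <;> fin_cases j <;>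
      simp
  rw [this]
  exact .mul _ _ (isGenerated_swapM d) (.mul _ _ .inv (isGenerated_swapM d))

lemma isGenerated_J2 (d : ℤ) : IsGenerated d J2 := by
  have : J2 = invM * invM' := by
    simp only [invM', invM, J2, fromBlocks_multiply]
    congr 1 <;> ext i j <;> fin_cases i <;> fin_cases j <;>
      simp
  rw [this]
  exact .mul _ _ .inv (isGenerated_invM' d)

/-- Simultaneous Euclidean reduction of a vector by an integral invertible matrix. -/
lemma exists_reduce_pair {d : ℤ} (hd : d = -4 ∨ d = -3) {a b : ℂ} (ha : a ∈ ringInt d)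
    (hb : b ∈ ringInt d) :
    ∃ U V : Matrix (Fin 2) (Fin 2) ℂ, (∀ i j, U i j ∈ ringInt d) ∧ (∀ i j, V i j ∈ ringInt d) ∧
      Uᴴ * V = 1 ∧ V 1 0 * a + V 1 1 * b = 0 := by
  obtain ⟨n, hn⟩ := normSq_nat hd hb
  induction n using Nat.strong_induction_on generalizing a b with
  | _ n ih =>
    by_cases hb0 : b = 0
    · exact ⟨1, 1, ringInt_matrix_one d, ringInt_matrix_one d, by simp, by simp [hb0]⟩
    · obtain ⟨q, hq, hlt⟩ := ringInt_euclid hd a hb0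
      have hr : a - q * b ∈ ringInt d := by
        rw [sub_eq_add_neg]; exact ringInt_add ha (ringInt_neg (ringInt_mul hd hq hb))
      obtain ⟨m, hm⟩ := normSq_nat hd hr
      have hmn : m < n := by rw [hm, hn] at hlt; exact_mod_cast hlt
      obtain ⟨U, V, hU, hV, hUV, h0⟩ := ih m hmn hb hr hm
      have hmul : ∀ X Y : Matrix (Fin 2) (Fin 2) ℂ, (∀ i j, X i j ∈ ringInt d) →
          (∀ i j, Y i j ∈ ringInt d) → ∀ i j, (X * Y) i j ∈ ringInt d := by
        intro X Y hX hY i j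
        rw [Matrix.mul_apply]
        exact Finset.sum_induction _ (· ∈ ringInt d) (fun _ _ => ringInt_add) (ringInt_zero d)
          (fun k _ => ringInt_mul hd (hX _ _) (hY _ _))
      refine ⟨U * !![(starRingEnd ℂ) q, 1; 1, 0], V * !![0, 1; 1, -q], hmul _ _ hU
        (ringInt_matrix_of (ringInt_conj hq) (ringInt_one d) (ringInt_one d) (ringInt_zero d)),
        hmul _ _ hV (ringInt_matrix_of (ringInt_zero d) (ringInt_one d) (ringInt_one d)
          (ringInt_neg hq)), ?_, ?_⟩
      · rw [conjTranspose_mul, Matrix.mul_assoc, ← Matrix.mul_assoc Uᴴ, hUV, Matrix.one_mul]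
        ext i j; fin_cases i <;> fin_cases j <;> simp [Matrix.mul_apply, Fin.sum_univ_two]
      · simp [Matrix.mul_apply, Fin.sum_univ_two]
        linear_combination h0

/-- The entries of the relation `ᵗM̄ J₂ M = J₂`. -/
lemma hermitian_group_entry {d : ℤ} {M : Matrix (Fin 2 ⊕ Fin 2) (Fin 2 ⊕ Fin 2) ℂ}
    (hM : M ∈ HermitianModularGroup d) (i j : Fin 2 ⊕ Fin 2) :
    (starRingEnd ℂ) (M (.inr 0) i) * M (.inl 0) j + (starRingEnd ℂ) (M (.inr 1) i) * M (.inl 1) j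
      - (starRingEnd ℂ) (M (.inl 0) i) * M (.inr 0) j
      - (starRingEnd ℂ) (M (.inl 1) i) * M (.inr 1) j = J2 i j := by
  have h := congrFun (congrFun hM.2 i) j
  rw [← h]
  simp only [J2, Matrix.mul_apply, Fintype.sum_sum_type, Fin.sum_univ_two, conjTranspose_apply,
    fromBlocks_apply₁₁, fromBlocks_apply₁₂, fromBlocks_apply₂₁, fromBlocks_apply₂₂, RCLike.star_def]
  simp
  ring

lemma exists_int_reduce {a c : ℂ} (hc : c ≠ 0)
    (h : (starRingEnd ℂ) c * a = (starRingEnd ℂ) a * c) :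
    ∃ s : ℤ, normSq (a - s * c) < normSq c := by
  obtain ⟨r, hr⟩ : ∃ r : ℝ, a = r * c := by
    refine ⟨((starRingEnd ℂ) c * a).re / normSq c, ?_⟩
    have hreal : ((((starRingEnd ℂ) c * a).re : ℝ) : ℂ) = (starRingEnd ℂ) c * a := by
      refine Complex.conj_eq_iff_re.1 ?_
      rw [map_mul, Complex.conj_conj, mul_comm, h]
    have hn : (normSq c : ℂ) = c * (starRingEnd ℂ) c := (Complex.mul_conj c).symm
    have h0 : (starRingEnd ℂ) c ≠ 0 := by simpa using hc
    rw [Complex.ofReal_div, hreal, hn]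
    field_simp
  refine ⟨round r, ?_⟩
  have : a - (round r : ℤ) * c = ((r - round r : ℝ) : ℂ) * c := by
    rw [hr]; push_cast; ring
  rw [this, normSq_mul, normSq_ofReal]
  have h1 := abs_sub_round r
  have h2 := normSq_pos.2 hc
  have h3 : (r - round r) * (r - round r) ≤ 1 / 4 := by
    rw [← abs_mul_abs_self]; nlinarith [abs_nonneg (r - round r)]
  nlinarith

lemma isGenerated_of_lower_left_zero {d : ℤ} (hd : d = -4 ∨ d = -3)
    {M : Matrix (Fin 2 ⊕ Fin 2) (Fin 2 ⊕ Fin 2) ℂ}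
    (hM : M ∈ HermitianModularGroup d) (h0 : M.toBlocks₂₁ = 0) : IsGenerated d M := by
  obtain ⟨A, B, D, rfl⟩ : ∃ A B D, M = fromBlocks A B 0 D :=
    ⟨_, _, _, by rw [← h0, fromBlocks_toBlocks]⟩
  have hrel : Aᴴ * D = 1 := by
    have h := hM.2
    simp only [J2, fromBlocks_conjTranspose, fromBlocks_multiply] at h
    have := congrArg toBlocks₁₂ h
    simpa using this
  have hrel' : Dᴴ * A = 1 := by simpa using congrArg conjTranspose hrel
  have hg : IsGenerated d (diagM Dᴴ Aᴴ) :=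
    .diag _ _ (fun i j => ringInt_conj (hM.1 (.inr j) (.inr i)))
      (fun i j => ringInt_conj (hM.1 (.inl j) (.inl i)))
      (by rw [conjTranspose_conjTranspose]; exact mul_eq_one_comm.1 hrel)
  refine hg.of_mul_left ?_
  have hmem := hermitian_group_mul hd (hg.mem hd) hM
  have he : diagM Dᴴ Aᴴ * fromBlocks A B 0 D = translM (Dᴴ * B) := by
    simp [diagM, translM, fromBlocks_multiply, hrel, hrel']
  rw [he] at hmem ⊢
  refine .transl _ ?_ fun i j => by simpa [translM] using hmem.1 (.inl i) (.inr j)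
  have h := hmem.2
  simp only [J2, translM, fromBlocks_conjTranspose, fromBlocks_multiply] at h
  have h2 := congrArg toBlocks₂₂ h
  simp only [toBlocks_fromBlocks₂₂] at h2
  generalize Dᴴ * B = S at *
  simp only [conjTranspose_one, Matrix.one_mul, Matrix.mul_one, Matrix.mul_zero,
    zero_add, add_zero, Matrix.mul_neg] at h2
  rw [Matrix.IsHermitian]
  exact (sub_eq_zero.1 ((sub_eq_add_neg _ _).trans h2)).symm

lemma normSq_reduce_pair_lt {d : ℤ} {c₀ c₁ : ℂ} {U V : Matrix (Fin 2) (Fin 2) ℂ}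
    (hd : d = -4 ∨ d = -3) (hU : ∀ i j, U i j ∈ ringInt d) (hUV : Uᴴ * V = 1)
    (h0 : V 1 0 * c₀ + V 1 1 * c₁ = 0) {n : ℝ} (hn : 0 < n) (h₀ : normSq c₀ < n)
    (h₁ : normSq c₁ < n) : normSq (V 0 0 * c₀ + V 0 1 * c₁) < n := by
  set g := V 0 0 * c₀ + V 0 1 * c₁ with hg
  have e : ∀ i j, (Uᴴ * V) i j = (1 : Matrix (Fin 2) (Fin 2) ℂ) i j := fun i j => by rw [hUV]
  have e00 := e 0 0
  have e01 := e 0 1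
  have e10 := e 1 0
  have e11 := e 1 1
  simp [Matrix.mul_apply, Fin.sum_univ_two] at e00 e01 e10 e11
  have hc0 : c₀ = (starRingEnd ℂ) (U 0 0) * g := by
    linear_combination (norm := skip) (-c₀) * e00 - c₁ * e01 + (starRingEnd ℂ) (U 1 0) * h0
    rw [hg]; ring
  have hc1 : c₁ = (starRingEnd ℂ) (U 0 1) * g := by
    linear_combination (norm := skip) (-c₀) * e10 - c₁ * e11 + (starRingEnd ℂ) (U 1 1) * h0
    rw [hg]; ring
  have key : ∀ u ∈ ringInt d, ∀ c : ℂ, c = (starRingEnd ℂ) u * g → c ≠ 0 → normSq c < n →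
      normSq g < n := by
    intro u hu c hc hc' hlt
    have hu0 : u ≠ 0 := by rintro rfl; simp [hc] at hc'
    have := one_le_normSq hd hu hu0
    rw [hc, normSq_mul, normSq_conj] at hlt
    nlinarith [normSq_nonneg g]
  by_cases hz : c₀ = 0
  · by_cases hz' : c₁ = 0
    · simpa [hg, hz, hz'] using hn
    · exact key _ (hU 0 1) _ hc1 hz' h₁
  · exact key _ (hU 0 0) _ hc0 hz h₀

/-- The first column of the lower left block can be cleared. -/
lemma exists_clear_column {d : ℤ} (hd : d = -4 ∨ d = -3) (n : ℕ) :
    ∀ M ∈ HermitianModularGroup d, normSq (M (.inr 0) (.inl 0)) < n →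
      normSq (M (.inr 1) (.inl 0)) < n →
      ∃ g, IsGenerated d g ∧ (g * M) (.inr 0) (.inl 0) = 0 ∧ (g * M) (.inr 1) (.inl 0) = 0 := by
  induction n with
  | zero => intro M _ h; exact absurd h (by simpa using normSq_nonneg _)
  | succ n ih =>
    intro M hM h₀ h₁
    obtain ⟨U, V, hU, hV, hUV, h0⟩ := exists_reduce_pair hd (hM.1 (.inr 0) (.inl 0))
      (hM.1 (.inr 1) (.inl 0))
    have hlt := normSq_reduce_pair_lt hd hU hUV h0
      (n := ((n + 1 : ℕ) : ℝ)) (by positivity) h₀ h₁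
    have hgen : IsGenerated d (diagM U V) := .diag U V hU hV hUV
    set N := diagM U V * M with hN
    have hNmem : N ∈ HermitianModularGroup d := hermitian_group_mul hd (hgen.mem hd) hM
    have hN0 : N (.inr 0) (.inl 0) = V 0 0 * M (.inr 0) (.inl 0) + V 0 1 * M (.inr 1) (.inl 0) := by
      simp [hN, diagM, Matrix.mul_apply, Fintype.sum_sum_type, Fin.sum_univ_two]
    have hN1 : N (.inr 1) (.inl 0) = 0 := by
      rw [← h0]
      simp [hN, diagM, Matrix.mul_apply, Fintype.sum_sum_type, Fin.sum_univ_two]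
    rw [← hN0] at hlt
    by_cases hc : N (.inr 0) (.inl 0) = 0
    · exact ⟨_, hgen, hc, hN1⟩
    have hiso := hermitian_group_entry hNmem (.inl 0) (.inl 0)
    simp only [hN1, map_zero, zero_mul, mul_zero, add_zero, sub_zero, J2, fromBlocks_apply₁₁,
      Matrix.zero_apply] at hiso
    obtain ⟨s, hs⟩ := exists_int_reduce hc (sub_eq_zero.1 hiso)
    obtain ⟨t, ht, hlt'⟩ := ringInt_euclid hd (N (.inl 1) (.inl 0)) hc
    set S : Matrix (Fin 2) (Fin 2) ℂ := !![(-s : ℂ), -(starRingEnd ℂ) t; -t, 0] with hS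
    have hSgen : IsGenerated d (translM S) := by
      refine .transl _ ?_ ?_
      · ext i j; fin_cases i <;> fin_cases j <;> simp [hS]
      · exact ringInt_matrix_of (by exact_mod_cast ringInt_int d (-s))
          (ringInt_neg (ringInt_conj ht)) (ringInt_neg ht) (ringInt_zero d)
    set P := J2 * (translM S * N) with hP
    have hPmem : P ∈ HermitianModularGroup d := hermitian_group_mul hd ((isGenerated_J2 d).mem hd)
      (hermitian_group_mul hd (hSgen.mem hd) hNmem)
    have hP0 : P (.inr 0) (.inl 0) = N (.inl 0) (.inl 0) - s * N (.inr 0) (.inl 0) := by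
      simp [hP, hS, J2, translM, Matrix.mul_apply, Fintype.sum_sum_type, Fin.sum_univ_two, hN1,
        Matrix.one_apply]
      ring
    have hP1 : P (.inr 1) (.inl 0) = N (.inl 1) (.inl 0) - t * N (.inr 0) (.inl 0) := by
      simp [hP, hS, J2, translM, Matrix.mul_apply, Fintype.sum_sum_type, Fin.sum_univ_two, hN1,
        Matrix.one_apply]
      ring
    have hle : normSq (N (.inr 0) (.inl 0)) ≤ n := by
      obtain ⟨m, hm⟩ := normSq_nat hd (hNmem.1 (.inr 0) (.inl 0))
      rw [hm] at hlt ⊢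
      have : m < n + 1 := by exact_mod_cast hlt
      exact_mod_cast Nat.lt_succ_iff.1 this
    obtain ⟨g, hg, hg0, hg1⟩ := ih P hPmem (by rw [hP0]; linarith) (by rw [hP1]; linarith)
    refine ⟨g * (J2 * (translM S * diagM U V)), .mul _ _ hg (.mul _ _ (isGenerated_J2 d)
      (.mul _ _ hSgen hgen)), ?_⟩
    have : g * (J2 * (translM S * diagM U V)) * M = g * P := by
      simp only [hP, hN, Matrix.mul_assoc]
    rw [this]
    exact ⟨hg0, hg1⟩

/-- A matrix whose first column is `(x, 0, 0, 0)` is generated. -/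
lemma isGenerated_of_first_column {d : ℤ} (hd : d = -4 ∨ d = -3) (n : ℕ) :
    ∀ M ∈ HermitianModularGroup d, M (.inl 1) (.inl 0) = 0 → M (.inr 0) (.inl 0) = 0 →
      M (.inr 1) (.inl 0) = 0 → normSq (M (.inr 1) (.inl 1)) < n → IsGenerated d M := by
  induction n with
  | zero => intro M _ _ _ _ h; exact absurd h (by simpa using normSq_nonneg _)
  | succ n ih =>
    intro M hM ha hc₀ hc₁ hlt
    have hx : M (.inl 0) (.inl 0) ≠ 0 := by
      intro h
      have := hermitian_group_entry hM (.inl 0) (.inr 0)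
      simp [ha, hc₀, hc₁, h, J2] at this
    have h01 : M (.inr 0) (.inl 1) = 0 := by
      have := hermitian_group_entry hM (.inl 0) (.inl 1)
      simpa [ha, hc₀, hc₁, hx, J2] using this
    by_cases hc : M (.inr 1) (.inl 1) = 0
    · refine isGenerated_of_lower_left_zero hd hM ?_
      ext i j; fin_cases i <;> fin_cases j <;> simp [toBlocks₂₁, hc, h01, hc₀, hc₁]
    have hiso := hermitian_group_entry hM (.inl 1) (.inl 1)
    simp only [h01, map_zero, zero_mul, mul_zero, zero_add, sub_zero, J2, fromBlocks_apply₁₁,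
      Matrix.zero_apply] at hiso
    obtain ⟨s, hs⟩ := exists_int_reduce hc (sub_eq_zero.1 hiso)
    set S : Matrix (Fin 2) (Fin 2) ℂ := !![0, 0; 0, (-s : ℂ)] with hS
    have hSgen : IsGenerated d (translM S) := by
      refine .transl _ ?_ ?_
      · ext i j; fin_cases i <;> fin_cases j <;> simp [hS]
      · exact ringInt_matrix_of (ringInt_zero d) (ringInt_zero d) (ringInt_zero d)
          (by exact_mod_cast ringInt_int d (-s))
    refine hSgen.of_mul_left ((isGenerated_invM' d).of_mul_left ?_)
    have hle : normSq (M (.inr 1) (.inl 1)) ≤ n := by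
      obtain ⟨m, hm⟩ := normSq_nat hd (hM.1 (.inr 1) (.inl 1))
      rw [hm] at hlt ⊢
      have : m < n + 1 := by exact_mod_cast hlt
      exact_mod_cast Nat.lt_succ_iff.1 this
    refine ih _ (hermitian_group_mul hd ((isGenerated_invM' d).mem hd)
      (hermitian_group_mul hd (hSgen.mem hd) hM)) ?_ ?_ ?_ ?_
    · simp [hS, invM', translM, Matrix.mul_apply, Fintype.sum_sum_type, Fin.sum_univ_two, hc₁]
    · simp [hS, invM', translM, Matrix.mul_apply, Fintype.sum_sum_type, Fin.sum_univ_two, hc₀]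
    · simp [hS, invM', translM, Matrix.mul_apply, Fintype.sum_sum_type, Fin.sum_univ_two, hc₁, ha,
        Matrix.one_apply]
    · have : (invM' * (translM S * M)) (.inr 1) (.inl 1) =
          M (.inl 1) (.inl 1) - s * M (.inr 1) (.inl 1) := by
        simp [hS, invM', translM, Matrix.mul_apply, Fintype.sum_sum_type, Fin.sum_univ_two,
          Matrix.one_apply]
        ring
      rw [this]; linarith

theorem isGenerated_of_mem {d : ℤ} (hd : d = -4 ∨ d = -3)
    {M : Matrix (Fin 2 ⊕ Fin 2) (Fin 2 ⊕ Fin 2) ℂ}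
    (hM : M ∈ HermitianModularGroup d) : IsGenerated d M := by
  obtain ⟨n, hn⟩ := exists_nat_gt (normSq (M (.inr 0) (.inl 0)) + normSq (M (.inr 1) (.inl 0)))
  have p0 := normSq_nonneg (M (.inr 0) (.inl 0))
  have p1 := normSq_nonneg (M (.inr 1) (.inl 0))
  obtain ⟨g, hg, h0, h1⟩ := exists_clear_column hd n M hM (by linarith) (by linarith)
  refine hg.of_mul_left ?_
  have hN : g * M ∈ HermitianModularGroup d := hermitian_group_mul hd (hg.mem hd) hM
  generalize g * M = N at *
  obtain ⟨U, V, hU, hV, hUV, h⟩ := exists_reduce_pair hd (hN.1 (.inl 0) (.inl 0))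
    (hN.1 (.inl 1) (.inl 0))
  have hgen : IsGenerated d (diagM V U) :=
    .diag V U hV hU (by simpa using congrArg conjTranspose hUV)
  refine hgen.of_mul_left ?_
  obtain ⟨m, hm⟩ := exists_nat_gt (normSq ((diagM V U * N) (.inr 1) (.inl 1)))
  refine isGenerated_of_first_column hd m _ (hermitian_group_mul hd (hgen.mem hd) hN) ?_ ?_ ?_ hm
  · rw [← h]
    simp [diagM, Matrix.mul_apply, Fintype.sum_sum_type, Fin.sum_univ_two]
  · simp [diagM, Matrix.mul_apply, Fintype.sum_sum_type, Fin.sum_univ_two, h0, h1]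
  · simp [diagM, Matrix.mul_apply, Fintype.sum_sum_type, Fin.sum_univ_two, h0, h1]

/-! ### Positivity of `2 × 2` Hermitian matrices -/

lemma hermitian_quadForm {A : Matrix (Fin 2) (Fin 2) ℂ} (hA : A.IsHermitian) (x : Fin 2 → ℂ) :
    star x ⬝ᵥ (A *ᵥ x) = ((A 0 0).re * normSq (x 0) + (A 1 1).re * normSq (x 1)
      + 2 * ((starRingEnd ℂ) (x 0) * A 0 1 * x 1).re : ℝ) := by
  have h00 : (((A 0 0).re : ℝ) : ℂ) = A 0 0 := Complex.conj_eq_iff_re.1 (hA.apply 0 0)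
  have h11 : (((A 1 1).re : ℝ) : ℂ) = A 1 1 := Complex.conj_eq_iff_re.1 (hA.apply 1 1)
  have h10 : A 1 0 = (starRingEnd ℂ) (A 0 1) := (hA.apply 1 0).symm
  have hre : ∀ u : ℂ, ((2 * u.re : ℝ) : ℂ) = u + (starRingEnd ℂ) u := fun u => by
    rw [Complex.add_conj]
  rw [ofReal_add, ofReal_add, ofReal_mul, ofReal_mul, hre, h00, h11, ← mul_conj, ← mul_conj]
  simp [dotProduct, Matrix.mulVec, Fin.sum_univ_two, h10]
  ring

lemma posDef_two_iff {A : Matrix (Fin 2) (Fin 2) ℂ} (hA : A.IsHermitian) :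
    A.PosDef ↔ 0 < (A 0 0).re ∧ normSq (A 0 1) < (A 0 0).re * (A 1 1).re := by
  have h00 : (((A 0 0).re : ℝ) : ℂ) = A 0 0 := Complex.conj_eq_iff_re.1 (hA.apply 0 0)
  have h11 : (((A 1 1).re : ℝ) : ℂ) = A 1 1 := Complex.conj_eq_iff_re.1 (hA.apply 1 1)
  have h10 : A 1 0 = (starRingEnd ℂ) (A 0 1) := (hA.apply 1 0).symm
  constructor
  · intro h
    refine ⟨(Complex.pos_iff.1 (h.diag_pos (i := 0))).1, ?_⟩
    have hd := h.det_pos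
    rw [det_fin_two, h10, mul_conj, ← h00, ← h11, ← ofReal_mul, ← ofReal_sub] at hd
    have := (Complex.pos_iff.1 hd).1
    simp only [ofReal_re] at this ⊢
    linarith
  · rintro ⟨h1, h2⟩
    refine PosDef.of_dotProduct_mulVec_pos hA fun {x} hx => ?_
    rw [hermitian_quadForm hA, Complex.zero_lt_real]
    have key : (A 0 0).re * ((A 0 0).re * normSq (x 0) + (A 1 1).re * normSq (x 1)
      + 2 * ((starRingEnd ℂ) (x 0) * A 0 1 * x 1).re) = normSq ((A 0 0).re * x 0 + A 0 1 * x 1)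
      + ((A 0 0).re * (A 1 1).re - normSq (A 0 1)) * normSq (x 1) := by
      simp [normSq_apply]; ring
    have hpos : 0 < normSq ((A 0 0).re * x 0 + A 0 1 * x 1)
      + ((A 0 0).re * (A 1 1).re - normSq (A 0 1)) * normSq (x 1) := by
      by_cases hx1 : x 1 = 0
      · have hx0 : x 0 ≠ 0 := fun h => hx (by ext i; fin_cases i <;> simp [h, hx1])
        simp only [hx1, mul_zero, add_zero, map_zero, normSq_pos]
        exact mul_ne_zero (by exact_mod_cast h1.ne') hx0
      · have := normSq_pos.2 hx1
        have := normSq_nonneg ((A 0 0).re * x 0 + A 0 1 * x 1)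
        have : 0 < (A 0 0).re * (A 1 1).re - normSq (A 0 1) := by linarith
        positivity
    rw [← key] at hpos
    exact (mul_pos_iff_of_pos_left h1).1 hpos

lemma posSemidef_two_iff {A : Matrix (Fin 2) (Fin 2) ℂ} (hA : A.IsHermitian) :
    A.PosSemidef ↔ 0 ≤ (A 0 0).re ∧ 0 ≤ (A 1 1).re ∧
      normSq (A 0 1) ≤ (A 0 0).re * (A 1 1).re := by
  have h00 : (((A 0 0).re : ℝ) : ℂ) = A 0 0 := Complex.conj_eq_iff_re.1 (hA.apply 0 0)
  have h11 : (((A 1 1).re : ℝ) : ℂ) = A 1 1 := Complex.conj_eq_iff_re.1 (hA.apply 1 1)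
  have h10 : A 1 0 = (starRingEnd ℂ) (A 0 1) := (hA.apply 1 0).symm
  constructor
  · intro h
    refine ⟨(Complex.nonneg_iff.1 (h.diag_nonneg (i := 0))).1,
      (Complex.nonneg_iff.1 (h.diag_nonneg (i := 1))).1, ?_⟩
    have hd := h.det_nonneg
    rw [det_fin_two, h10, mul_conj, ← h00, ← h11, ← ofReal_mul, ← ofReal_sub] at hd
    have := (Complex.nonneg_iff.1 hd).1
    simp only [ofReal_re] at this ⊢
    linarith
  · rintro ⟨h1, h3, h2⟩
    refine PosSemidef.of_dotProduct_mulVec_nonneg hA fun x => ?_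
    rw [hermitian_quadForm hA, Complex.zero_le_real]
    rcases h1.eq_or_lt with h1 | h1
    · have h0 : A 0 1 = 0 := by
        rw [← h1, zero_mul] at h2
        exact normSq_eq_zero.1 (le_antisymm h2 (normSq_nonneg _))
      have := normSq_nonneg (x 1)
      simp only [← h1, h0, mul_zero, zero_mul, zero_re, add_zero, zero_add]
      positivity
    have key : (A 0 0).re * ((A 0 0).re * normSq (x 0) + (A 1 1).re * normSq (x 1)
      + 2 * ((starRingEnd ℂ) (x 0) * A 0 1 * x 1).re) = normSq ((A 0 0).re * x 0 + A 0 1 * x 1)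
      + ((A 0 0).re * (A 1 1).re - normSq (A 0 1)) * normSq (x 1) := by
      simp [normSq_apply]; ring
    have hpos : 0 ≤ normSq ((A 0 0).re * x 0 + A 0 1 * x 1)
      + ((A 0 0).re * (A 1 1).re - normSq (A 0 1)) * normSq (x 1) := by
      have := normSq_nonneg (x 1)
      have := normSq_nonneg ((A 0 0).re * x 0 + A 0 1 * x 1)
      have : 0 ≤ (A 0 0).re * (A 1 1).re - normSq (A 0 1) := by linarith
      positivity
    rw [← key] at hpos
    exact (mul_nonneg_iff_of_pos_left h1).1 hpos

/-! ### The Hermitian upper half space -/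

lemma hermitian_imag (Z : Matrix (Fin 2) (Fin 2) ℂ) :
    ((Z - Zᴴ).map (fun w => w / (2 * Complex.I))).IsHermitian := by
  ext i j
  simp only [conjTranspose_apply, Matrix.map_apply, Matrix.sub_apply, RCLike.star_def, map_div₀,
    map_sub, map_mul, Complex.conj_conj, map_ofNat, conj_I]
  field_simp
  ring

lemma mem_upperHalfSpace_iff {Z : Matrix (Fin 2) (Fin 2) ℂ} :
    Z ∈ HermitianUpperHalfSpace ↔ 0 < (Z 0 0).im ∧
      normSq (Z 0 1 - (starRingEnd ℂ) (Z 1 0)) < 4 * ((Z 0 0).im * (Z 1 1).im) := by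
  have hd : ∀ i, (((Z - Zᴴ).map (fun w => w / (2 * Complex.I))) i i).re = (Z i i).im := by
    intro i
    have : Z i i - (starRingEnd ℂ) (Z i i) = (Z i i).im * (2 * I) := by
      rw [Complex.sub_conj]; push_cast; ring
    simp only [Matrix.map_apply, Matrix.sub_apply, conjTranspose_apply, RCLike.star_def, this]
    rw [mul_div_cancel_right₀ _ (by simp), ofReal_re]
  have h01 : normSq (((Z - Zᴴ).map (fun w => w / (2 * Complex.I))) 0 1) =
      normSq (Z 0 1 - (starRingEnd ℂ) (Z 1 0)) / 4 := by
    simp [Matrix.map_apply, normSq_mul]; norm_num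
  rw [HermitianUpperHalfSpace, Set.mem_ofPred_eq, posDef_two_iff (hermitian_imag Z), hd, hd, h01,
    div_lt_iff₀ (by norm_num)]
  simp only [mul_comm]

lemma upperHalfSpace_add {Z S : Matrix (Fin 2) (Fin 2) ℂ} (hZ : Z ∈ HermitianUpperHalfSpace)
    (hS : S.IsHermitian) : Z + S ∈ HermitianUpperHalfSpace := by
  have : Z + S - (Z + S)ᴴ = Z - Zᴴ := by
    rw [conjTranspose_add, hS.eq]; abel
  rw [HermitianUpperHalfSpace, Set.mem_ofPred_eq, this]
  exact hZ

lemma upperHalfSpace_conj {Z U : Matrix (Fin 2) (Fin 2) ℂ} (hZ : Z ∈ HermitianUpperHalfSpace)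
    (hU : IsUnit U) : U * Z * Uᴴ ∈ HermitianUpperHalfSpace := by
  have hm : ∀ X : Matrix (Fin 2) (Fin 2) ℂ, X.map (fun w => w / (2 * Complex.I)) =
      (2 * Complex.I)⁻¹ • X := by
    intro X; ext i j; simp [div_eq_inv_mul]
  have : (U * Z * Uᴴ - (U * Z * Uᴴ)ᴴ).map (fun w => w / (2 * Complex.I)) =
      U * (Z - Zᴴ).map (fun w => w / (2 * Complex.I)) * Uᴴ := by
    rw [hm, hm, conjTranspose_mul, conjTranspose_mul, conjTranspose_conjTranspose,
      Matrix.mul_smul, Matrix.smul_mul, Matrix.mul_sub, Matrix.sub_mul, Matrix.mul_assoc U Zᴴ]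
  rw [HermitianUpperHalfSpace, Set.mem_ofPred_eq, this]
  exact (IsUnit.posDef_star_right_conjugate_iff hU).2 hZ

/-- The partial inversion on the upper half space. -/
def partialInv (Z : Matrix (Fin 2) (Fin 2) ℂ) : Matrix (Fin 2) (Fin 2) ℂ :=
  !![-1 / Z 0 0, Z 0 1 / Z 0 0; Z 1 0 / Z 0 0, Z 1 1 - Z 0 1 * Z 1 0 / Z 0 0]

lemma upperHalfSpace_ne_zero {Z : Matrix (Fin 2) (Fin 2) ℂ} (hZ : Z ∈ HermitianUpperHalfSpace) :
    Z 0 0 ≠ 0 := by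
  intro h
  have := (mem_upperHalfSpace_iff.1 hZ).1
  simp [h] at this

lemma upperHalfSpace_partialInv {Z : Matrix (Fin 2) (Fin 2) ℂ} (hZ : Z ∈ HermitianUpperHalfSpace) :
    partialInv Z ∈ HermitianUpperHalfSpace := by
  have h0 := normSq_pos.2 (upperHalfSpace_ne_zero hZ)
  obtain ⟨h1, h2⟩ := mem_upperHalfSpace_iff.1 hZ
  refine mem_upperHalfSpace_iff.2 ⟨?_, ?_⟩
  · have : (partialInv Z 0 0).im = (Z 0 0).im / normSq (Z 0 0) := by
      simp [partialInv, neg_div]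
    rw [this]
    positivity
  · have key : 4 * ((partialInv Z 0 0).im * (partialInv Z 1 1).im) -
        normSq (partialInv Z 0 1 - (starRingEnd ℂ) (partialInv Z 1 0)) =
        (4 * ((Z 0 0).im * (Z 1 1).im) - normSq (Z 0 1 - (starRingEnd ℂ) (Z 1 0))) /
          normSq (Z 0 0) := by
      have hne := h0.ne'
      simp only [partialInv, Matrix.of_apply, cons_val_zero, cons_val_one, cons_val',
        normSq_apply, sub_re, sub_im, conj_re, conj_im, div_re, div_im, mul_re, mul_im, neg_im,
        neg_re, one_re, one_im, cons_val_fin_one] at hne ⊢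
      field_simp
      ring
    have : 0 < (4 * ((Z 0 0).im * (Z 1 1).im) - normSq (Z 0 1 - (starRingEnd ℂ) (Z 1 0))) /
          normSq (Z 0 0) := div_pos (by linarith) h0
    linarith

/-! ### Action of the generators -/

lemma matAct_mul {M N : Matrix (Fin 2 ⊕ Fin 2) (Fin 2 ⊕ Fin 2) ℂ} {Z : Matrix (Fin 2) (Fin 2) ℂ}
    (hN : (N.toBlocks₂₁ * Z + N.toBlocks₂₂).det ≠ 0) :
    (M * N).toBlocks₂₁ * Z + (M * N).toBlocks₂₂ =
      (M.toBlocks₂₁ * matAct N Z + M.toBlocks₂₂) * (N.toBlocks₂₁ * Z + N.toBlocks₂₂) ∧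
    matAct (M * N) Z = matAct M (matAct N Z) := by
  obtain ⟨A, B, C, D, rfl⟩ : ∃ A B C D, M = fromBlocks A B C D :=
    ⟨_, _, _, _, (fromBlocks_toBlocks M).symm⟩
  obtain ⟨A', B', C', D', rfl⟩ : ∃ A B C D, N = fromBlocks A B C D :=
    ⟨_, _, _, _, (fromBlocks_toBlocks N).symm⟩
  simp only [matAct, fromBlocks_multiply, toBlocks_fromBlocks₁₁, toBlocks_fromBlocks₁₂,
    toBlocks_fromBlocks₂₁, toBlocks_fromBlocks₂₂] at hN ⊢
  set P := C' * Z + D' with hP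
  have hu : IsUnit P.det := isUnit_iff_ne_zero.2 hN
  have key : ∀ X Y : Matrix (Fin 2) (Fin 2) ℂ, (X * A' + Y * C') * Z + (X * B' + Y * D') =
      (X * ((A' * Z + B') * P⁻¹) + Y) * P := by
    intro X Y
    rw [Matrix.add_mul _ Y P, Matrix.mul_assoc X _ P, Matrix.mul_assoc (A' * Z + B'),
      nonsing_inv_mul _ hu, Matrix.mul_one, hP]
    simp only [Matrix.mul_add, Matrix.add_mul, Matrix.mul_assoc]
    abel
  refine ⟨key C D, ?_⟩
  rw [key A B, key C D, Matrix.mul_inv_rev, ← Matrix.mul_assoc,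
    Matrix.mul_assoc _ P P⁻¹, mul_nonsing_inv _ hu, Matrix.mul_one]

lemma det_invM : invM.det = 1 := by
  have : invM = translM !![-1, 0; 0, 0] * (fromBlocks 1 0 !![1, 0; 0, 0] 1 *
      translM !![-1, 0; 0, 0]) := by
    simp only [invM, translM, fromBlocks_multiply, Matrix.one_fin_two]
    congr 1 <;> ext i j <;> fin_cases i <;> fin_cases j <;>
      simp
  rw [this, det_mul, det_mul]
  simp [translM]

lemma unit_pow {d : ℤ} (hd : d = -4 ∨ d = -3) {u : ℂ} (hu : u ∈ ringInt d)
    (h : normSq u = 1) : (d = -4 → u ^ 4 = 1) ∧ (d = -3 → u ^ 6 = 1) := by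
  obtain ⟨a, b, rfl⟩ := mem_ringInt.1 hu
  have hn : normForm d a b = 1 := by
    have := normSq_ringInt hd a b
    rw [h] at this; exact_mod_cast this.symm
  have h1 := ringInt_mul_conj hd a b
  rw [hn] at h1
  simp only [map_add, map_mul, map_intCast, conj_omegaD] at h1
  set u := (a : ℂ) + b * omegaD d with hu
  set s : ℤ := 2 * a + d * b with hs
  have hq : u ^ 2 = s * u - 1 := by
    have : (a : ℂ) + b * (d - omegaD d) = s - u := by rw [hs, hu]; push_cast; ring
    rw [this] at h1
    push_cast at h1
    linear_combination -h1
  have hsb : s ^ 2 - d * b ^ 2 = 4 := by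
    have h4 : 4 * normForm d a b = s ^ 2 - d * b ^ 2 := by
      rw [normForm, hs]; rcases hd with rfl | rfl <;> ring_nf
    omega
  have hs2 : s ^ 2 ≤ 4 := by rcases hd with rfl | rfl <;> nlinarith [sq_nonneg b]
  have hs_le : s ≤ 2 := by nlinarith
  have hs_ge : -2 ≤ s := by nlinarith
  constructor
  · rintro rfl
    have heven : s = -2 ∨ s = 0 ∨ s = 2 := by omega
    rcases heven with h | h | h <;> rw [h] at hq
    · have : (u + 1) ^ 2 = 0 := by push_cast at hq; linear_combination hq
      have : u = -1 := by linear_combination pow_eq_zero_iff (two_ne_zero) |>.1 this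
      rw [this]; norm_num
    · push_cast at hq; linear_combination (u ^ 2 - 1) * hq
    · have : (u - 1) ^ 2 = 0 := by push_cast at hq; linear_combination hq
      have : u = 1 := by linear_combination pow_eq_zero_iff (two_ne_zero) |>.1 this
      rw [this]; norm_num
  · rintro rfl
    have hs0 : s ≠ 0 := by
      intro h; rw [h] at hsb; omega
    have : s = -2 ∨ s = -1 ∨ s = 1 ∨ s = 2 := by omega
    rcases this with h | h | h | h <;> rw [h] at hq <;> push_cast at hq
    · have : (u + 1) ^ 2 = 0 := by linear_combination hq
      have : u = -1 := by linear_combination pow_eq_zero_iff (two_ne_zero) |>.1 this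
      rw [this]; norm_num
    · have : u ^ 3 = 1 := by linear_combination (u - 1) * hq
      linear_combination (u ^ 3 + 1) * this
    · have : u ^ 3 = -1 := by linear_combination (u + 1) * hq
      linear_combination (u ^ 3 - 1) * this
    · have : (u - 1) ^ 2 = 0 := by linear_combination hq
      have : u = 1 := by linear_combination pow_eq_zero_iff (two_ne_zero) |>.1 this
      rw [this]; norm_num

lemma ringInt_det {d : ℤ} (hd : d = -4 ∨ d = -3) {U : Matrix (Fin 2) (Fin 2) ℂ}
    (hU : ∀ i j, U i j ∈ ringInt d) : U.det ∈ ringInt d := by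
  rw [det_fin_two, sub_eq_add_neg]
  exact ringInt_add (ringInt_mul hd (hU _ _) (hU _ _))
    (ringInt_neg (ringInt_mul hd (hU _ _) (hU _ _)))

lemma diag_factor {d : ℤ} (hd : d = -4 ∨ d = -3) {k : ℤ} (hk : Even k)
    {U V : Matrix (Fin 2) (Fin 2) ℂ} (hU : ∀ i j, U i j ∈ ringInt d)
    (hV : ∀ i j, V i j ∈ ringInt d) (h : Uᴴ * V = 1) :
    nuChar d k (diagM U V) * V.det ^ k = 1 := by
  have hdet : (starRingEnd ℂ) U.det * V.det = 1 := by
    have := congrArg Matrix.det h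
    rwa [det_mul, det_conjTranspose, det_one] at this
  have hUd := ringInt_det hd hU
  have hVd := ringInt_det hd hV
  have hU0 : U.det ≠ 0 := by rintro h0; simp [h0] at hdet
  have hV0 : V.det ≠ 0 := by rintro h0; simp [h0] at hdet
  have hn := congrArg normSq hdet
  rw [normSq_mul, normSq_conj, normSq_one] at hn
  have h1 := one_le_normSq hd hUd hU0
  have h2 := one_le_normSq hd hVd hV0
  have hU1 : normSq U.det = 1 := by nlinarith
  have hVU : V.det = U.det := by
    have h3 : U.det * (starRingEnd ℂ) U.det = 1 := by rw [mul_conj, hU1, ofReal_one]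
    calc V.det = U.det * (starRingEnd ℂ) U.det * V.det := by rw [h3, one_mul]
      _ = U.det * ((starRingEnd ℂ) U.det * V.det) := by ring
      _ = U.det := by rw [hdet, mul_one]
  obtain ⟨hp4, hp6⟩ := unit_pow hd hUd hU1
  have hM : (diagM U V).det = U.det ^ 2 := by
    rw [diagM, det_fromBlocks_zero₂₁, hVU, sq]
  obtain ⟨j, rfl⟩ := hk
  rw [nuChar, hM, hVU]
  rcases hd with rfl | rfl
  · rw [if_pos rfl, show (j + j) / 2 = j by omega]
    have : (U.det ^ 2) ^ j * U.det ^ (j + j) = (U.det ^ 4) ^ j := by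
      rw [← zpow_natCast, ← zpow_natCast, ← _root_.zpow_mul, ← _root_.zpow_mul, ← zpow_add₀ hU0]
      congr 1; push_cast; ring
    rw [this, hp4 rfl, _root_.one_zpow]
  · rw [if_neg (by norm_num)]
    have : (U.det ^ 2) ^ (j + j) * U.det ^ (j + j) = (U.det ^ 6) ^ j := by
      rw [← zpow_natCast, ← zpow_natCast, ← _root_.zpow_mul, ← _root_.zpow_mul, ← zpow_add₀ hU0]
      congr 1; push_cast; ring
    rw [this, hp6 rfl, _root_.one_zpow]

lemma nuChar_mul (d k : ℤ) (M N : Matrix (Fin 2 ⊕ Fin 2) (Fin 2 ⊕ Fin 2) ℂ) :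
    nuChar d k (M * N) = nuChar d k M * nuChar d k N := by
  simp only [nuChar, det_mul]
  split_ifs <;> rw [mul_zpow]

/-- A function with the correct behaviour under the generators transforms like a modular form. -/
theorem transform_of_generators {d : ℤ} (hd : d = -4 ∨ d = -3) {k : ℤ} (hk : Even k)
    {F : Matrix (Fin 2) (Fin 2) ℂ → ℂ}
    (hT : ∀ S : Matrix (Fin 2) (Fin 2) ℂ, S.IsHermitian → (∀ i j, S i j ∈ ringInt d) →
      ∀ Z ∈ HermitianUpperHalfSpace, F (Z + S) = F Z)
    (hU : ∀ U V : Matrix (Fin 2) (Fin 2) ℂ, (∀ i j, U i j ∈ ringInt d) →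
      (∀ i j, V i j ∈ ringInt d) → Uᴴ * V = 1 →
      ∀ Z ∈ HermitianUpperHalfSpace, F (U * Z * Uᴴ) = F Z)
    (hI : ∀ Z ∈ HermitianUpperHalfSpace, F (partialInv Z) = Z 0 0 ^ k * F Z) :
    ∀ M ∈ HermitianModularGroup d, ∀ Z ∈ HermitianUpperHalfSpace,
      F (matAct M Z) = nuChar d k M * (M.toBlocks₂₁ * Z + M.toBlocks₂₂).det ^ k * F Z := by
  suffices H : ∀ M, IsGenerated d M → ∀ Z ∈ HermitianUpperHalfSpace,
      matAct M Z ∈ HermitianUpperHalfSpace ∧ (M.toBlocks₂₁ * Z + M.toBlocks₂₂).det ≠ 0 ∧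
      F (matAct M Z) = nuChar d k M * (M.toBlocks₂₁ * Z + M.toBlocks₂₂).det ^ k * F Z from
    fun M hM Z hZ => (H M (isGenerated_of_mem hd hM) Z hZ).2.2
  intro M hM
  induction hM with
  | transl S hS hO =>
    intro Z hZ
    have h1 : matAct (translM S) Z = Z + S := by simp [matAct, translM]
    have h2 : (translM S).toBlocks₂₁ * Z + (translM S).toBlocks₂₂ = 1 := by simp [translM]
    have h3 : nuChar d k (translM S) = 1 := by
      simp [nuChar, translM]
    rw [h1, h2, h3]
    exact ⟨upperHalfSpace_add hZ hS, by simp, by rw [hT S hS hO Z hZ]; simp⟩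
  | diag U V hUO hVO h =>
    intro Z hZ
    have hinv : V⁻¹ = Uᴴ := Matrix.inv_eq_left_inv h
    have h1 : matAct (diagM U V) Z = U * Z * Uᴴ := by simp [matAct, diagM, hinv]
    have h2 : (diagM U V).toBlocks₂₁ * Z + (diagM U V).toBlocks₂₂ = V := by simp [diagM]
    have hu : IsUnit U := by
      have h' : Vᴴ * U = 1 := by simpa using congrArg conjTranspose h
      exact (Matrix.isUnit_iff_isUnit_det _).2 (Matrix.isUnit_det_of_left_inverse h')
    rw [h1, h2, diag_factor hd hk hUO hVO h, one_mul]
    exact ⟨upperHalfSpace_conj hZ hu, (Matrix.isUnit_det_of_left_inverse h).ne_zero,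
      hU U V hUO hVO h Z hZ⟩
  | inv =>
    intro Z hZ
    have h0 := upperHalfSpace_ne_zero hZ
    have h2 : invM.toBlocks₂₁ * Z + invM.toBlocks₂₂ = !![Z 0 0, Z 0 1; 0, 1] := by
      rw [invM, toBlocks_fromBlocks₂₁, toBlocks_fromBlocks₂₂]
      conv_lhs => rw [Matrix.eta_fin_two Z]
      ext i j; fin_cases i <;> fin_cases j <;> simp
    have h5 : invM.toBlocks₁₁ * Z + invM.toBlocks₁₂ = !![-1, 0; Z 1 0, Z 1 1] := by
      rw [invM, toBlocks_fromBlocks₁₁, toBlocks_fromBlocks₁₂]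
      conv_lhs => rw [Matrix.eta_fin_two Z]
      ext i j; fin_cases i <;> fin_cases j <;> simp
    have h1 : matAct invM Z = partialInv Z := by
      rw [matAct, h2, h5, Matrix.inv_eq_left_inv (B := !![1 / Z 0 0, -Z 0 1 / Z 0 0; 0, 1])]
      · ext i j; fin_cases i <;> fin_cases j <;>
          simp [partialInv, Matrix.mul_apply, Fin.sum_univ_two] <;> field_simp
        ring
      · ext i j; fin_cases i <;> fin_cases j <;>
          simp [Matrix.mul_apply, Fin.sum_univ_two] <;> field_simp
        ring
    have h3 : nuChar d k invM = 1 := by simp [nuChar, det_invM]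
    have h4 : (!![Z 0 0, Z 0 1; 0, 1] : Matrix (Fin 2) (Fin 2) ℂ).det = Z 0 0 := by
      simp [det_fin_two]
    rw [h1, h2, h3, h4, one_mul]
    exact ⟨upperHalfSpace_partialInv hZ, h0, hI Z hZ⟩
  | mul M N _ _ ihM ihN =>
    intro Z hZ
    obtain ⟨hN1, hN2, hN3⟩ := ihN Z hZ
    obtain ⟨hM1, hM2, hM3⟩ := ihM _ hN1
    obtain ⟨e1, e2⟩ := matAct_mul (M := M) hN2
    rw [e1, e2, det_mul]
    refine ⟨hM1, mul_ne_zero hM2 hN2, ?_⟩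
    rw [hM3, hN3, nuChar_mul, mul_zpow]
    ring

/-! ### Coordinates on the lattice `Λ₂(K)` -/

/-- The element `(a + b ω) / √d` of the inverse different. -/
def dualElt (d a b : ℤ) : ℂ := ((a : ℂ) + b * omegaD d) / sqrtD d

/-- The Hermitian matrix with coordinates `(n, m, a, b)`. -/
def hMat (d : ℤ) (v : ℤ × ℤ × ℤ × ℤ) : Matrix (Fin 2) (Fin 2) ℂ :=
  !![(v.1 : ℂ), dualElt d v.2.2.1 v.2.2.2; (starRingEnd ℂ) (dualElt d v.2.2.1 v.2.2.2), (v.2.1 : ℂ)]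

/-- `|d|` times the determinant of `hMat d v`. -/
def hDisc (d : ℤ) (v : ℤ × ℤ × ℤ × ℤ) : ℤ := -d * (v.1 * v.2.1) - normForm d v.2.2.1 v.2.2.2

lemma conj_dualElt (d a b : ℤ) : (starRingEnd ℂ) (dualElt d a b) = dualElt d (-a - b * d) b := by
  simp only [dualElt, map_div₀, map_add, map_mul, map_intCast, conj_omegaD, conj_sqrtD]
  push_cast
  rw [div_neg, ← neg_div]
  ring_nf

lemma normSq_sqrtD {d : ℤ} (hd : d = -4 ∨ d = -3) : normSq (sqrtD d) = -d := by
  have h : (0 : ℝ) ≤ -d := by rcases hd with rfl | rfl <;> norm_num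
  rw [sqrtD, normSq_mul, normSq_ofReal, normSq_I, mul_one, Real.mul_self_sqrt h]

lemma normSq_dualElt {d : ℤ} (hd : d = -4 ∨ d = -3) (a b : ℤ) :
    normSq (dualElt d a b) = normForm d a b / (-d : ℤ) := by
  rw [dualElt, normSq_div, normSq_ringInt hd, normSq_sqrtD hd]; push_cast; rfl

lemma dualElt_injective {d : ℤ} (hd : d = -4 ∨ d = -3) {a b a' b' : ℤ}
    (h : dualElt d a b = dualElt d a' b') : a = a' ∧ b = b' :=
  ringInt_coord_injective hd ((div_left_inj' (sqrtD_ne_zero hd)).1 h)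

lemma hMat_injective {d : ℤ} (hd : d = -4 ∨ d = -3) : Function.Injective (hMat d) := by
  rintro ⟨n, m, a, b⟩ ⟨n', m', a', b'⟩ h
  have h00 := congrFun (congrFun h 0) 0
  have h01 := congrFun (congrFun h 0) 1
  have h11 := congrFun (congrFun h 1) 1
  simp only [hMat, of_apply, cons_val_zero, cons_val_one, cons_val', cons_val_fin_one,
    Int.cast_inj] at h00 h01 h11
  obtain ⟨rfl, rfl⟩ := dualElt_injective hd h01
  subst h00 h11
  rfl

lemma hMat_isHermitian (d : ℤ) (v : ℤ × ℤ × ℤ × ℤ) : (hMat d v).IsHermitian := by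
  ext i j; fin_cases i <;> fin_cases j <;> simp [hMat]

lemma hMat_mem {d : ℤ} (hd : d = -4 ∨ d = -3) (v : ℤ × ℤ × ℤ × ℤ) : hMat d v ∈ LambdaH d := by
  have key : ∀ a b : ℤ, sqrtD d * dualElt d a b ∈ ringInt d := fun a b => by
    rw [dualElt, mul_div_cancel₀ _ (sqrtD_ne_zero hd)]; exact mem_ringInt.2 ⟨a, b, rfl⟩
  refine ⟨hMat_isHermitian d v, fun i => ?_, fun i j => ?_⟩
  · fin_cases i
    exacts [⟨v.1, rfl⟩, ⟨v.2.1, rfl⟩]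
  · fin_cases i <;> fin_cases j
    · exact ringInt_mul hd (ringInt_sqrtD d) (ringInt_int d _)
    · exact key _ _
    · simp only [hMat, conj_dualElt]
      exact key _ _
    · exact ringInt_mul hd (ringInt_sqrtD d) (ringInt_int d _)

lemma exists_hMat_eq {d : ℤ} (hd : d = -4 ∨ d = -3) {H : Matrix (Fin 2) (Fin 2) ℂ}
    (hH : H ∈ LambdaH d) : ∃ v, hMat d v = H := by
  obtain ⟨h1, h2, h3⟩ := hH
  obtain ⟨n, hn⟩ := h2 0
  obtain ⟨m, hm⟩ := h2 1
  obtain ⟨a, b, hab⟩ := mem_ringInt.1 (h3 0 1)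
  have h01 : dualElt d a b = H 0 1 := by
    rw [dualElt, ← hab, mul_div_cancel_left₀ _ (sqrtD_ne_zero hd)]
  refine ⟨(n, m, a, b), ?_⟩
  ext i j; fin_cases i <;> fin_cases j
  · simp [hMat, hn]
  · simp [hMat, h01]
  · simpa [hMat, h01] using h1.apply 1 0
  · simp [hMat, hm]

/-- The coordinate description of `Λ₂(K)`. -/
def lambdaEquiv {d : ℤ} (hd : d = -4 ∨ d = -3) : (ℤ × ℤ × ℤ × ℤ) ≃ LambdaH d :=
  Equiv.ofBijective (fun v => ⟨hMat d v, hMat_mem hd v⟩)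
    ⟨fun _ _ h => hMat_injective hd (congrArg Subtype.val h),
      fun H => (exists_hMat_eq hd H.2).imp fun _ h => Subtype.ext h⟩

@[simp] lemma lambdaEquiv_apply {d : ℤ} (hd : d = -4 ∨ d = -3) (v : ℤ × ℤ × ℤ × ℤ) :
    (lambdaEquiv hd v : Matrix (Fin 2) (Fin 2) ℂ) = hMat d v := rfl

lemma hMat_symm {d : ℤ} (hd : d = -4 ∨ d = -3) (H : LambdaH d) :
    hMat d ((lambdaEquiv hd).symm H) = H := by
  rw [← lambdaEquiv_apply hd, Equiv.apply_symm_apply]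

/-- The cone of positive semidefinite matrices in coordinates. -/
def InCone (d : ℤ) (v : ℤ × ℤ × ℤ × ℤ) : Prop := 0 ≤ v.1 ∧ 0 ≤ v.2.1 ∧ 0 ≤ hDisc d v

lemma hMat_posSemidef_iff {d : ℤ} (hd : d = -4 ∨ d = -3) (v : ℤ × ℤ × ℤ × ℤ) :
    (hMat d v).PosSemidef ↔ InCone d v := by
  have hpos : (0 : ℝ) < ((-d : ℤ) : ℝ) := by rcases hd with rfl | rfl <;> norm_num
  rw [posSemidef_two_iff (hMat_isHermitian d v)]
  have h00 : (hMat d v 0 0).re = v.1 := by simp [hMat]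
  have h11 : (hMat d v 1 1).re = v.2.1 := by simp [hMat]
  have h01 : normSq (hMat d v 0 1) = normForm d v.2.2.1 v.2.2.2 / (-d : ℤ) := by
    rw [← normSq_dualElt hd]; simp [hMat]
  rw [h00, h11, h01, div_le_iff₀ hpos, InCone, hDisc]
  refine and_congr (by exact_mod_cast Iff.rfl) (and_congr (by exact_mod_cast Iff.rfl) ?_)
  rw [sub_nonneg, mul_comm (-d)]
  exact_mod_cast Iff.rfl

lemma four_normForm {d : ℤ} (hd : d = -4 ∨ d = -3) (a b : ℤ) :
    4 * normForm d a b = (2 * a + d * b) ^ 2 - d * b ^ 2 := by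
  rw [normForm]; rcases hd with rfl | rfl <;> ring_nf

lemma InCone.bound {d : ℤ} (hd : d = -4 ∨ d = -3) {v : ℤ × ℤ × ℤ × ℤ} (h : InCone d v) :
    |v.1| + |v.2.1| + |v.2.2.1| + |v.2.2.2| ≤ 5 * (v.1 + v.2.1) := by
  obtain ⟨n, m, a, b⟩ := v
  obtain ⟨hn, hm, hD⟩ := h
  simp only [hDisc] at hn hm hD ⊢
  have h4 := four_normForm hd a b
  have hs : 4 * (n * m) ≤ (n + m) ^ 2 := by nlinarith [sq_nonneg (n - m)]
  have hb : |b| ≤ n + m := by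
    refine abs_le_of_sq_le_sq ?_ (by omega)
    rcases hd with rfl | rfl <;> nlinarith [sq_nonneg (2 * a + -4 * b), sq_nonneg (2 * a + -3 * b)]
  have ha : |2 * a + d * b| ≤ 2 * (n + m) := by
    refine abs_le_of_sq_le_sq ?_ (by omega)
    rcases hd with rfl | rfl <;> nlinarith [sq_nonneg b, sq_nonneg (n + m)]
  rw [abs_of_nonneg hn, abs_of_nonneg hm]
  rw [abs_le] at ha hb
  have : |a| ≤ 3 * (n + m) := by
    rw [abs_le]
    rcases hd with rfl | rfl <;> constructor <;> omega
  have : |b| ≤ n + m := abs_le.2 hb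
  omega

lemma InCone.normSq_le {d : ℤ} (hd : d = -4 ∨ d = -3) {v : ℤ × ℤ × ℤ × ℤ} (h : InCone d v) :
    normSq (dualElt d v.2.2.1 v.2.2.2) ≤ v.1 * v.2.1 := by
  have := ((posSemidef_two_iff (hMat_isHermitian d v)).1 ((hMat_posSemidef_iff hd v).2 h)).2.2
  simpa [hMat] using this

/-! ### Integrality of traces -/

lemma dualElt_add_conj {d : ℤ} (hd : d = -4 ∨ d = -3) (a b : ℤ) :
    dualElt d a b + (starRingEnd ℂ) (dualElt d a b) = b := by
  rw [conj_dualElt, dualElt, dualElt, ← add_div, div_eq_iff (sqrtD_ne_zero hd), sqrtD_eq]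
  push_cast; ring

lemma invDiff_add_conj {d : ℤ} (hd : d = -4 ∨ d = -3) {x : ℂ} (hx : sqrtD d * x ∈ ringInt d) :
    ∃ n : ℤ, x + (starRingEnd ℂ) x = n := by
  obtain ⟨a, b, hab⟩ := mem_ringInt.1 hx
  have : x = dualElt d a b := by
    rw [dualElt, ← hab, mul_div_cancel_left₀ _ (sqrtD_ne_zero hd)]
  exact ⟨b, by rw [this, dualElt_add_conj hd]⟩

lemma ringInt_real {d : ℤ} (hd : d = -4 ∨ d = -3) {x : ℂ} (hx : x ∈ ringInt d)
    (h : (starRingEnd ℂ) x = x) : ∃ n : ℤ, x = n := by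
  obtain ⟨a, b, rfl⟩ := mem_ringInt.1 hx
  refine ⟨a, ?_⟩
  have him := Complex.conj_eq_iff_im.1 h
  simp only [Complex.add_im, Complex.intCast_im, Complex.mul_im, Complex.intCast_re, zero_mul,
    add_zero, zero_add] at him
  rcases mul_eq_zero.1 him with h | h
  · have : b = 0 := by exact_mod_cast h
    simp [this]
  · exact absurd h (omegaD_im hd).ne'

lemma exists_int_trace {d : ℤ} (hd : d = -4 ∨ d = -3) {H S : Matrix (Fin 2) (Fin 2) ℂ}
    (hH : H ∈ LambdaH d) (hS : S.IsHermitian) (hO : ∀ i j, S i j ∈ ringInt d) :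
    ∃ n : ℤ, (H * S).trace = n := by
  obtain ⟨h1, h2, h3⟩ := hH
  obtain ⟨n, hn⟩ := h2 0
  obtain ⟨m, hm⟩ := h2 1
  obtain ⟨x, hx⟩ := ringInt_real hd (hO 0 0) (hS.apply 0 0)
  obtain ⟨y, hy⟩ := ringInt_real hd (hO 1 1) (hS.apply 1 1)
  obtain ⟨z, hz⟩ := invDiff_add_conj hd (x := H 0 1 * S 1 0)
    (by rw [← mul_assoc]; exact ringInt_mul hd (h3 0 1) (hO 1 0))
  have e1 : (starRingEnd ℂ) (H 0 1) = H 1 0 := h1.apply 1 0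
  have e2 : (starRingEnd ℂ) (S 1 0) = S 0 1 := hS.apply 0 1
  rw [map_mul, e1, e2] at hz
  refine ⟨n * x + m * y + z, ?_⟩
  simp only [Matrix.trace_fin_two, Matrix.mul_apply, Fin.sum_univ_two, hn, hm, hx, hy]
  push_cast
  linear_combination hz

lemma lambdaH_conj_mem {d : ℤ} (hd : d = -4 ∨ d = -3) {H U : Matrix (Fin 2) (Fin 2) ℂ}
    (hH : H ∈ LambdaH d) (hU : ∀ i j, U i j ∈ ringInt d) : Uᴴ * H * U ∈ LambdaH d := by
  refine ⟨isHermitian_conjTranspose_mul_mul U hH.1, fun i => ?_, fun i j => ?_⟩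
  · obtain ⟨n, hn⟩ := exists_int_trace hd hH
      (S := Matrix.of fun k l => U k i * (starRingEnd ℂ) (U l i)) (by
        ext k l; simp [mul_comm]) (fun k l => ringInt_mul hd (hU k i) (ringInt_conj (hU l i)))
    refine ⟨n, ?_⟩
    rw [← hn]
    simp only [Matrix.trace_fin_two, Matrix.mul_apply, Fin.sum_univ_two, conjTranspose_apply,
      of_apply, RCLike.star_def]
    ring
  · have hsum : ∀ f : Fin 2 → ℂ, (∀ k, f k ∈ ringInt d) → ∑ k, f k ∈ ringInt d := fun f hf =>
      Finset.sum_induction _ (· ∈ ringInt d) (fun _ _ => ringInt_add) (ringInt_zero d)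
        (fun k _ => hf k)
    simp only [Matrix.mul_apply, Finset.mul_sum, Finset.sum_mul, conjTranspose_apply,
      RCLike.star_def]
    refine hsum _ fun k => hsum _ fun l => ?_
    have := ringInt_mul hd (ringInt_mul hd (ringInt_conj (hU l i)) (hH.2.2 l k)) (hU k j)
    convert this using 1
    ring

/-- The permutation of `Λ₂(K)` induced by a unimodular matrix. -/
def lambdaConj {d : ℤ} (hd : d = -4 ∨ d = -3) {U V : Matrix (Fin 2) (Fin 2) ℂ}
    (hU : ∀ i j, U i j ∈ ringInt d) (hV : ∀ i j, V i j ∈ ringInt d) (h : Uᴴ * V = 1) :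
    LambdaH d ≃ LambdaH d where
  toFun H := ⟨Uᴴ * H * U, lambdaH_conj_mem hd H.2 hU⟩
  invFun H := ⟨V * H * Vᴴ, by
    have := lambdaH_conj_mem hd H.2 (U := Vᴴ) fun i j => ringInt_conj (hV j i)
    rwa [conjTranspose_conjTranspose] at this⟩
  left_inv H := by
    have h1 : V * Uᴴ = 1 := mul_eq_one_comm.1 h
    have h2 : U * Vᴴ = 1 := by simpa using congrArg conjTranspose h1
    refine Subtype.ext ?_
    change V * (Uᴴ * H * U) * Vᴴ = H
    rw [Matrix.mul_assoc, Matrix.mul_assoc (Uᴴ * _), h2, Matrix.mul_one, ← Matrix.mul_assoc, h1,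
      Matrix.one_mul]
  right_inv H := by
    have h2 : Vᴴ * U = 1 := by simpa using congrArg conjTranspose h
    refine Subtype.ext ?_
    change Uᴴ * (V * H * Vᴴ) * U = H
    rw [Matrix.mul_assoc, Matrix.mul_assoc (V * _), h2, Matrix.mul_one, ← Matrix.mul_assoc, h,
      Matrix.one_mul]

/-! ### Convergence of Fourier series on the Hermitian upper half space -/

/-- The character `e^{2 π i x}`. -/
def eC (x : ℂ) : ℂ := Complex.exp (2 * Real.pi * Complex.I * x)

lemma eC_add (x y : ℂ) : eC (x + y) = eC x * eC y := by
  rw [eC, eC, eC, ← Complex.exp_add, mul_add]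

lemma eC_int (n : ℤ) : eC n = 1 := by
  rw [eC, mul_comm]; exact Complex.exp_int_mul_two_pi_mul_I n

lemma eC_zero : eC 0 = 1 := by simp [eC]

lemma eC_add_int (x : ℂ) (n : ℤ) : eC (x + n) = eC x := by rw [eC_add, eC_int, mul_one]

lemma norm_eC (x : ℂ) : ‖eC x‖ = Real.exp (-(2 * Real.pi * x.im)) := by
  rw [eC, Complex.norm_exp]; congr 1; simp

lemma hMat_trace (d : ℤ) (v : ℤ × ℤ × ℤ × ℤ) (Z : Matrix (Fin 2) (Fin 2) ℂ) :
    (hMat d v * Z).trace = v.1 * Z 0 0 + v.2.1 * Z 1 1 + dualElt d v.2.2.1 v.2.2.2 * Z 1 0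
      + (starRingEnd ℂ) (dualElt d v.2.2.1 v.2.2.2) * Z 0 1 := by
  simp only [hMat, Matrix.trace_fin_two, Matrix.mul_apply, Fin.sum_univ_two, of_apply,
    cons_val_zero, cons_val_one, cons_val', cons_val_fin_one]
  ring

lemma trace_im_nonneg {d : ℤ} (hd : d = -4 ∨ d = -3) {v : ℤ × ℤ × ℤ × ℤ} (hv : InCone d v)
    {Z : Matrix (Fin 2) (Fin 2) ℂ} (hZ : Z ∈ HermitianUpperHalfSpace) :
    0 ≤ (hMat d v * Z).trace.im := by
  obtain ⟨h1, h2⟩ := mem_upperHalfSpace_iff.1 hZ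
  have ht := hv.normSq_le hd
  have hn : (0 : ℝ) ≤ v.1 := by exact_mod_cast hv.1
  have hm : (0 : ℝ) ≤ v.2.1 := by exact_mod_cast hv.2.1
  rw [hMat_trace]
  generalize dualElt d v.2.2.1 v.2.2.2 = t at *
  have h3 : 0 < (Z 1 1).im := by
    have := normSq_nonneg (Z 0 1 - (starRingEnd ℂ) (Z 1 0))
    have h4 : 0 < 4 * ((Z 0 0).im * (Z 1 1).im) := by linarith
    exact (mul_pos_iff_of_pos_left h1).1 (by linarith)
  set η := Z 0 1 - (starRingEnd ℂ) (Z 1 0) with hη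
  have him : (v.1 * Z 0 0 + v.2.1 * Z 1 1 + t * Z 1 0 + (starRingEnd ℂ) t * Z 0 1).im =
      v.1 * (Z 0 0).im + v.2.1 * (Z 1 1).im + ((starRingEnd ℂ) t * η).im := by
    simp [hη]; ring
  rw [him]
  have hsq : ((starRingEnd ℂ) t * η).im ^ 2 ≤ (v.1 * (Z 0 0).im + v.2.1 * (Z 1 1).im) ^ 2 := by
    have e1 : ((starRingEnd ℂ) t * η).im ^ 2 ≤ normSq t * normSq η := by
      rw [← normSq_conj t, ← normSq_mul, normSq_apply]; nlinarith [sq_nonneg ((starRingEnd ℂ) t * η).re]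
    have e2 : normSq t * normSq η ≤ (v.1 * v.2.1) * (4 * ((Z 0 0).im * (Z 1 1).im)) :=
      mul_le_mul ht h2.le (normSq_nonneg _) (by positivity)
    nlinarith [sq_nonneg (v.1 * (Z 0 0).im - v.2.1 * (Z 1 1).im)]
  have := abs_le_of_sq_le_sq hsq (by positivity)
  linarith [(abs_le.1 this).1]

/-- The part of the upper half space where the imaginary part exceeds `r`. -/
def upperPart (r : ℝ) : Set (Matrix (Fin 2) (Fin 2) ℂ) :=
  {Z | Z - (r * Complex.I) • (1 : Matrix (Fin 2) (Fin 2) ℂ) ∈ HermitianUpperHalfSpace}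

lemma trace_im_ge {d : ℤ} (hd : d = -4 ∨ d = -3) {v : ℤ × ℤ × ℤ × ℤ} (hv : InCone d v)
    {r : ℝ} {Z : Matrix (Fin 2) (Fin 2) ℂ} (hZ : Z ∈ upperPart r) :
    r * (v.1 + v.2.1) ≤ (hMat d v * Z).trace.im := by
  have h := trace_im_nonneg hd hv hZ
  rw [hMat_trace] at h ⊢
  simp at h ⊢
  linarith

lemma mem_upperPart_iff {r : ℝ} {Z : Matrix (Fin 2) (Fin 2) ℂ} :
    Z ∈ upperPart r ↔ 0 < (Z 0 0).im - r ∧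
      normSq (Z 0 1 - (starRingEnd ℂ) (Z 1 0)) < 4 * (((Z 0 0).im - r) * ((Z 1 1).im - r)) := by
  rw [upperPart, Set.mem_ofPred_eq, mem_upperHalfSpace_iff]
  simp

lemma exists_mem_upperPart {Z : Matrix (Fin 2) (Fin 2) ℂ} (hZ : Z ∈ HermitianUpperHalfSpace) :
    ∃ r : ℝ, 0 < r ∧ Z ∈ upperPart r := by
  obtain ⟨h1, h2⟩ := mem_upperHalfSpace_iff.1 hZ
  have c1 : ContinuousAt (fun r : ℝ => (Z 0 0).im - r) 0 := by fun_prop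
  have c2 : ContinuousAt (fun r : ℝ => 4 * (((Z 0 0).im - r) * ((Z 1 1).im - r))) 0 := by fun_prop
  have e1 := c1.eventually (lt_mem_nhds (a := 0) (by simpa using h1))
  have e2 := c2.eventually (lt_mem_nhds (a := normSq (Z 0 1 - (starRingEnd ℂ) (Z 1 0)))
    (by simpa using h2))
  have e3 : ∀ᶠ r : ℝ in nhdsWithin 0 (Set.Ioi 0), 0 < r := eventually_mem_nhdsWithin
  obtain ⟨r, ⟨h1, h2⟩, h3⟩ :=
    (((e1.and e2).filter_mono nhdsWithin_le_nhds).and e3).exists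
  exact ⟨r, h3, mem_upperPart_iff.2 ⟨h1, h2⟩⟩

lemma isOpen_upperPart (r : ℝ) : IsOpen {Z : Fin 2 → Fin 2 → ℂ | Matrix.of Z ∈ upperPart r} := by
  simp only [mem_upperPart_iff, of_apply]
  have c1 : Continuous fun Z : Fin 2 → Fin 2 → ℂ => (Z 0 0).im - r := by fun_prop
  have c2 : Continuous fun Z : Fin 2 → Fin 2 → ℂ => normSq (Z 0 1 - (starRingEnd ℂ) (Z 1 0)) :=
    continuous_normSq.comp (by fun_prop)
  have c3 : Continuous fun Z : Fin 2 → Fin 2 → ℂ =>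
    4 * (((Z 0 0).im - r) * ((Z 1 1).im - r)) := by fun_prop
  exact (isOpen_lt continuous_const c1).inter (isOpen_lt c2 c3)

lemma convex_upperPart (r : ℝ) :
    Convex ℝ {Z : Fin 2 → Fin 2 → ℂ | Matrix.of Z ∈ upperPart r} := by
  rw [convex_iff_forall_pos]
  intro X hX Y hY a b ha hb hab
  have hab' : (a : ℂ) + b = 1 := by exact_mod_cast hab
  simp only [upperPart, HermitianUpperHalfSpace, Set.mem_ofPred_eq] at hX hY ⊢
  have h1 := (hX.smul (a := (a : ℂ)) (by exact_mod_cast ha)).add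
    (hY.smul (a := (b : ℂ)) (by exact_mod_cast hb))
  convert h1 using 1
  ext i j
  simp [Matrix.sub_apply]
  linear_combination r * I * (1 : Matrix (Fin 2) (Fin 2) ℂ) i j / I * hab'

/-- Coefficient systems of polynomial growth supported on the cone. -/
structure IsFourierCoeff (d : ℤ) (α : ℤ × ℤ × ℤ × ℤ → ℂ) : Prop where
  support : ∀ v, α v ≠ 0 → InCone d v
  growth : ∃ (C : ℝ) (B : ℕ), ∀ v, InCone d v → ‖α v‖ ≤ C * (1 + v.1 + v.2.1) ^ B

lemma summable_exp_abs {δ : ℝ} (hδ : 0 < δ) : Summable fun n : ℤ => Real.exp (-(δ * |(n : ℝ)|)) := by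
  have h : Summable fun n : ℕ => Real.exp (-(δ * n)) := by
    simpa [neg_mul] using Real.summable_exp_nat_mul_of_ge (c := -δ) (by linarith)
      (f := fun n => n) (fun n => le_rfl)
  refine Summable.of_nat_of_neg ?_ ?_ <;> simpa using h

lemma summable_exp_l1 {δ : ℝ} (hδ : 0 < δ) : Summable fun v : ℤ × ℤ × ℤ × ℤ =>
    Real.exp (-(δ * (|(v.1 : ℝ)| + |(v.2.1 : ℝ)| + |(v.2.2.1 : ℝ)| + |(v.2.2.2 : ℝ)|))) := by
  have h := summable_exp_abs hδ
  have h2 := h.mul_of_nonneg h (fun _ => (Real.exp_pos _).le) (fun _ => (Real.exp_pos _).le)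
  have h3 := h.mul_of_nonneg h2 (fun _ => (Real.exp_pos _).le) (fun _ => by positivity)
  have h4 := h.mul_of_nonneg h3 (fun _ => (Real.exp_pos _).le) (fun _ => by positivity)
  refine h4.congr fun v => ?_
  rw [← Real.exp_add, ← Real.exp_add, ← Real.exp_add]
  congr 1; ring

lemma exists_poly_mul_exp_le (B : ℕ) {δ : ℝ} (hδ : 0 < δ) :
    ∃ C : ℝ, 0 < C ∧ ∀ s : ℝ, 0 ≤ s → (1 + s) ^ B * Real.exp (-(2 * δ * s)) ≤ C * Real.exp (-(δ * s)) := by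
  refine ⟨B.factorial / δ ^ B * Real.exp δ, by positivity, fun s hs => ?_⟩
  have h := Real.pow_div_factorial_le_exp (δ * (1 + s)) (by positivity) B
  rw [div_le_iff₀ (by positivity), mul_pow, mul_comm, ← le_div_iff₀ (by positivity)] at h
  calc (1 + s) ^ B * Real.exp (-(2 * δ * s))
      ≤ Real.exp (δ * (1 + s)) * B.factorial / δ ^ B * Real.exp (-(2 * δ * s)) := by gcongr
    _ = B.factorial / δ ^ B * (Real.exp (δ * (1 + s)) * Real.exp (-(2 * δ * s))) := by ring
    _ = B.factorial / δ ^ B * Real.exp δ * Real.exp (-(δ * s)) := by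
      rw [← Real.exp_add, mul_assoc (_ / _), ← Real.exp_add]; congr 2; ring

/-- The uniform bound for the terms of a Fourier series, with a polynomial factor to spare. -/
lemma IsFourierCoeff.exists_bound {d : ℤ} (hd : d = -4 ∨ d = -3) {α : ℤ × ℤ × ℤ × ℤ → ℂ}
    (hα : IsFourierCoeff d α) {r : ℝ} (hr : 0 < r) :
    ∃ u : ℤ × ℤ × ℤ × ℤ → ℝ, Summable u ∧ (∀ v, 0 ≤ u v) ∧ ∀ Z ∈ upperPart r, ∀ v,
      ‖α v * eC (hMat d v * Z).trace‖ * (1 + |(v.1 : ℝ)| + |(v.2.1 : ℝ)|) ≤ u v := by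
  obtain ⟨C, B, hC⟩ := hα.growth
  obtain ⟨C', hC', hexp⟩ := exists_poly_mul_exp_le (B + 1) (δ := Real.pi * r) (by positivity)
  refine ⟨fun v => |C| * C' * Real.exp (-(Real.pi * r / 5 *
    (|(v.1 : ℝ)| + |(v.2.1 : ℝ)| + |(v.2.2.1 : ℝ)| + |(v.2.2.2 : ℝ)|))),
    (summable_exp_l1 (by positivity)).mul_left _, fun v => by positivity, fun Z hZ v => ?_⟩
  by_cases h0 : α v = 0
  · simp only [h0, zero_mul, norm_zero]; positivity
  have hv := hα.support v h0
  have hn : (0 : ℝ) ≤ v.1 := by exact_mod_cast hv.1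
  have hm : (0 : ℝ) ≤ v.2.1 := by exact_mod_cast hv.2.1
  have hb : |(v.1 : ℝ)| + |(v.2.1 : ℝ)| + |(v.2.2.1 : ℝ)| + |(v.2.2.2 : ℝ)| ≤ 5 * (v.1 + v.2.1) := by
    exact_mod_cast hv.bound hd
  have him := trace_im_ge hd hv hZ
  rw [norm_mul, norm_eC, abs_of_nonneg hn, abs_of_nonneg hm]
  have hs := hexp (v.1 + v.2.1) (by positivity)
  have hpi := Real.pi_pos
  calc ‖α v‖ * Real.exp (-(2 * Real.pi * (hMat d v * Z).trace.im)) * (1 + v.1 + v.2.1)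
      ≤ |C| * (1 + v.1 + v.2.1) ^ B * Real.exp (-(2 * (Real.pi * r) * (v.1 + v.2.1))) *
        (1 + v.1 + v.2.1) := by
        have e1 : ‖α v‖ ≤ |C| * (1 + v.1 + v.2.1) ^ B :=
          (hC v hv).trans (by gcongr; exact le_abs_self C)
        have e2 : Real.exp (-(2 * Real.pi * (hMat d v * Z).trace.im)) ≤
            Real.exp (-(2 * (Real.pi * r) * (v.1 + v.2.1))) :=
          Real.exp_le_exp.2 (by nlinarith)
        exact mul_le_mul_of_nonneg_right
          (mul_le_mul e1 e2 (Real.exp_pos _).le (by positivity)) (by positivity)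
    _ = |C| * ((1 + (v.1 + v.2.1)) ^ (B + 1) *
          Real.exp (-(2 * (Real.pi * r) * (v.1 + v.2.1)))) := by ring
    _ ≤ |C| * (C' * Real.exp (-(Real.pi * r * (v.1 + v.2.1)))) := by gcongr
    _ ≤ |C| * (C' * Real.exp (-(Real.pi * r / 5 *
          (|(v.1 : ℝ)| + |(v.2.1 : ℝ)| + |(v.2.2.1 : ℝ)| + |(v.2.2.2 : ℝ)|)))) := by
        have h5 : 0 < Real.pi * r / 5 := by positivity
        exact mul_le_mul_of_nonneg_left (mul_le_mul_of_nonneg_left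
          (Real.exp_le_exp.2 (by nlinarith)) hC'.le) (abs_nonneg C)
    _ = _ := by ring

/-- The function defined by a Fourier series. -/
def fourierFun (d : ℤ) (α : ℤ × ℤ × ℤ × ℤ → ℂ) (Z : Matrix (Fin 2) (Fin 2) ℂ) : ℂ :=
  ∑' v, α v * eC (hMat d v * Z).trace

lemma IsFourierCoeff.summable {d : ℤ} (hd : d = -4 ∨ d = -3) {α : ℤ × ℤ × ℤ × ℤ → ℂ}
    (hα : IsFourierCoeff d α) {Z : Matrix (Fin 2) (Fin 2) ℂ} (hZ : Z ∈ HermitianUpperHalfSpace) :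
    Summable fun v => α v * eC (hMat d v * Z).trace := by
  obtain ⟨r, hr, hZr⟩ := exists_mem_upperPart hZ
  obtain ⟨u, hu, -, hb⟩ := hα.exists_bound hd hr
  refine hu.of_norm_bounded fun v => (le_mul_of_one_le_right (norm_nonneg _) ?_).trans (hb Z hZr v)
  linarith [abs_nonneg (v.1 : ℝ), abs_nonneg (v.2.1 : ℝ)]

/-- The trace pairing with `hMat d v`, as a continuous linear form. -/
def traceCLM (d : ℤ) (v : ℤ × ℤ × ℤ × ℤ) : (Fin 2 → Fin 2 → ℂ) →L[ℂ] ℂ :=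
  let p : Fin 2 → Fin 2 → ((Fin 2 → Fin 2 → ℂ) →L[ℂ] ℂ) := fun i j =>
    (ContinuousLinearMap.proj (R := ℂ) (φ := fun _ : Fin 2 => ℂ) j).comp
      (ContinuousLinearMap.proj (R := ℂ) (φ := fun _ : Fin 2 => Fin 2 → ℂ) i)
  (v.1 : ℂ) • p 0 0 + (v.2.1 : ℂ) • p 1 1 + dualElt d v.2.2.1 v.2.2.2 • p 1 0
    + (starRingEnd ℂ) (dualElt d v.2.2.1 v.2.2.2) • p 0 1

lemma traceCLM_apply (d : ℤ) (v : ℤ × ℤ × ℤ × ℤ) (Z : Fin 2 → Fin 2 → ℂ) :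
    traceCLM d v Z = (hMat d v * Matrix.of Z).trace := by
  rw [hMat_trace]; simp [traceCLM]

lemma norm_traceCLM_le {d : ℤ} (hd : d = -4 ∨ d = -3) {v : ℤ × ℤ × ℤ × ℤ} (hv : InCone d v) :
    ‖traceCLM d v‖ ≤ 2 * (1 + |(v.1 : ℝ)| + |(v.2.1 : ℝ)|) := by
  have hn : (0 : ℝ) ≤ v.1 := by exact_mod_cast hv.1
  have hm : (0 : ℝ) ≤ v.2.1 := by exact_mod_cast hv.2.1
  have ht : ‖dualElt d v.2.2.1 v.2.2.2‖ ≤ (v.1 + v.2.1) / 2 := by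
    have h := hv.normSq_le hd
    rw [normSq_eq_norm_sq] at h
    refine le_of_sq_le_sq ?_ (by positivity)
    nlinarith [sq_nonneg ((v.1 : ℝ) - v.2.1)]
  refine ContinuousLinearMap.opNorm_le_bound _ (by positivity) fun Z => ?_
  have hZ : ∀ i j, ‖Z i j‖ ≤ ‖Z‖ := fun i j => (norm_le_pi_norm (Z i) j).trans (norm_le_pi_norm Z i)
  rw [traceCLM_apply, hMat_trace, abs_of_nonneg hn, abs_of_nonneg hm]
  simp only [of_apply]
  have hZ0 := norm_nonneg Z
  calc _ ≤ ‖(v.1 : ℂ) * Z 0 0‖ + ‖(v.2.1 : ℂ) * Z 1 1‖ + ‖dualElt d v.2.2.1 v.2.2.2 * Z 1 0‖ +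
        ‖(starRingEnd ℂ) (dualElt d v.2.2.1 v.2.2.2) * Z 0 1‖ := norm_add₄_le
    _ ≤ v.1 * ‖Z‖ + v.2.1 * ‖Z‖ + (v.1 + v.2.1) / 2 * ‖Z‖ + (v.1 + v.2.1) / 2 * ‖Z‖ := by
        simp only [norm_mul, RCLike.norm_conj, Complex.norm_intCast, abs_of_nonneg hn,
          abs_of_nonneg hm]
        gcongr <;> apply hZ
    _ ≤ 2 * (1 + v.1 + v.2.1) * ‖Z‖ := by nlinarith

lemma IsFourierCoeff.differentiableOn {d : ℤ} (hd : d = -4 ∨ d = -3) {α : ℤ × ℤ × ℤ × ℤ → ℂ}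
    (hα : IsFourierCoeff d α) :
    DifferentiableOn ℂ (fun Z : Fin 2 → Fin 2 → ℂ => fourierFun d α (Matrix.of Z))
      {Z | Matrix.of Z ∈ HermitianUpperHalfSpace} := by
  intro Z hZ
  obtain ⟨r, hr, hZr⟩ := exists_mem_upperPart hZ
  obtain ⟨u, hu, hu0, hb⟩ := hα.exists_bound hd hr
  have hder : ∀ (v : ℤ × ℤ × ℤ × ℤ) (X : Fin 2 → Fin 2 → ℂ), HasFDerivAt
      (fun Z : Fin 2 → Fin 2 → ℂ => α v * eC (hMat d v * Matrix.of Z).trace)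
      ((α v * eC (hMat d v * Matrix.of X).trace * (2 * Real.pi * I)) • traceCLM d v) X := by
    intro v X
    have h1 : HasFDerivAt (fun Z => (2 * Real.pi * I) * traceCLM d v Z)
        ((2 * Real.pi * I) • traceCLM d v) X := (traceCLM d v).hasFDerivAt.const_mul _
    have h2 := (h1.cexp).const_mul (α v)
    simp only [traceCLM_apply] at h2
    refine h2.congr_fderiv ?_
    rw [smul_smul, smul_smul, eC]
  have := hasFDerivAt_tsum_of_isPreconnected (𝕜 := ℂ) (u := fun v => 4 * Real.pi * u v)
    (hu.mul_left _) (isOpen_upperPart r) (convex_upperPart r).isPreconnected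
    (fun v X _ => hder v X) (fun v X hX => ?_) hZr (hα.summable hd hZ) hZr
  · exact this.differentiableAt.differentiableWithinAt
  · by_cases h0 : α v = 0
    · have := hu0 v
      rw [norm_smul, h0, zero_mul, zero_mul, norm_zero, zero_mul]; positivity
    have hle := norm_traceCLM_le hd (hα.support v h0)
    have hb' := hb _ hX v
    rw [norm_smul, norm_mul _ (2 * Real.pi * I : ℂ)]
    have : ‖(2 * Real.pi * I : ℂ)‖ = 2 * Real.pi := by
      simp [abs_of_pos Real.pi_pos]
    rw [this]
    calc _ ≤ ‖α v * eC (hMat d v * Matrix.of X).trace‖ * (2 * Real.pi) *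
          (2 * (1 + |(v.1 : ℝ)| + |(v.2.1 : ℝ)|)) := by gcongr
      _ = 4 * Real.pi * (‖α v * eC (hMat d v * Matrix.of X).trace‖ *
          (1 + |(v.1 : ℝ)| + |(v.2.1 : ℝ)|)) := by ring
      _ ≤ _ := mul_le_mul_of_nonneg_left hb' (by positivity)

/-! ### Formal properties of Fourier series -/

/-- The coefficient function on matrices attached to a coefficient system. -/
def matCoeff {d : ℤ} (hd : d = -4 ∨ d = -3) (α : ℤ × ℤ × ℤ × ℤ → ℂ)
    (H : Matrix (Fin 2) (Fin 2) ℂ) : ℂ :=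
  open Classical in if h : H ∈ LambdaH d then α ((lambdaEquiv hd).symm ⟨H, h⟩) else 0

lemma matCoeff_hMat {d : ℤ} (hd : d = -4 ∨ d = -3) (α : ℤ × ℤ × ℤ × ℤ → ℂ)
    (v : ℤ × ℤ × ℤ × ℤ) : matCoeff hd α (hMat d v) = α v := by
  have : (⟨hMat d v, hMat_mem hd v⟩ : LambdaH d) = lambdaEquiv hd v := rfl
  rw [matCoeff, dif_pos (hMat_mem hd v), this, Equiv.symm_apply_apply]

lemma matCoeff_ne_zero {d : ℤ} (hd : d = -4 ∨ d = -3) {α : ℤ × ℤ × ℤ × ℤ → ℂ}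
    {H : Matrix (Fin 2) (Fin 2) ℂ} (h : matCoeff hd α H ≠ 0) : ∃ v, hMat d v = H ∧ α v ≠ 0 := by
  have hH : H ∈ LambdaH d := by
    by_contra h'; exact h (by rw [matCoeff, dif_neg h'])
  obtain ⟨v, rfl⟩ := exists_hMat_eq hd hH
  exact ⟨v, rfl, by rwa [matCoeff_hMat] at h⟩

lemma IsFourierCoeff.matCoeff_supported {d : ℤ} (hd : d = -4 ∨ d = -3) {α : ℤ × ℤ × ℤ × ℤ → ℂ}
    (hα : IsFourierCoeff d α) (H : Matrix (Fin 2) (Fin 2) ℂ) (h : matCoeff hd α H ≠ 0) :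
    H ∈ HermLattice d := by
  obtain ⟨v, rfl, hv⟩ := matCoeff_ne_zero hd h
  exact ⟨hMat_mem hd v, (hMat_posSemidef_iff hd v).2 (hα.support v hv)⟩

lemma IsFourierCoeff.hasSum {d : ℤ} (hd : d = -4 ∨ d = -3) {α : ℤ × ℤ × ℤ × ℤ → ℂ}
    (hα : IsFourierCoeff d α) {Z : Matrix (Fin 2) (Fin 2) ℂ} (hZ : Z ∈ HermitianUpperHalfSpace) :
    HasSum (fun H : HermLattice d => matCoeff hd α H *
      Complex.exp (2 * Real.pi * Complex.I * ((H : Matrix (Fin 2) (Fin 2) ℂ) * Z).trace))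
      (fourierFun d α Z) := by
  have h1 := (hα.summable hd hZ).hasSum
  let f : Matrix (Fin 2) (Fin 2) ℂ → ℂ := fun H => matCoeff hd α H * eC (H * Z).trace
  have hsupp : Function.support f ⊆ HermLattice d := fun H hH =>
    hα.matCoeff_supported hd H (left_ne_zero_of_mul hH)
  refine (hasSum_subtype_iff_of_support_subset hsupp).2 ?_
  refine (hasSum_subtype_iff_of_support_subset (s := LambdaH d)
    (hsupp.trans fun H hH => hH.1)).1 ?_
  rw [← (lambdaEquiv hd).hasSum_iff]
  convert h1 using 1
  · funext v
    simp only [Function.comp_apply, lambdaEquiv_apply, f, matCoeff_hMat]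
  · rfl

lemma fourierFun_translate {d : ℤ} (hd : d = -4 ∨ d = -3) (α : ℤ × ℤ × ℤ × ℤ → ℂ)
    {S : Matrix (Fin 2) (Fin 2) ℂ} (hS : S.IsHermitian) (hO : ∀ i j, S i j ∈ ringInt d)
    (Z : Matrix (Fin 2) (Fin 2) ℂ) : fourierFun d α (Z + S) = fourierFun d α Z := by
  refine tsum_congr fun v => ?_
  obtain ⟨n, hn⟩ := exists_int_trace hd (hMat_mem hd v) hS hO
  rw [Matrix.mul_add, Matrix.trace_add, hn, eC_add_int]

lemma fourierFun_conj {d : ℤ} (hd : d = -4 ∨ d = -3) {α : ℤ × ℤ × ℤ × ℤ → ℂ}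
    {U V : Matrix (Fin 2) (Fin 2) ℂ} (hU : ∀ i j, U i j ∈ ringInt d)
    (hV : ∀ i j, V i j ∈ ringInt d) (h : Uᴴ * V = 1)
    (hα : ∀ v v', hMat d v' = Uᴴ * hMat d v * U → α v' = α v)
    (Z : Matrix (Fin 2) (Fin 2) ℂ) : fourierFun d α (U * Z * Uᴴ) = fourierFun d α Z := by
  let σ := ((lambdaEquiv hd).trans (lambdaConj hd hU hV h)).trans (lambdaEquiv hd).symm
  have hσ : ∀ v, hMat d (σ v) = Uᴴ * hMat d v * U := fun v => by
    simp only [σ, Equiv.trans_apply, hMat_symm]; rfl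
  rw [fourierFun, fourierFun, 
    ← σ.tsum_eq (fun v => α v * eC (hMat d v * Z).trace)]
  refine tsum_congr fun v => ?_
  rw [hα v _ (hσ v), hσ]
  congr 2
  rw [← Matrix.mul_assoc, ← Matrix.mul_assoc, Matrix.trace_mul_comm]
  simp only [Matrix.mul_assoc]

/-- The involution of the index set induced by transposition. -/
def transposeIdx (d : ℤ) (v : ℤ × ℤ × ℤ × ℤ) : ℤ × ℤ × ℤ × ℤ :=
  (v.1, v.2.1, -v.2.2.1 - v.2.2.2 * d, v.2.2.2)

lemma transposeIdx_involutive (d : ℤ) : Function.Involutive (transposeIdx d) := by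
  rintro ⟨n, m, a, b⟩
  simp [transposeIdx]

lemma fourierFun_transpose {d : ℤ} {α : ℤ × ℤ × ℤ × ℤ → ℂ}
    (hα : ∀ v, α (transposeIdx d v) = α v) (Z : Matrix (Fin 2) (Fin 2) ℂ) :
    fourierFun d α Zᵀ = fourierFun d α Z := by
  rw [fourierFun, fourierFun, ← (transposeIdx_involutive d).toPerm.tsum_eq]
  refine tsum_congr fun v => ?_
  simp only [Function.Involutive.coe_toPerm, hα]
  congr 2
  rw [hMat_trace, hMat_trace]
  simp only [transposeIdx, ← conj_dualElt, conj_conj, transpose_apply]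
  ring

/-! ### The coefficients of the Maass lift -/

/-- The greatest common divisor of the coordinates. -/
def content (v : ℤ × ℤ × ℤ × ℤ) : ℕ := Int.gcd (Int.gcd v.1 v.2.1) (Int.gcd v.2.2.1 v.2.2.2)

lemma dvd_content_iff {g : ℕ} {v : ℤ × ℤ × ℤ × ℤ} : g ∣ content v ↔
    (g : ℤ) ∣ v.1 ∧ (g : ℤ) ∣ v.2.1 ∧ (g : ℤ) ∣ v.2.2.1 ∧ (g : ℤ) ∣ v.2.2.2 := by
  rw [content, ← Int.natCast_dvd_natCast, Int.dvd_coe_gcd_iff, Int.dvd_coe_gcd_iff,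
    Int.dvd_coe_gcd_iff, and_assoc]

/-- The Fourier coefficients of the Maass lift of the sequence `c`. -/
def maassCoeff (d : ℤ) (k : ℕ) (c : ℤ → ℤ) (e : ℂ) (v : ℤ × ℤ × ℤ × ℤ) : ℂ :=
  open Classical in if v = 0 then e else if InCone d v then
    ((∑ g ∈ (content v).divisors, (g : ℤ) ^ (k - 1) * c (hDisc d v / (g : ℤ) ^ 2) : ℤ) : ℂ) else 0

lemma maassCoeff_zero (d : ℤ) (k : ℕ) (c : ℤ → ℤ) (e : ℂ) : maassCoeff d k c e 0 = e := by
  rw [maassCoeff, if_pos rfl]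

lemma maassCoeff_int (d : ℤ) (k : ℕ) (c : ℤ → ℤ) (e : ℂ) {v : ℤ × ℤ × ℤ × ℤ} (hv : v ≠ 0) :
    ∃ N : ℤ, maassCoeff d k c e v = N := by
  rw [maassCoeff, if_neg hv]
  split_ifs
  · exact ⟨_, rfl⟩
  · exact ⟨0, by simp⟩

lemma normForm_pos {d : ℤ} (hd : d = -4 ∨ d = -3) {a b : ℤ} (h : ¬(a = 0 ∧ b = 0)) :
    0 < normForm d a b := by
  have h4 := four_normForm hd a b
  by_contra! hn
  apply h
  rcases hd with rfl | rfl
  · have : b = 0 := by nlinarith [sq_nonneg b]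
    subst this
    refine ⟨?_, rfl⟩
    nlinarith [sq_nonneg a]
  · have : b = 0 := by nlinarith [sq_nonneg b]
    subst this
    refine ⟨?_, rfl⟩
    nlinarith [sq_nonneg a]

lemma normForm_nonneg {d : ℤ} (hd : d = -4 ∨ d = -3) (a b : ℤ) : 0 ≤ normForm d a b := by
  by_cases h : a = 0 ∧ b = 0
  · simp [normForm, h.1, h.2]
  · exact (normForm_pos hd h).le

lemma InCone.pos {d : ℤ} (hd : d = -4 ∨ d = -3) {v : ℤ × ℤ × ℤ × ℤ} (h : InCone d v)
    (hv : v ≠ 0) : 0 < v.1 + v.2.1 := by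
  obtain ⟨n, m, a, b⟩ := v
  obtain ⟨h1, h2, h3⟩ := h
  simp only at h1 h2 h3 ⊢
  by_contra! hn
  obtain rfl : n = 0 := by lia
  obtain rfl : m = 0 := by lia
  simp only [hDisc] at h3
  have := normForm_pos hd (a := a) (b := b) (by rintro ⟨rfl, rfl⟩; exact hv rfl)
  lia

lemma InCone.content_le {d : ℤ} (hd : d = -4 ∨ d = -3) {v : ℤ × ℤ × ℤ × ℤ} (h : InCone d v)
    (hv : v ≠ 0) : (content v : ℤ) ≤ v.1 + v.2.1 := by
  have hp := h.pos hd hv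
  obtain ⟨h1, h2, -⟩ := h
  obtain ⟨d1, d2, -⟩ := dvd_content_iff.1 (dvd_refl (content v))
  exact Int.le_of_dvd hp (dvd_add d1 d2)

lemma InCone.hDisc_le {d : ℤ} (hd : d = -4 ∨ d = -3) {v : ℤ × ℤ × ℤ × ℤ} (h : InCone d v) :
    hDisc d v ≤ (v.1 + v.2.1) ^ 2 := by
  obtain ⟨h1, h2, h3⟩ := h
  have := normForm_nonneg hd v.2.2.1 v.2.2.2
  have h12 := mul_nonneg h1 h2
  rw [hDisc]
  rcases hd with rfl | rfl <;> nlinarith [sq_nonneg (v.1 - v.2.1)]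

lemma isFourierCoeff_maassCoeff {d : ℤ} (hd : d = -4 ∨ d = -3) {k : ℕ} (hk : 1 ≤ k) {c : ℤ → ℤ}
    {C : ℝ} {A : ℕ} (hc : ∀ l : ℤ, 0 ≤ l → |(c l : ℝ)| ≤ C * (1 + l) ^ A) (e : ℂ) :
    IsFourierCoeff d (maassCoeff d k c e) := by
  constructor
  · intro v hv
    by_cases h0 : v = 0
    · subst h0; simp [InCone, hDisc, normForm]
    · by_contra h
      rw [maassCoeff, if_neg h0, if_neg h] at hv
      exact hv rfl
  · refine ⟨‖e‖ + |C|, k + 2 * A, fun v hv => ?_⟩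
    have hn : (0 : ℝ) ≤ v.1 := by exact_mod_cast hv.1
    have hm : (0 : ℝ) ≤ v.2.1 := by exact_mod_cast hv.2.1
    have h1s : (1 : ℝ) ≤ (1 + v.1 + v.2.1) ^ (k + 2 * A) := one_le_pow₀ (by linarith)
    by_cases h0 : v = 0
    · subst h0; simp [maassCoeff_zero]
    rw [maassCoeff, if_neg h0, if_pos hv]
    set s : ℝ := 1 + v.1 + v.2.1 with hs
    have hs1 : 1 ≤ s := by linarith
    have hcont : (content v : ℝ) ≤ s := by
      have := hv.content_le hd h0
      have h2 : (content v : ℝ) ≤ v.1 + v.2.1 := by exact_mod_cast this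
      linarith
    have hdisc : (1 + hDisc d v : ℝ) ≤ s ^ 2 := by
      have := hv.hDisc_le hd
      have h2 : (hDisc d v : ℝ) ≤ (v.1 + v.2.1) ^ 2 := by exact_mod_cast this
      nlinarith
    have hterm : ∀ g ∈ (content v).divisors,
        |(((g : ℤ) ^ (k - 1) * c (hDisc d v / (g : ℤ) ^ 2) : ℤ) : ℝ)| ≤
          s ^ (k - 1) * (|C| * (s ^ 2) ^ A) := by
      intro g hg
      have hgle : (g : ℝ) ≤ s := le_trans (by exact_mod_cast Nat.divisor_le hg) hcont
      have hq0 : 0 ≤ hDisc d v / (g : ℤ) ^ 2 := Int.ediv_nonneg hv.2.2 (by positivity)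
      have hq1 : hDisc d v / (g : ℤ) ^ 2 ≤ hDisc d v := Int.ediv_le_self _ hv.2.2
      have hq0' : (0 : ℝ) ≤ (hDisc d v / (g : ℤ) ^ 2 : ℤ) := by exact_mod_cast hq0
      have hq1' : ((hDisc d v / (g : ℤ) ^ 2 : ℤ) : ℝ) ≤ hDisc d v := by exact_mod_cast hq1
      rw [Int.cast_mul, abs_mul]
      refine mul_le_mul ?_ ((hc _ hq0).trans ?_) (abs_nonneg _) (by positivity)
      · push_cast
        rw [abs_of_nonneg (by positivity)]
        gcongr
      · refine mul_le_mul (le_abs_self C) (pow_le_pow_left₀ (by positivity) ?_ _) (by positivity)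
          (abs_nonneg C)
        linarith
    rw [Complex.norm_intCast]
    calc _ ≤ ∑ g ∈ (content v).divisors, s ^ (k - 1) * (|C| * (s ^ 2) ^ A) := by
          rw [Int.cast_sum]
          exact (Finset.abs_sum_le_sum_abs _ _).trans (Finset.sum_le_sum hterm)
      _ = (content v).divisors.card * (s ^ (k - 1) * (|C| * (s ^ 2) ^ A)) := by
          rw [Finset.sum_const, nsmul_eq_mul]
      _ ≤ s * (s ^ (k - 1) * (|C| * (s ^ 2) ^ A)) := by
          gcongr
          exact le_trans (by exact_mod_cast Nat.card_divisors_le_self _) hcont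
      _ = |C| * s ^ (k + 2 * A) := by
          obtain ⟨j, rfl⟩ := Nat.exists_eq_add_of_le hk
          rw [Nat.add_sub_cancel_left]
          ring
      _ ≤ (‖e‖ + |C|) * s ^ (k + 2 * A) := by
          gcongr
          linarith [norm_nonneg e]

/-! ### Invariance of the coefficients -/

lemma hDisc_cast {d : ℤ} (hd : d = -4 ∨ d = -3) (v : ℤ × ℤ × ℤ × ℤ) :
    (hDisc d v : ℂ) = -d * (hMat d v).det := by
  have h : dualElt d v.2.2.1 v.2.2.2 * (starRingEnd ℂ) (dualElt d v.2.2.1 v.2.2.2) * (-d) =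
      normForm d v.2.2.1 v.2.2.2 := by
    rw [mul_conj]
    have := normSq_dualElt hd v.2.2.1 v.2.2.2
    have hd0 : (d : ℝ) ≠ 0 := by rcases hd with rfl | rfl <;> norm_num
    rw [this]; push_cast
    have hd0' : (d : ℂ) ≠ 0 := by exact_mod_cast hd0
    field_simp
  rw [hMat, Matrix.det_fin_two_of, hDisc]
  push_cast
  linear_combination h

lemma hMat_smul (d g : ℤ) (v : ℤ × ℤ × ℤ × ℤ) : hMat d (g • v) = (g : ℂ) • hMat d v := by
  ext i j
  fin_cases i <;> fin_cases j <;> simp [hMat, dualElt] <;> ring_nf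

lemma dvd_content_iff_smul {g : ℕ} {v : ℤ × ℤ × ℤ × ℤ} :
    g ∣ content v ↔ ∃ u, v = (g : ℤ) • u := by
  rw [dvd_content_iff]
  constructor
  · rintro ⟨⟨n, h1⟩, ⟨m, h2⟩, ⟨a, h3⟩, ⟨b, h4⟩⟩
    exact ⟨(n, m, a, b), by ext <;> simp [*]⟩
  · rintro ⟨u, rfl⟩
    simp

lemma dvd_content_conj {d : ℤ} (hd : d = -4 ∨ d = -3) {U : Matrix (Fin 2) (Fin 2) ℂ}
    (hU : ∀ i j, U i j ∈ ringInt d) {v v' : ℤ × ℤ × ℤ × ℤ}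
    (h : hMat d v' = Uᴴ * hMat d v * U) {g : ℕ} (hg : g ∣ content v) : g ∣ content v' := by
  obtain ⟨u, rfl⟩ := dvd_content_iff_smul.1 hg
  obtain ⟨u', hu'⟩ := exists_hMat_eq hd (lambdaH_conj_mem hd (hMat_mem hd u) hU)
  refine dvd_content_iff_smul.2 ⟨u', hMat_injective hd ?_⟩
  rw [h, hMat_smul, hMat_smul, hu']
  simp

lemma maassCoeff_conj {d : ℤ} (hd : d = -4 ∨ d = -3) (k : ℕ) (c : ℤ → ℤ) (e : ℂ)
    {U V : Matrix (Fin 2) (Fin 2) ℂ} (hU : ∀ i j, U i j ∈ ringInt d)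
    (hV : ∀ i j, V i j ∈ ringInt d) (h : Uᴴ * V = 1) (v v' : ℤ × ℤ × ℤ × ℤ)
    (hv : hMat d v' = Uᴴ * hMat d v * U) : maassCoeff d k c e v' = maassCoeff d k c e v := by
  have h2 : V * Uᴴ = 1 := mul_eq_one_comm.1 h
  have h3 : U * Vᴴ = 1 := by
    have := congrArg conjTranspose h2
    simpa using this
  have hv' : hMat d v = (Vᴴ)ᴴ * hMat d v' * Vᴴ := by
    rw [hv, conjTranspose_conjTranspose]
    simp only [Matrix.mul_assoc, h3, Matrix.mul_one]
    rw [← Matrix.mul_assoc, h2, Matrix.one_mul]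
  have hVH : ∀ i j, Vᴴ i j ∈ ringInt d := fun i j => ringInt_conj (hV j i)
  have hcont : content v' = content v :=
    Nat.dvd_antisymm (dvd_content_conj hd hVH hv' dvd_rfl) (dvd_content_conj hd hU hv dvd_rfl)
  have hcone : InCone d v' ↔ InCone d v := by
    rw [← hMat_posSemidef_iff hd, ← hMat_posSemidef_iff hd]
    constructor
    · intro h; rw [hv']; exact h.conjTranspose_mul_mul_same _
    · intro h; rw [hv]; exact h.conjTranspose_mul_mul_same _
  have hz : v' = 0 ↔ v = 0 := by
    have h0 : hMat d 0 = 0 := by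
      simpa using hMat_smul d 0 0
    constructor
    · rintro rfl; apply hMat_injective hd; rw [hv', h0]; simp
    · rintro rfl; apply hMat_injective hd; rw [hv, h0]; simp
  have hdet : U.det ∈ ringInt d ∧ V.det ∈ ringInt d := by
    constructor <;> rw [Matrix.det_fin_two, sub_eq_add_neg] <;>
    refine ringInt_add (ringInt_mul hd ?_ ?_) (ringInt_neg (ringInt_mul hd ?_ ?_)) <;>
    solve_by_elim
  have hnorm : normSq U.det = 1 := by
    have e1 := congrArg (fun M => normSq (Matrix.det M)) h
    simp only [det_mul, det_conjTranspose, normSq_mul, det_one, normSq_one] at e1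
    have e2 : normSq (star U.det) = normSq U.det := normSq_conj _
    rw [e2] at e1
    obtain ⟨a, ha⟩ := normSq_nat hd hdet.1
    obtain ⟨b, hb⟩ := normSq_nat hd hdet.2
    rw [ha, hb] at e1
    have e3 : a * b = 1 := by exact_mod_cast e1
    rw [ha, Nat.eq_one_of_mul_eq_one_right e3]; simp
  have hdisc : hDisc d v' = hDisc d v := by
    have : (hDisc d v' : ℂ) = hDisc d v := by
      rw [hDisc_cast hd, hDisc_cast hd, hv, det_mul, det_mul, det_conjTranspose]
      have : star U.det * U.det = 1 := by
        have := normSq_eq_conj_mul_self (z := U.det)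
        rw [hnorm] at this
        simpa using this.symm
      linear_combination (-d * (hMat d v).det) * this
    exact_mod_cast this
  rw [maassCoeff, maassCoeff, hcont, hdisc]
  classical exact if_congr hz rfl (if_congr hcone rfl rfl)

lemma maassCoeff_transposeIdx {d : ℤ} (hd : d = -4 ∨ d = -3) (k : ℕ) (c : ℤ → ℤ) (e : ℂ)
    (v : ℤ × ℤ × ℤ × ℤ) : maassCoeff d k c e (transposeIdx d v) = maassCoeff d k c e v := by
  have hdvd : ∀ v, content v ∣ content (transposeIdx d v) := by
    intro v
    obtain ⟨h1, h2, h3, h4⟩ := dvd_content_iff.1 (dvd_refl (content v))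
    exact dvd_content_iff.2 ⟨h1, h2, dvd_sub (dvd_neg.2 h3) (h4.mul_right d), h4⟩
  have hcont : content (transposeIdx d v) = content v := by
    refine Nat.dvd_antisymm ?_ (hdvd v)
    have := hdvd (transposeIdx d v)
    rwa [transposeIdx_involutive d v] at this
  have hdisc : hDisc d (transposeIdx d v) = hDisc d v := by
    simp only [hDisc, transposeIdx, normForm]
    rcases hd with rfl | rfl <;> ring_nf
  have hz : transposeIdx d v = 0 ↔ v = 0 := by
    constructor
    · intro h
      rw [← transposeIdx_involutive d v, h]; simp [transposeIdx]
    · rintro rfl; simp [transposeIdx]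
  have hcone : InCone d (transposeIdx d v) ↔ InCone d v := by
    rw [InCone, InCone, hdisc]; rfl
  rw [maassCoeff, maassCoeff, hcont, hdisc]
  classical exact if_congr hz rfl (if_congr hcone rfl rfl)

/-! ### Hecke operators on functions of Jacobi type -/

/-- The transformation laws of a Jacobi form of weight `k` and index one under the generators of
the modular group. -/
structure IsJacobiType (k : ℕ) (φ : ℂ → ℂ → ℂ → ℂ) : Prop where
  translate : ∀ τ z w, φ (τ + 1) z w = φ τ z w
  invert : ∀ τ z w, 0 < τ.im → φ (-1 / τ) (z / τ) (w / τ) = τ ^ k * eC (z * w / τ) * φ τ z w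

/-- The slash action of an integral matrix of positive determinant. -/
def jacobiSlash (k : ℕ) (φ : ℂ → ℂ → ℂ → ℂ) (A : Matrix (Fin 2) (Fin 2) ℤ) (τ z w : ℂ) : ℂ :=
  ((A 1 0 * τ + A 1 1) ^ k)⁻¹ * eC (-(A.det * A 1 0 * (z * w)) / (A 1 0 * τ + A 1 1)) *
    φ ((A 0 0 * τ + A 0 1) / (A 1 0 * τ + A 1 1)) (A.det * z / (A 1 0 * τ + A 1 1))
      (A.det * w / (A 1 0 * τ + A 1 1))

lemma linear_ne_zero {a b : ℤ} (h : ¬(a = 0 ∧ b = 0)) {τ : ℂ} (hτ : 0 < τ.im) :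
    (a * τ + b : ℂ) ≠ 0 := by
  intro h0
  have him : (a : ℝ) * τ.im = 0 := by simpa using congrArg Complex.im h0
  have ha : a = 0 := by
    rcases mul_eq_zero.1 him with h1 | h1
    · exact_mod_cast h1
    · exact absurd h1 hτ.ne'
  subst ha
  exact h ⟨rfl, by simpa using h0⟩

lemma moebius_im_pos {A : Matrix (Fin 2) (Fin 2) ℤ} (hA : 0 < A.det) {τ : ℂ} (hτ : 0 < τ.im) :
    0 < ((A 0 0 * τ + A 0 1) / (A 1 0 * τ + A 1 1)).im := by
  have hne : (A 1 0 * τ + A 1 1 : ℂ) ≠ 0 := by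
    refine linear_ne_zero ?_ hτ
    rintro ⟨h1, h2⟩
    simp [det_fin_two, h1, h2] at hA
  have hdet : (0 : ℝ) < A.det := by exact_mod_cast hA
  have : ((A 0 0 * τ + A 0 1) / (A 1 0 * τ + A 1 1)).im =
      A.det * τ.im / normSq (A 1 0 * τ + A 1 1) := by
    rw [div_im, det_fin_two]
    have := normSq_pos.2 hne
    simp
    field_simp
    ring
  rw [this]
  have := normSq_pos.2 hne
  positivity

lemma IsJacobiType.slash_T {k : ℕ} {φ : ℂ → ℂ → ℂ → ℂ} (hφ : IsJacobiType k φ)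
    {A : Matrix (Fin 2) (Fin 2) ℤ} (hA : 0 < A.det) {τ : ℂ} (hτ : 0 < τ.im) (z w : ℂ) :
    jacobiSlash k φ (!![1, 1; 0, 1] * A) τ z w = jacobiSlash k φ A τ z w := by
  have hne : (A 1 0 * τ + A 1 1 : ℂ) ≠ 0 := by
    refine linear_ne_zero ?_ hτ
    rintro ⟨h1, h2⟩
    simp [det_fin_two, h1, h2] at hA
  have hdet : (!![1, 1; 0, 1] * A).det = A.det := by rw [det_mul]; simp [det_fin_two]
  have e : ∀ j, (!![1, 1; 0, 1] * A : Matrix (Fin 2) (Fin 2) ℤ) 0 j = A 0 j + A 1 j ∧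
      (!![1, 1; 0, 1] * A : Matrix (Fin 2) (Fin 2) ℤ) 1 j = A 1 j := by
    intro j; simp [Matrix.mul_apply, Fin.sum_univ_two]
  simp only [jacobiSlash, hdet, (e _).1, (e _).2]
  rw [← hφ.translate ((A 0 0 * τ + A 0 1) / (A 1 0 * τ + A 1 1))]
  congr 2
  push_cast
  field_simp
  ring

lemma IsJacobiType.slash_S {k : ℕ} {φ : ℂ → ℂ → ℂ → ℂ} (hφ : IsJacobiType k φ)
    {A : Matrix (Fin 2) (Fin 2) ℤ} (hA : 0 < A.det) {τ : ℂ} (hτ : 0 < τ.im) (z w : ℂ) :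
    jacobiSlash k φ (!![0, -1; 1, 0] * A) τ z w = jacobiSlash k φ A τ z w := by
  have hne : (A 1 0 * τ + A 1 1 : ℂ) ≠ 0 := by
    refine linear_ne_zero ?_ hτ
    rintro ⟨h1, h2⟩
    simp [det_fin_two, h1, h2] at hA
  have hne' : (A 0 0 * τ + A 0 1 : ℂ) ≠ 0 := by
    refine linear_ne_zero ?_ hτ
    rintro ⟨h1, h2⟩
    simp [det_fin_two, h1, h2] at hA
  have hdet : (!![0, -1; 1, 0] * A).det = A.det := by rw [det_mul]; simp [det_fin_two]
  have e : ∀ j, (!![0, -1; 1, 0] * A : Matrix (Fin 2) (Fin 2) ℤ) 0 j = - A 1 j ∧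
      (!![0, -1; 1, 0] * A : Matrix (Fin 2) (Fin 2) ℤ) 1 j = A 0 j := by
    intro j; simp [Matrix.mul_apply, Fin.sum_univ_two]
  simp only [jacobiSlash, hdet, (e _).1, (e _).2]
  have h := hφ.invert _ (A.det * z / (A 1 0 * τ + A 1 1)) (A.det * w / (A 1 0 * τ + A 1 1))
    (moebius_im_pos hA hτ)
  have hD : (A.det : ℂ) = A 0 0 * A 1 1 - A 0 1 * A 1 0 := by rw [det_fin_two]; push_cast; ring
  have h1 : -1 / ((A 0 0 * τ + A 0 1) / (A 1 0 * τ + A 1 1)) =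
      (((-A 1 0 : ℤ) : ℂ) * τ + ((-A 1 1 : ℤ) : ℂ)) / (A 0 0 * τ + A 0 1) := by
    push_cast; field_simp; ring
  have h2 : ∀ x : ℂ, x / (A 1 0 * τ + A 1 1) / ((A 0 0 * τ + A 0 1) / (A 1 0 * τ + A 1 1)) =
      x / (A 0 0 * τ + A 0 1) := by
    intro x; field_simp
  rw [h1, h2, h2] at h
  rw [h]
  have h3 : -(A.det * A 1 0 * (z * w)) / (A 1 0 * τ + A 1 1) =
      -(A.det * A 0 0 * (z * w)) / (A 0 0 * τ + A 0 1) +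
      A.det * z / (A 1 0 * τ + A 1 1) * (A.det * w / (A 1 0 * τ + A 1 1)) /
        ((A 0 0 * τ + A 0 1) / (A 1 0 * τ + A 1 1)) := by
    rw [hD]; field_simp; ring
  rw [h3, eC_add, div_pow]
  field_simp

lemma IsJacobiType.slash_smul {k : ℕ} {φ : ℂ → ℂ → ℂ → ℂ} (hφ : IsJacobiType k φ) {m : ℤ}
    (hm : 0 < m) (γ : SpecialLinearGroup (Fin 2) ℤ) (A : FixedDetMatrix (Fin 2) ℤ m) {τ : ℂ}
    (hτ : 0 < τ.im) (z w : ℂ) :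
    jacobiSlash k φ (γ • A).1 τ z w = jacobiSlash k φ A.1 τ z w := by
  have hγ : γ ∈ Subgroup.closure {ModularGroup.S, ModularGroup.T} := by
    rw [SpecialLinearGroup.SL2Z_generators]; trivial
  induction hγ using Subgroup.closure_induction generalizing A with
  | mem x hx =>
    have hA : 0 < A.1.det := by rw [A.2]; exact hm
    rcases hx with rfl | rfl
    · exact hφ.slash_S hA hτ z w
    · exact hφ.slash_T hA hτ z w
  | one => rw [one_smul]
  | mul x y _ _ hx hy => rw [mul_smul, hx, hy]
  | inv x _ hx =>
    have := hx (x⁻¹ • A)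
    rw [smul_inv_smul] at this
    exact this.symm

/-- Right multiplication by the inversion `S`. -/
def rightS {m : ℤ} (A : FixedDetMatrix (Fin 2) ℤ m) : FixedDetMatrix (Fin 2) ℤ m :=
  ⟨A.1 * !![0, -1; 1, 0], by rw [det_mul, A.2]; simp [det_fin_two]⟩

lemma rightS_smul {m : ℤ} (γ : SpecialLinearGroup (Fin 2) ℤ) (A : FixedDetMatrix (Fin 2) ℤ m) :
    rightS (γ • A) = γ • rightS A := by
  apply FixedDetMatrices.ext'
  rw [FixedDetMatrices.smul_coe]
  simp only [rightS, FixedDetMatrices.smul_coe, Matrix.mul_assoc]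

lemma rightS_four {m : ℤ} (A : FixedDetMatrix (Fin 2) ℤ m) :
    rightS (rightS (rightS (rightS A))) = A := by
  apply FixedDetMatrices.ext'
  have h : (!![0, -1; 1, 0] : Matrix (Fin 2) (Fin 2) ℤ) *
      (!![0, -1; 1, 0] * (!![0, -1; 1, 0] * !![0, -1; 1, 0])) = 1 := by decide
  simp only [rightS, Matrix.mul_assoc, h, Matrix.mul_one]

lemma jacobiSlash_rightS (k : ℕ) (φ : ℂ → ℂ → ℂ → ℂ) {m : ℤ} (hm : 0 < m)
    (A : FixedDetMatrix (Fin 2) ℤ m) {τ : ℂ} (hτ : 0 < τ.im) (z w : ℂ) :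
    jacobiSlash k φ A.1 (-1 / τ) (z / τ) (w / τ) =
      τ ^ k * eC (m * (z * w) / τ) * jacobiSlash k φ (rightS A).1 τ z w := by
  have hdet : (rightS A).1.det = m := (rightS A).2
  have hτ0 : τ ≠ 0 := by rintro rfl; simp at hτ
  have hA := A.2
  have hne : (A.1 1 1 * τ + (-A.1 1 0 : ℤ) : ℂ) ≠ 0 := by
    refine linear_ne_zero ?_ hτ
    rintro ⟨h1, h2⟩
    rw [neg_eq_zero] at h2
    simp [det_fin_two, h1, h2] at hA
    exact hm.ne hA
  have e : ∀ i, (rightS A).1 i 0 = A.1 i 1 ∧ (rightS A).1 i 1 = - A.1 i 0 := by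
    intro j; simp [rightS, Matrix.mul_apply, Fin.sum_univ_two]
  simp only [jacobiSlash, hdet, hA, (e _).1, (e _).2]
  have h1 : (A.1 1 0 : ℂ) * (-1 / τ) + A.1 1 1 = (A.1 1 1 * τ + (-A.1 1 0 : ℤ)) / τ := by
    push_cast; field_simp; ring
  have h2 : (A.1 0 0 : ℂ) * (-1 / τ) + A.1 0 1 = (A.1 0 1 * τ + (-A.1 0 0 : ℤ)) / τ := by
    push_cast; field_simp; ring
  rw [h1, h2]
  have h3 : -(m * A.1 1 0 * (z / τ * (w / τ))) / ((A.1 1 1 * τ + (-A.1 1 0 : ℤ) : ℂ) / τ) =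
      m * (z * w) / τ + -(m * A.1 1 1 * (z * w)) / (A.1 1 1 * τ + (-A.1 1 0 : ℤ)) := by
    generalize hD : (A.1 1 1 * τ + (-A.1 1 0 : ℤ) : ℂ) = D at hne
    have hD' : (A.1 1 0 : ℂ) = A.1 1 1 * τ - D := by rw [← hD]; push_cast; ring
    rw [hD']; field_simp; ring
  have h4 : ∀ x : ℂ, m * (x / τ) / ((A.1 1 1 * τ + (-A.1 1 0 : ℤ) : ℂ) / τ) =
      m * x / (A.1 1 1 * τ + (-A.1 1 0 : ℤ)) := by
    intro x; field_simp
  rw [h3, h4, h4, eC_add, div_div_div_cancel_right₀ hτ0, div_pow, inv_div]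
  field_simp

lemma exists_smul_reps {m : ℤ} (hm : m ≠ 0) (A : FixedDetMatrix (Fin 2) ℤ m) :
    ∃ γ : SpecialLinearGroup (Fin 2) ℤ, ∃ R ∈ FixedDetMatrices.reps m, A = γ • R := by
  induction A using FixedDetMatrices.induction_on hm with
  | h0 A h1 h2 h3 h4 => exact ⟨1, A, ⟨h1, h2, h3, h4⟩, (one_smul _ _).symm⟩
  | hS B hB =>
    obtain ⟨γ, R, hR, rfl⟩ := hB
    exact ⟨ModularGroup.S * γ, R, hR, (mul_smul _ _ _).symm⟩
  | hT B hB =>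
    obtain ⟨γ, R, hR, rfl⟩ := hB
    exact ⟨ModularGroup.T * γ, R, hR, (mul_smul _ _ _).symm⟩

lemma reps_unique {m : ℤ} (hm : 0 < m) {γ : SpecialLinearGroup (Fin 2) ℤ}
    {R R' : FixedDetMatrix (Fin 2) ℤ m} (hR : R ∈ FixedDetMatrices.reps m)
    (hR' : R' ∈ FixedDetMatrices.reps m) (h : R' = γ • R) : R' = R := by
  obtain ⟨h1, h2, h3, h4⟩ := hR
  obtain ⟨h1', h2', h3', h4'⟩ := hR'
  have hdR := R.2
  have hdR' := R'.2
  have hγ := γ.2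
  rw [det_fin_two] at hdR hdR' hγ
  have e : ∀ i j, R'.1 i j = γ.1 i 0 * R.1 0 j + γ.1 i 1 * R.1 1 j := by
    intro i j; rw [h, FixedDetMatrices.smul_coe, Matrix.mul_apply, Fin.sum_univ_two]
  have e00 := e 0 0
  have e01 := e 0 1
  have e10 := e 1 0
  have e11 := e 1 1
  rw [h1] at e00 e10 hdR
  rw [h1'] at e10 hdR'
  have hd : 0 < R.1 1 1 := by
    by_contra! hn; nlinarith
  have hd' : 0 < R'.1 1 1 := by
    by_contra! hn; nlinarith
  rw [abs_of_nonneg h3, abs_of_pos hd] at h4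
  rw [abs_of_nonneg h3', abs_of_pos hd'] at h4'
  have hc : γ.1 1 0 = 0 := by
    have : γ.1 1 0 * R.1 0 0 = 0 := by linarith
    exact (mul_eq_zero.1 this).resolve_right h2.ne'
  rw [hc] at e11 hγ
  have ha : γ.1 0 0 = 1 := by
    have h00 : 0 < γ.1 0 0 := by
      by_contra! hn; nlinarith
    have : γ.1 0 0 ∣ 1 := ⟨γ.1 1 1, by linarith⟩
    exact Int.eq_one_of_dvd_one h00.le this
  rw [ha] at e00 e01 hγ
  have hd1 : γ.1 1 1 = 1 := by linarith
  rw [hd1] at e11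
  have hb : γ.1 0 1 = 0 := by
    have hlt : γ.1 0 1 < 1 := by
      by_contra! hn; nlinarith
    have hgt : -1 < γ.1 0 1 := by
      by_contra! hn; nlinarith
    lia
  rw [hb] at e01
  apply FixedDetMatrices.ext
  intro i j
  fin_cases i <;> fin_cases j
  · simpa using e00
  · simpa using e01
  · simp [h1, h1']
  · simpa using e11

/-- The Hecke operator: the sum of the slash translates over the representatives of determinant
`m`. -/
def heckeSum (k : ℕ) (φ : ℂ → ℂ → ℂ → ℂ) (m : ℤ) (τ z w : ℂ) : ℂ :=
  ∑ R : FixedDetMatrices.reps m, jacobiSlash k φ R.1.1 τ z w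

lemma IsJacobiType.heckeSum_invert {k : ℕ} {φ : ℂ → ℂ → ℂ → ℂ} (hφ : IsJacobiType k φ) {m : ℤ}
    (hm : 0 < m) {τ : ℂ} (hτ : 0 < τ.im) (z w : ℂ) :
    heckeSum k φ m (-1 / τ) (z / τ) (w / τ) =
      τ ^ k * eC (m * (z * w) / τ) * heckeSum k φ m τ z w := by
  have hex : ∀ R : FixedDetMatrices.reps m, ∃ R' : FixedDetMatrices.reps m,
      ∃ γ : SpecialLinearGroup (Fin 2) ℤ, rightS R.1 = γ • R'.1 := by
    intro R
    obtain ⟨γ, R', hR', h⟩ := exists_smul_reps hm.ne' (rightS R.1)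
    exact ⟨⟨R', hR'⟩, γ, h⟩
  choose σ γ hσ using hex
  have hinj : Function.Injective σ := by
    intro R₁ R₂ h
    have h12 : rightS R₂.1 = rightS ((γ R₂ * (γ R₁)⁻¹) • R₁.1) := by
      rw [rightS_smul, hσ R₁, hσ R₂, h, mul_smul, inv_smul_smul]
    have h4 := congrArg (fun A => rightS (rightS (rightS A))) h12
    simp only [rightS_four] at h4
    exact (Subtype.ext (reps_unique hm R₁.2 R₂.2 h4)).symm
  have hbij : Function.Bijective σ := Finite.injective_iff_bijective.1 hinj
  rw [heckeSum, heckeSum, ← hbij.sum_comp (fun R => jacobiSlash k φ R.1.1 τ z w), Finset.mul_sum]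
  refine Finset.sum_congr rfl fun R _ => ?_
  rw [jacobiSlash_rightS k φ hm R.1 hτ, hσ, hφ.slash_smul hm _ _ hτ]

/-! ### The Jacobi function attached to a sequence -/

/-- The exponent of the Fourier expansion of a Jacobi function. -/
def jacobiExp (d : ℤ) (x : ℤ × ℤ × ℤ) (τ z w : ℂ) : ℂ :=
  x.1 * τ + dualElt d x.2.1 x.2.2 * w + (starRingEnd ℂ) (dualElt d x.2.1 x.2.2) * z

/-- The Jacobi function of index one with coefficients `c`. -/
def jacobiFun (d : ℤ) (c : ℤ → ℤ) (τ z w : ℂ) : ℂ :=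
  ∑' x : ℤ × ℤ × ℤ, (c (-d * x.1 - normForm d x.2.1 x.2.2) : ℂ) * eC (jacobiExp d x τ z w)

/-- Sequences of polynomial growth supported on the non-negative integers. -/
structure IsPolyGrowth (c : ℤ → ℤ) : Prop where
  neg : ∀ l, l < 0 → c l = 0
  growth : ∃ (C : ℝ) (A : ℕ), ∀ l : ℤ, 0 ≤ l → |(c l : ℝ)| ≤ C * (1 + l) ^ A

lemma IsPolyGrowth.isFourierCoeff {d : ℤ} (hd : d = -4 ∨ d = -3) {k : ℕ} (hk : 1 ≤ k) {c : ℤ → ℤ}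
    (hc : IsPolyGrowth c) (e : ℂ) : IsFourierCoeff d (maassCoeff d k c e) := by
  obtain ⟨C, A, h⟩ := hc.growth
  exact isFourierCoeff_maassCoeff hd hk h e

/-- The matrix with the given entries. -/
lemma exists_mem_upperHalfSpace {τ : ℂ} (hτ : 0 < τ.im) (z w : ℂ) :
    ∃ τ' : ℂ, !![τ, z; w, τ'] ∈ HermitianUpperHalfSpace := by
  refine ⟨((normSq (z - (starRingEnd ℂ) w) / (4 * τ.im) + 1 : ℝ) : ℂ) * I, ?_⟩
  rw [mem_upperHalfSpace_iff]
  have h : (((normSq (z - (starRingEnd ℂ) w) / (4 * τ.im) + 1 : ℝ) : ℂ) * I).im =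
      normSq (z - (starRingEnd ℂ) w) / (4 * τ.im) + 1 := by rw [im_ofReal_mul]; simp
  simp only [of_apply, cons_val_zero, cons_val_one, cons_val', cons_val_fin_one, h]
  refine ⟨hτ, ?_⟩
  have : 4 * (τ.im * (normSq (z - (starRingEnd ℂ) w) / (4 * τ.im) + 1)) =
      normSq (z - (starRingEnd ℂ) w) + 4 * τ.im := by field_simp
  rw [this]; linarith

/-- The Fourier index with second coordinate `m`. -/
def fiberIdx (m : ℤ) (x : ℤ × ℤ × ℤ) : ℤ × ℤ × ℤ × ℤ := (x.1, m, x.2.1, x.2.2)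

lemma fiberIdx_injective (m : ℤ) : Function.Injective (fiberIdx m) := by
  rintro ⟨n, a, b⟩ ⟨n', a', b'⟩ h
  simp only [fiberIdx, Prod.mk.injEq] at h ⊢
  exact ⟨h.1, h.2.2⟩

lemma trace_fiberIdx (d m : ℤ) (x : ℤ × ℤ × ℤ) (Z : Matrix (Fin 2) (Fin 2) ℂ) :
    (hMat d (fiberIdx m x) * Z).trace = m * Z 1 1 + jacobiExp d x (Z 0 0) (Z 0 1) (Z 1 0) := by
  rw [hMat_trace, jacobiExp, fiberIdx]; ring

lemma IsFourierCoeff.summable_fiber {d : ℤ} (hd : d = -4 ∨ d = -3) {α : ℤ × ℤ × ℤ × ℤ → ℂ}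
    (hα : IsFourierCoeff d α) (m : ℤ) {τ : ℂ} (hτ : 0 < τ.im) (z w : ℂ) :
    Summable fun x => α (fiberIdx m x) * eC (jacobiExp d x τ z w) := by
  obtain ⟨τ', hZ⟩ := exists_mem_upperHalfSpace hτ z w
  have h := ((hα.summable hd hZ).comp_injective (fiberIdx_injective m)).mul_right (eC (-(m * τ')))
  refine h.congr fun x => ?_
  rw [Function.comp_apply, trace_fiberIdx, mul_assoc, ← eC_add]
  simp

lemma maassCoeff_fiber_pos {d : ℤ} (hd : d = -4 ∨ d = -3) (k : ℕ) {c : ℤ → ℤ}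
    (hc : ∀ l, l < 0 → c l = 0) (e : ℂ) {m : ℕ} (hm : 0 < m) (x : ℤ × ℤ × ℤ) :
    maassCoeff d k c e (fiberIdx m x) = ∑ g ∈ m.divisors,
      if (g : ℤ) ∣ x.1 ∧ (g : ℤ) ∣ x.2.1 ∧ (g : ℤ) ∣ x.2.2 then
        (g : ℂ) ^ (k - 1) * c (hDisc d (fiberIdx m x) / (g : ℤ) ^ 2) else 0 := by
  have hne : fiberIdx m x ≠ 0 := by
    intro h
    have : (m : ℤ) = 0 := congrArg (fun v => v.2.1) h
    lia
  rw [maassCoeff, if_neg hne, ← Finset.sum_filter]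
  have hdiv : (content (fiberIdx m x)).divisors =
      m.divisors.filter fun g : ℕ => (g : ℤ) ∣ x.1 ∧ (g : ℤ) ∣ x.2.1 ∧ (g : ℤ) ∣ x.2.2 := by
    have h0 : content (fiberIdx m x) ≠ 0 := by
      intro h
      have h1 := (dvd_content_iff (v := fiberIdx m x)).1 (by rw [h])
      have := h1.2.1
      simp [fiberIdx] at this
      lia
    ext g
    rw [Nat.mem_divisors, Finset.mem_filter, Nat.mem_divisors, dvd_content_iff]
    simp only [fiberIdx, Int.natCast_dvd_natCast]
    constructor
    · rintro ⟨⟨h1, h2, h3, h4⟩, -⟩; exact ⟨⟨h2, hm.ne'⟩, h1, h3, h4⟩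
    · rintro ⟨⟨h2, -⟩, h1, h3, h4⟩; exact ⟨⟨h1, h2, h3, h4⟩, h0⟩
  split_ifs with h
  · rw [hdiv]; push_cast; rfl
  · symm
    refine Finset.sum_eq_zero fun g hg => ?_
    have hneg : hDisc d (fiberIdx m x) < 0 := by
      by_contra! h2
      refine h ⟨?_, by simp [fiberIdx], h2⟩
      have hN := normForm_nonneg hd x.2.1 x.2.2
      simp only [hDisc, fiberIdx] at h2 ⊢
      by_contra! h3
      have hm' : (0 : ℤ) < m := by exact_mod_cast hm
      have := mul_neg_of_neg_of_pos h3 hm'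
      rcases hd with rfl | rfl <;> linarith
    have hg0 : 0 < g := Nat.pos_of_mem_divisors (Finset.mem_filter.1 hg).1
    have : hDisc d (fiberIdx m x) / (g : ℤ) ^ 2 < 0 := Int.ediv_neg_of_neg_of_pos hneg (by positivity)
    rw [hc _ this]; simp

lemma IsPolyGrowth.summable_jacobi {d : ℤ} (hd : d = -4 ∨ d = -3) {c : ℤ → ℤ}
    (hc : IsPolyGrowth c) {τ : ℂ} (hτ : 0 < τ.im) (z w : ℂ) :
    Summable fun x : ℤ × ℤ × ℤ =>
      (c (-d * x.1 - normForm d x.2.1 x.2.2) : ℂ) * eC (jacobiExp d x τ z w) := by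
  refine ((hc.isFourierCoeff hd le_rfl 0).summable_fiber hd 1 hτ z w).congr fun x => ?_
  have h := maassCoeff_fiber_pos hd 1 hc.neg 0 one_pos x
  rw [Nat.cast_one] at h
  rw [h]
  simp [hDisc, fiberIdx]

/-! ### The Fourier expansion of the Hecke sums -/

lemma sum_eC_div (δ : ℕ) (hδ : 0 < δ) (n : ℤ) :
    ∑ b ∈ Finset.range δ, eC (n * (b / δ : ℂ)) = if (δ : ℤ) ∣ n then (δ : ℂ) else 0 := by
  have hδ' : (δ : ℂ) ≠ 0 := by exact_mod_cast hδ.ne'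
  have hpow : ∀ b : ℕ, eC (n * (b / δ : ℂ)) = eC (n / δ) ^ b := by
    intro b
    rw [eC, eC, ← Complex.exp_nat_mul]; congr 1; ring
  simp only [hpow]
  split_ifs with h
  · obtain ⟨j, rfl⟩ := h
    have : eC (((δ : ℤ) * j : ℤ) / (δ : ℂ)) = 1 := by
      rw [← eC_int j]; congr 1; push_cast; field_simp
    simp only [this, one_pow]
    simp
  · have h1 : eC (n / δ) ≠ 1 := by
      intro h1
      rw [eC, Complex.exp_eq_one_iff] at h1
      obtain ⟨j, hj⟩ := h1
      apply h
      refine ⟨j, ?_⟩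
      have hpi : (2 * Real.pi * I : ℂ) ≠ 0 := by simp [Real.pi_ne_zero]
      have : (n / δ : ℂ) = j := mul_left_cancel₀ hpi (by rw [hj]; ring)
      rw [div_eq_iff hδ'] at this
      have : (n : ℂ) = ((δ * j : ℤ) : ℂ) := by rw [this]; push_cast; ring
      exact_mod_cast this
    rw [geom_sum_eq h1, ← hpow]
    have : eC (n * (δ / δ : ℂ)) = 1 := by rw [div_self hδ', mul_one, eC_int]
    rw [this]; simp

lemma mulIdx_injective {δ : ℕ} (hδ : 0 < δ) :
    Function.Injective fun x : ℤ × ℤ × ℤ => ((δ : ℤ) * x.1, x.2.1, x.2.2) := by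
  rintro ⟨n, a, b⟩ ⟨n', a', b'⟩ h
  have hδ' : (δ : ℤ) ≠ 0 := by exact_mod_cast hδ.ne'
  simp only [Prod.mk.injEq] at h ⊢
  exact ⟨mul_left_cancel₀ hδ' h.1, h.2⟩

lemma IsPolyGrowth.average {d : ℤ} (hd : d = -4 ∨ d = -3) {c : ℤ → ℤ}
    (hc : IsPolyGrowth c) {τ : ℂ} (hτ : 0 < τ.im) (z w : ℂ) {δ : ℕ} (hδ : 0 < δ) :
    ∑ b ∈ Finset.range δ, jacobiFun d c (τ + b / δ) z w = δ * ∑' x : ℤ × ℤ × ℤ,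
      (c (-d * (δ * x.1) - normForm d x.2.1 x.2.2) : ℂ) * eC (jacobiExp d x (δ * τ) z w) := by
  have him : ∀ b : ℕ, 0 < (τ + b / δ : ℂ).im := by
    intro b
    have : ((b : ℂ) / δ).im = 0 := by
      rw [show ((b : ℂ) / δ) = ((b / δ : ℝ) : ℂ) by push_cast; rfl]; exact ofReal_im _
    rw [add_im, this, add_zero]; exact hτ
  simp only [jacobiFun]
  rw [← Summable.tsum_finsetSum (fun b _ => hc.summable_jacobi hd (him b) z w), ← tsum_mul_left]
  have hterm : ∀ x : ℤ × ℤ × ℤ, ∑ b ∈ Finset.range δ,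
      (c (-d * x.1 - normForm d x.2.1 x.2.2) : ℂ) * eC (jacobiExp d x (τ + b / δ) z w) =
      if (δ : ℤ) ∣ x.1 then
        δ * ((c (-d * x.1 - normForm d x.2.1 x.2.2) : ℂ) * eC (jacobiExp d x τ z w)) else 0 := by
    intro x
    have : ∀ b : ℕ, eC (jacobiExp d x (τ + b / δ) z w) =
        eC (jacobiExp d x τ z w) * eC (x.1 * (b / δ : ℂ)) := by
      intro b; rw [← eC_add]; congr 1; simp only [jacobiExp]; ring
    simp only [this, ← mul_assoc]
    rw [← Finset.mul_sum, sum_eC_div δ hδ]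
    split_ifs <;> ring
  rw [tsum_congr hterm, ← (mulIdx_injective hδ).tsum_eq]
  · refine tsum_congr fun x => ?_
    simp only [dvd_mul_right, if_true]
    congr 3
    simp only [jacobiExp]; push_cast; ring
  · intro x hx
    rw [Function.mem_support] at hx
    have : (δ : ℤ) ∣ x.1 := by
      by_contra h; exact hx (if_neg h)
    obtain ⟨n, hn⟩ := this
    exact ⟨(n, x.2.1, x.2.2), by simp [← hn]⟩

lemma heckeSum_eq (k : ℕ) (φ : ℂ → ℂ → ℂ → ℂ) {m : ℕ} (hm : 0 < m) (τ z w : ℂ) :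
    heckeSum k φ m τ z w = ∑ g ∈ m.divisors, ∑ b ∈ Finset.range (m / g),
      (((m / g : ℕ) : ℂ) ^ k)⁻¹ *
        φ (g * τ / (m / g : ℕ) + b / (m / g : ℕ)) (g * z) (g * w) := by
  rw [Finset.sum_sigma', heckeSum]
  symm
  have hdet : ∀ s : (_ : ℕ) × ℕ, s.1 ∈ m.divisors →
      (!![(s.1 : ℤ), (s.2 : ℤ); 0, ((m / s.1 : ℕ) : ℤ)]).det = m := by
    intro s hs
    rw [det_fin_two_of, mul_zero, sub_zero]
    exact_mod_cast Nat.mul_div_cancel' (Nat.dvd_of_mem_divisors hs)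
  refine Finset.sum_bij (fun s hs => ⟨⟨!![(s.1 : ℤ), (s.2 : ℤ); 0, ((m / s.1 : ℕ) : ℤ)],
    hdet s (Finset.mem_sigma.1 hs).1⟩, ?_⟩) ?_ ?_ ?_ ?_
  · obtain ⟨h1, h2⟩ := Finset.mem_sigma.1 hs
    have := Nat.pos_of_mem_divisors h1
    have h2' := Finset.mem_range.1 h2
    refine ⟨by simp, by simpa using this, by simp, ?_⟩
    simp only [of_apply, cons_val_zero, cons_val_one, cons_val', cons_val_fin_one, Nat.abs_cast]
    exact_mod_cast h2'
  · intros; exact Finset.mem_univ _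
  · rintro ⟨g, b⟩ hs ⟨g', b'⟩ hs' h
    have h1 := congrArg (fun R => R.1.1 0 0) h
    have h2 := congrArg (fun R => R.1.1 0 1) h
    simp at h1 h2
    subst h1 h2
    rfl
  · rintro ⟨⟨R, hR⟩, h1, h2, h3, h4⟩ -
    simp only at h1 h2 h3 h4
    have hR' := hR
    rw [det_fin_two, h1, mul_zero, sub_zero] at hR'
    have h5 : 0 < R 1 1 := by
      by_contra! hn
      have : (0 : ℤ) < m := by exact_mod_cast hm
      nlinarith
    rw [abs_of_nonneg h3, abs_of_pos h5] at h4
    obtain ⟨g, hg⟩ := Int.eq_ofNat_of_zero_le h2.le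
    obtain ⟨b, hb⟩ := Int.eq_ofNat_of_zero_le h3
    obtain ⟨δ, hδ⟩ := Int.eq_ofNat_of_zero_le h5.le
    rw [hg, hδ] at hR'
    have hgδ : g * δ = m := by exact_mod_cast hR'
    have hg0 : 0 < g := by rw [hg] at h2; exact_mod_cast h2
    have hmg : m / g = δ := by rw [← hgδ, Nat.mul_div_cancel_left _ hg0]
    refine ⟨⟨g, b⟩, ?_, ?_⟩
    · rw [Finset.mem_sigma, Nat.mem_divisors, Finset.mem_range]
      refine ⟨⟨⟨δ, hgδ.symm⟩, hm.ne'⟩, ?_⟩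
      simp only [hmg]
      rw [hb, hδ] at h4
      exact_mod_cast h4
    · apply Subtype.ext
      apply Subtype.ext
      ext i j
      fin_cases i <;> fin_cases j
      · simp [hg]
      · simp [hb]
      · simp [h1]
      · simp [hδ, hmg]
  · rintro ⟨g, b⟩ hs
    have hg := (Finset.mem_sigma.1 hs).1
    have hd := hdet ⟨g, b⟩ hg
    simp only at hd hg
    have hg0 := Nat.pos_of_mem_divisors hg
    have hδ0 : 0 < m / g := Nat.div_pos (Nat.divisor_le hg) hg0
    have hgδ : ((m : ℤ) : ℂ) = g * (m / g : ℕ) := by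
      rw [Int.cast_natCast, ← Nat.cast_mul, Nat.mul_div_cancel' (Nat.dvd_of_mem_divisors hg)]
    have hδ : ((m / g : ℕ) : ℂ) ≠ 0 := by exact_mod_cast hδ0.ne'
    simp only [jacobiSlash, hd, of_apply, cons_val_zero, cons_val_one, cons_val', cons_val_fin_one,
      hgδ]
    simp only [Int.cast_zero, zero_mul, mul_zero, zero_add, neg_zero, zero_div, eC_zero, mul_one,
      Int.cast_natCast, add_div]
    congr 2 <;> field_simp

/-- The coefficient function of `e(m τ')` in a Fourier series. -/
def fiberSum (d : ℤ) (α : ℤ × ℤ × ℤ × ℤ → ℂ) (m : ℤ) (τ z w : ℂ) : ℂ :=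
  ∑' x, α (fiberIdx m x) * eC (jacobiExp d x τ z w)

lemma scaleIdx_injective {g : ℕ} (hg : 0 < g) :
    Function.Injective fun x : ℤ × ℤ × ℤ => ((g : ℤ) * x.1, (g : ℤ) * x.2.1, (g : ℤ) * x.2.2) := by
  rintro ⟨n, a, b⟩ ⟨n', a', b'⟩ h
  have hg' : (g : ℤ) ≠ 0 := by exact_mod_cast hg.ne'
  simp only [Prod.mk.injEq] at h ⊢
  exact ⟨mul_left_cancel₀ hg' h.1, mul_left_cancel₀ hg' h.2.1, mul_left_cancel₀ hg' h.2.2⟩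

lemma IsPolyGrowth.fiberSum_pos {d : ℤ} (hd : d = -4 ∨ d = -3) {k : ℕ} (hk : 1 ≤ k) {c : ℤ → ℤ}
    (hc : IsPolyGrowth c) (e : ℂ) {m : ℕ} (hm : 0 < m) {τ : ℂ} (hτ : 0 < τ.im) (z w : ℂ) :
    fiberSum d (maassCoeff d k c e) m τ z w =
      m ^ (k - 1) * heckeSum k (jacobiFun d c) m τ z w := by
  have hmain : ∀ g ∈ m.divisors, HasSum (fun x : ℤ × ℤ × ℤ =>
      (if (g : ℤ) ∣ x.1 ∧ (g : ℤ) ∣ x.2.1 ∧ (g : ℤ) ∣ x.2.2 then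
        (g : ℂ) ^ (k - 1) * c (hDisc d (fiberIdx m x) / (g : ℤ) ^ 2) else 0) *
          eC (jacobiExp d x τ z w))
      ((m : ℂ) ^ (k - 1) * ∑ b ∈ Finset.range (m / g), (((m / g : ℕ) : ℂ) ^ k)⁻¹ *
        jacobiFun d c (g * τ / (m / g : ℕ) + b / (m / g : ℕ)) (g * z) (g * w)) := by
    intro g hg
    have hg0 := Nat.pos_of_mem_divisors hg
    have hδ0 : 0 < m / g := Nat.div_pos (Nat.divisor_le hg) hg0
    have hgδ : m = g * (m / g) := (Nat.mul_div_cancel' (Nat.dvd_of_mem_divisors hg)).symm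
    generalize m / g = δ at *
    subst hgδ
    have hδ : (δ : ℂ) ≠ 0 := by exact_mod_cast hδ0.ne'
    have him : 0 < (g * τ / δ : ℂ).im := by
      have : (g * τ / δ : ℂ) = ((g / δ : ℝ) : ℂ) * τ := by push_cast; ring
      rw [this, im_ofReal_mul]; positivity
    have hs := (hc.summable_jacobi hd him (g * z) (g * w)).comp_injective (mulIdx_injective hδ0)
    rw [← Finset.mul_sum, hc.average hd him (g * z) (g * w) hδ0, mul_div_cancel₀ _ hδ]
    have hval : (((g * δ : ℕ) : ℂ) ^ (k - 1)) * ((δ ^ k : ℂ)⁻¹ * (δ * ∑' x : ℤ × ℤ × ℤ,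
        (c (-d * (δ * x.1) - normForm d x.2.1 x.2.2) : ℂ) *
          eC (jacobiExp d x (g * τ) (g * z) (g * w)))) = ∑' x : ℤ × ℤ × ℤ, (g : ℂ) ^ (k - 1) *
        ((c (-d * (δ * x.1) - normForm d x.2.1 x.2.2) : ℂ) *
          eC (jacobiExp d x (g * τ) (g * z) (g * w))) := by
      rw [tsum_mul_left]
      obtain ⟨j, rfl⟩ := Nat.exists_eq_add_of_le hk
      rw [Nat.add_sub_cancel_left]
      push_cast
      field_simp
      ring
    rw [hval]
    have hs' : Summable fun x : ℤ × ℤ × ℤ => (g : ℂ) ^ (k - 1) *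
        ((c (-d * (δ * x.1) - normForm d x.2.1 x.2.2) : ℂ) *
          eC (jacobiExp d x (g * τ) (g * z) (g * w))) := by
      refine (hs.congr fun x => ?_).mul_left _
      simp only [Function.comp_apply, jacobiExp]
      congr 2; push_cast; field_simp
    rw [← (scaleIdx_injective hg0).hasSum_iff]
    · convert hs'.hasSum using 2 with x
      have hdiv : hDisc d (fiberIdx (g * δ : ℕ) (g * x.1, g * x.2.1, g * x.2.2)) / (g : ℤ) ^ 2 =
          -d * (δ * x.1) - normForm d x.2.1 x.2.2 := by
        apply Int.ediv_eq_of_eq_mul_right (by positivity)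
        simp only [hDisc, fiberIdx, normForm]; push_cast; ring
      simp only [Function.comp_apply, dvd_mul_right, and_self, if_true, hdiv]
      rw [mul_assoc]
      congr 3
      simp only [jacobiExp, dualElt, map_div₀, map_add, map_mul, map_intCast]
      push_cast; ring
    · rintro x hx
      by_contra h
      apply hx
      have hdvd : (g : ℤ) ∣ x.1 ∧ (g : ℤ) ∣ x.2.1 ∧ (g : ℤ) ∣ x.2.2 := by
        by_contra h'
        exact h (by rw [if_neg h', zero_mul])
      obtain ⟨⟨n, hn⟩, ⟨a, ha⟩, ⟨b, hb⟩⟩ := hdvd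
      exact ⟨(n, a, b), by simp only [← hn, ← ha, ← hb]⟩
  rw [fiberSum, heckeSum_eq _ _ hm, Finset.mul_sum]
  have := hasSum_sum hmain
  rw [← this.tsum_eq]
  refine tsum_congr fun x => ?_
  rw [maassCoeff_fiber_pos hd k hc.neg e hm, Finset.sum_mul]

/-! ### The additive lift -/

lemma fiberSum_neg {d : ℤ} {α : ℤ × ℤ × ℤ × ℤ → ℂ} (hα : IsFourierCoeff d α) {m : ℤ} (hm : m < 0)
    (τ z w : ℂ) : fiberSum d α m τ z w = 0 := by
  have : ∀ x, α (fiberIdx m x) * eC (jacobiExp d x τ z w) = 0 := by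
    intro x
    by_contra h
    have := (hα.support _ (left_ne_zero_of_mul h)).2.1
    simp only [fiberIdx] at this
    lia
  rw [fiberSum, tsum_congr this, tsum_zero]

lemma maassCoeff_fiber_zero {d : ℤ} (k : ℕ) {c : ℤ → ℤ} (h1 : c 0 = 1) (e : ℂ) {n : ℕ}
    (hn : 0 < n) :
    maassCoeff d k c e (fiberIdx 0 (n, 0, 0)) = ArithmeticFunction.sigma (k - 1) n := by
  have hne : fiberIdx 0 (n, 0, 0) ≠ 0 := by
    intro h
    have : (n : ℤ) = 0 := congrArg (fun v => v.1) h
    lia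
  have hdisc : hDisc d (fiberIdx 0 (n, 0, 0)) = 0 := by simp [hDisc, fiberIdx, normForm]
  have hcone : InCone d (fiberIdx 0 (n, 0, 0)) := ⟨by simp [fiberIdx], by simp [fiberIdx], hdisc.ge⟩
  have hcont : content (fiberIdx 0 (n, 0, 0)) = n := by simp [content, fiberIdx]
  rw [maassCoeff, if_neg hne, if_pos hcone, hcont, hdisc, ArithmeticFunction.sigma_apply]
  simp [h1]

lemma fiberSum_zero {d : ℤ} (hd : d = -4 ∨ d = -3) {k : ℕ} (hk : 1 ≤ k) {c : ℤ → ℤ}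
    (hc : IsPolyGrowth c) (h1 : c 0 = 1) (e : ℂ) {τ : ℂ} (hτ : 0 < τ.im) (z w : ℂ) :
    fiberSum d (maassCoeff d k c e) 0 τ z w =
      e + ∑' n : ℕ+, ArithmeticFunction.sigma (k - 1) n * eC τ ^ (n : ℤ) := by
  have hα := hc.isFourierCoeff hd hk e
  have hinj : Function.Injective fun n : ℕ => ((n : ℤ), (0 : ℤ), (0 : ℤ)) := by
    intro a b h
    simpa using h
  have hs : Summable fun n : ℕ => maassCoeff d k c e (fiberIdx 0 (n, 0, 0)) *
      eC (jacobiExp d (n, 0, 0) τ z w) := (hα.summable_fiber hd 0 hτ z w).comp_injective hinj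
  rw [fiberSum, ← hinj.tsum_eq]
  · rw [Summable.tsum_eq_zero_add hs,
      tsum_pnat_eq_tsum_succ (f := fun n => (ArithmeticFunction.sigma (k - 1) n : ℂ) *
        eC τ ^ (n : ℤ))]
    congr 1
    · have hz : fiberIdx 0 (((0 : ℕ) : ℤ), (0 : ℤ), (0 : ℤ)) = 0 := rfl
      rw [hz, maassCoeff_zero]
      simp [jacobiExp, dualElt, eC_zero]
    · refine tsum_congr fun n => ?_
      rw [maassCoeff_fiber_zero k h1 e n.succ_pos, zpow_natCast, eC, eC, ← Complex.exp_nat_mul]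
      congr 2
      simp only [jacobiExp, dualElt, map_zero, Int.cast_zero, zero_mul, add_zero, zero_div]
      push_cast
      ring
  · intro x hx
    have hcone := hα.support _ (left_ne_zero_of_mul hx)
    have hN : ¬ 0 < normForm d x.2.1 x.2.2 := by
      have := hcone.2.2
      simp only [hDisc, fiberIdx] at this
      lia
    have h0 : x.2.1 = 0 ∧ x.2.2 = 0 := by
      by_contra h
      exact hN (normForm_pos hd h)
    obtain ⟨n, hn⟩ := Int.eq_ofNat_of_zero_le hcone.1
    refine ⟨n, ?_⟩
    have hn' : x.1 = n := hn
    ext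
    · exact hn'.symm
    · exact h0.1.symm
    · exact h0.2.symm

lemma eisenstein_invert {k : ℕ} (hk : 3 ≤ k) (τ : UpperHalfPlane) (τ' : UpperHalfPlane)
    (h : (τ' : ℂ) = -1 / τ) : ModularForm.E hk τ' = (τ : ℂ) ^ k * ModularForm.E hk τ := by
  have h1 : ModularGroup.S • τ = τ' := by
    rw [UpperHalfPlane.modular_S_smul]
    ext
    rw [h]
    simp [neg_div, inv_neg]
  have h2 := SlashInvariantForm.slash_action_eqn'' (ModularForm.E hk)
    (γ := (ModularGroup.S : GL (Fin 2) ℝ)) (MonoidHom.mem_range.2 ⟨ModularGroup.S, rfl⟩) τ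
  have h3 : UpperHalfPlane.denom (ModularGroup.S : GL (Fin 2) ℝ) τ = τ := by
    have h10 : (ModularGroup.S : GL (Fin 2) ℝ) 1 0 = 1 := by
      change ((1 : ℤ) : ℝ) = 1
      simp
    have h11 : (ModularGroup.S : GL (Fin 2) ℝ) 1 1 = 0 := by
      change ((0 : ℤ) : ℝ) = 0
      simp
    rw [UpperHalfPlane.denom, h10, h11]
    simp
  rw [h3, zpow_natCast] at h2
  rw [← h1, ← h2]
  rfl

lemma fiberSum_zero_invert {d : ℤ} (hd : d = -4 ∨ d = -3) {k : ℕ} (hk : 3 ≤ k) (hk2 : Even k)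
    (hB : bernoulli k ≠ 0) {c : ℤ → ℤ} (hc : IsPolyGrowth c) (h1 : c 0 = 1) {τ : ℂ}
    (hτ : 0 < τ.im) (hτ' : 0 < (-1 / τ).im) (z w z' w' : ℂ) :
    fiberSum d (maassCoeff d k c (-bernoulli k / (2 * k))) 0 (-1 / τ) z' w' =
      τ ^ k * fiberSum d (maassCoeff d k c (-bernoulli k / (2 * k))) 0 τ z w := by
  have key : ∀ (σ : UpperHalfPlane) (z w : ℂ),
      fiberSum d (maassCoeff d k c (-bernoulli k / (2 * k))) 0 σ z w =
        (-bernoulli k / (2 * k)) * ModularForm.E hk σ := by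
    intro σ z w
    rw [fiberSum_zero hd (by lia) hc h1 _ σ.2, EisensteinSeries.q_expansion_bernoulli hk hk2]
    have hB' : (bernoulli k : ℂ) ≠ 0 := by exact_mod_cast hB
    have hk' : (k : ℂ) ≠ 0 := by
      have : k ≠ 0 := by lia
      exact_mod_cast this
    simp only [eC]
    field_simp
    ring
  have e1 := key ⟨τ, hτ⟩ z w
  have e2 := key ⟨-1 / τ, hτ'⟩ z' w'
  rw [eisenstein_invert hk ⟨τ, hτ⟩ ⟨-1 / τ, hτ'⟩ rfl] at e2
  refine e2.trans ?_
  refine (Eq.trans ?_ (congrArg (fun t => τ ^ k * t) e1.symm))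
  ring

/-- The decomposition of the index set by the second coordinate. -/
def fiberEquiv : ℤ × (ℤ × ℤ × ℤ) ≃ ℤ × ℤ × ℤ × ℤ where
  toFun y := fiberIdx y.1 y.2
  invFun v := (v.2.1, v.1, v.2.2.1, v.2.2.2)
  left_inv _ := rfl
  right_inv _ := rfl

lemma IsFourierCoeff.fourierFun_eq {d : ℤ} (hd : d = -4 ∨ d = -3) {α : ℤ × ℤ × ℤ × ℤ → ℂ}
    (hα : IsFourierCoeff d α) {Z : Matrix (Fin 2) (Fin 2) ℂ} (hZ : Z ∈ HermitianUpperHalfSpace) :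
    fourierFun d α Z = ∑' m : ℤ, eC (m * Z 1 1) * fiberSum d α m (Z 0 0) (Z 0 1) (Z 1 0) := by
  have hs : Summable fun y => α (fiberEquiv y) * eC (hMat d (fiberEquiv y) * Z).trace :=
    (hα.summable hd hZ).comp_injective fiberEquiv.injective
  rw [fourierFun, ← fiberEquiv.tsum_eq, hs.tsum_prod]
  refine tsum_congr fun m => ?_
  rw [fiberSum, ← tsum_mul_left]
  refine tsum_congr fun x => ?_
  change α (fiberIdx m x) * eC (hMat d (fiberIdx m x) * Z).trace = _
  rw [trace_fiberIdx, eC_add]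
  ring

lemma fourierFun_partialInv {d : ℤ} (hd : d = -4 ∨ d = -3) {k : ℕ} (hk : 3 ≤ k) (hk2 : Even k)
    (hB : bernoulli k ≠ 0) {c : ℤ → ℤ} (hc : IsPolyGrowth c) (h1 : c 0 = 1)
    (hφ : IsJacobiType k (jacobiFun d c)) {Z : Matrix (Fin 2) (Fin 2) ℂ}
    (hZ : Z ∈ HermitianUpperHalfSpace) :
    fourierFun d (maassCoeff d k c (-bernoulli k / (2 * k))) (partialInv Z) =
      Z 0 0 ^ k * fourierFun d (maassCoeff d k c (-bernoulli k / (2 * k))) Z := by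
  have hα := hc.isFourierCoeff hd (show 1 ≤ k by lia) (-bernoulli k / (2 * k))
  have hZ' := upperHalfSpace_partialInv hZ
  have hτ := (mem_upperHalfSpace_iff.1 hZ).1
  have hτ' := (mem_upperHalfSpace_iff.1 hZ').1
  rw [hα.fourierFun_eq hd hZ, hα.fourierFun_eq hd hZ', ← tsum_mul_left]
  refine tsum_congr fun m => ?_
  simp only [partialInv, of_apply, cons_val_zero, cons_val_one, cons_val', cons_val_fin_one] at hτ' ⊢
  rcases lt_trichotomy m 0 with hm | rfl | hm
  · rw [fiberSum_neg hα hm, fiberSum_neg hα hm]; simp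
  · rw [fiberSum_zero_invert hd hk hk2 hB hc h1 hτ hτ' (Z 0 1) (Z 1 0)]
    simp [eC_zero]
  · obtain ⟨n, rfl⟩ := Int.eq_ofNat_of_zero_le hm.le
    have hn : 0 < n := by exact_mod_cast hm
    rw [hc.fiberSum_pos hd (by lia) _ hn hτ, hc.fiberSum_pos hd (by lia) _ hn hτ',
      hφ.heckeSum_invert hm hτ]
    have : eC ((n : ℤ) * (Z 1 1 - Z 0 1 * Z 1 0 / Z 0 0)) *
        eC ((n : ℤ) * (Z 0 1 * Z 1 0) / Z 0 0) = eC ((n : ℤ) * Z 1 1) := by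
      rw [← eC_add]; congr 1; ring
    rw [← this]
    ring

/-- The normalized additive lift. -/
theorem exists_maassLift {d : ℤ} (hd : d = -4 ∨ d = -3) {k : ℕ} (hk : 3 ≤ k) (hk2 : Even k)
    (hB : bernoulli k ≠ 0) {c : ℤ → ℤ} (hc : IsPolyGrowth c) (h1 : c 0 = 1)
    (hφ : IsJacobiType k (jacobiFun d c)) {K : ℤ} (hK : K = k) :
    ∃ F : HermitianModularForm d K, IsSymmetricHMF F ∧ F.coeff 0 = 1 ∧
      ∀ H, H ≠ 0 → ∃ N : ℤ, F.coeff H = (-(2 * k) / bernoulli k : ℂ) * N := by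
  subst hK
  have hB' : (bernoulli k : ℂ) ≠ 0 := by exact_mod_cast hB
  have hk' : (k : ℂ) ≠ 0 := by
    have : k ≠ 0 := by lia
    exact_mod_cast this
  have hα := hc.isFourierCoeff hd (show 1 ≤ k by lia) (-bernoulli k / (2 * k))
  set α := maassCoeff d k c (-bernoulli k / (2 * k)) with hαdef
  refine ⟨⟨fun Z => (-(2 * k) / bernoulli k : ℂ) * fourierFun d α Z,
    fun H => (-(2 * k) / bernoulli k : ℂ) * matCoeff hd α H,
    (hα.differentiableOn hd).const_mul _, ?_, ?_, ?_⟩, ?_, ?_, ?_⟩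
  · refine transform_of_generators hd (k := (k : ℤ)) (by exact_mod_cast hk2)
      (F := fun Z => (-(2 * k) / bernoulli k : ℂ) * fourierFun d α Z) ?_ ?_ ?_
    · intro S hS hO Z _
      rw [fourierFun_translate hd α hS hO]
    · intro U V hU hV h Z _
      rw [fourierFun_conj hd hU hV h (maassCoeff_conj hd k c _ hU hV h)]
    · intro Z hZ
      rw [fourierFun_partialInv hd hk hk2 hB hc h1 hφ hZ, zpow_natCast]
      ring
  · intro H hH
    exact hα.matCoeff_supported hd H (right_ne_zero_of_mul hH)
  · intro Z hZ
    simp only [mul_assoc]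
    refine HasSum.mul_left _ ?_
    simpa only [mul_assoc] using hα.hasSum hd hZ
  · intro Z _
    simp only
    rw [fourierFun_transpose (maassCoeff_transposeIdx hd k c _)]
  · have h0 : hMat d 0 = 0 := by
      have := hMat_smul d 0 0
      simpa using this
    simp only
    rw [← h0, matCoeff_hMat, hαdef, maassCoeff_zero]
    field_simp
  · intro H hH
    by_cases hz : matCoeff hd α H = 0
    · exact ⟨0, by simp [hz]⟩
    · obtain ⟨v, rfl, hv⟩ := matCoeff_ne_zero hd hz
      have hv0 : v ≠ 0 := by
        rintro rfl
        apply hH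
        have := hMat_smul d 0 0
        simpa using this
      obtain ⟨N, hN⟩ := maassCoeff_int d k c (-bernoulli k / (2 * k)) hv0
      exact ⟨N, by simp only [matCoeff_hMat]; rw [hαdef, hN]⟩

/-! ### Power series with coefficients of polynomial growth -/

/-- The ring of integral power series whose coefficients grow at most polynomially. -/
def polyGrowthSubring : Subring (PowerSeries ℤ) where
  carrier := {f | ∃ C A : ℕ, ∀ n, |PowerSeries.coeff n f| ≤ C * (1 + n) ^ A}
  zero_mem' := ⟨0, 0, fun n => by simp⟩
  one_mem' := ⟨1, 0, fun n => by rw [PowerSeries.coeff_one]; split_ifs <;> simp⟩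
  neg_mem' := by
    rintro f ⟨C, A, h⟩
    exact ⟨C, A, fun n => by simpa using h n⟩
  add_mem' := by
    rintro f g ⟨C, A, hf⟩ ⟨C', A', hg⟩
    refine ⟨C + C', A + A', fun n => ?_⟩
    have h1 : (1 : ℤ) ≤ 1 + n := by lia
    rw [map_add]
    calc _ ≤ _ := abs_add_le _ _
      _ ≤ C * (1 + n : ℤ) ^ A + C' * (1 + n : ℤ) ^ A' := add_le_add (hf n) (hg n)
      _ ≤ C * (1 + n : ℤ) ^ (A + A') + C' * (1 + n : ℤ) ^ (A + A') := by
        gcongr <;> lia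
      _ = _ := by push_cast; ring
  mul_mem' := by
    rintro f g ⟨C, A, hf⟩ ⟨C', A', hg⟩
    refine ⟨C * C', A + A' + 1, fun n => ?_⟩
    rw [PowerSeries.coeff_mul]
    calc _ ≤ _ := Finset.abs_sum_le_sum_abs _ _
      _ ≤ ∑ ij ∈ Finset.HasAntidiagonal.antidiagonal n, (C * C' * (1 + n : ℤ) ^ (A + A')) := by
        refine Finset.sum_le_sum fun ij hij => ?_
        have h := Finset.HasAntidiagonal.mem_antidiagonal.1 hij
        rw [abs_mul]
        have h1 : (1 + ij.1 : ℤ) ≤ 1 + n := by lia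
        have h2 : (1 + ij.2 : ℤ) ≤ 1 + n := by lia
        calc _ ≤ (C * (1 + ij.1 : ℤ) ^ A) * (C' * (1 + ij.2 : ℤ) ^ A') :=
              mul_le_mul (hf _) (hg _) (abs_nonneg _) (by positivity)
          _ ≤ (C * (1 + n : ℤ) ^ A) * (C' * (1 + n : ℤ) ^ A') := by gcongr
          _ = _ := by ring
      _ = _ := by
        rw [Finset.sum_const, Finset.Nat.card_antidiagonal, nsmul_eq_mul]
        push_cast; ring

lemma summable_polyGrowth {f : PowerSeries ℤ} (hf : f ∈ polyGrowthSubring) {q : ℂ} (hq : ‖q‖ < 1) :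
    Summable fun n => ‖((PowerSeries.coeff n f : ℤ) : ℂ) * q ^ n‖ := by
  obtain ⟨C, A, h⟩ := hf
  have h1 := (summable_pow_mul_geometric_of_norm_lt_one A (r := ‖q‖) (by simpa using hq))
  have h2 := (summable_geometric_of_norm_lt_one (x := ‖q‖) (by simpa using hq))
  refine Summable.of_nonneg_of_le (fun _ => norm_nonneg _) (fun n => ?_)
    ((h1.add h2).mul_left (C * 2 ^ (A - 1) : ℝ))
  rw [norm_mul, norm_pow, Complex.norm_intCast]
  have h3 : |((PowerSeries.coeff n f : ℤ) : ℝ)| ≤ C * (1 + n : ℝ) ^ A := by exact_mod_cast h n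
  have h4 : (n + 1 : ℝ) ^ A ≤ 2 ^ (A - 1) * (n ^ A + 1 ^ A) :=
    add_pow_le (by positivity) zero_le_one A
  rw [one_pow] at h4
  calc _ ≤ (C * (2 ^ (A - 1) * (n ^ A + 1 : ℝ))) * ‖q‖ ^ n := by
        gcongr
        refine h3.trans ?_
        rw [add_comm (1 : ℝ)]
        gcongr
    _ = _ := by ring

/-- Evaluation of a power series of polynomial growth in the unit disc. -/
def evalDisc {q : ℂ} (hq : ‖q‖ < 1) : polyGrowthSubring →+* ℂ where
  toFun f := ∑' n, ((PowerSeries.coeff n f.1 : ℤ) : ℂ) * q ^ n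
  map_zero' := by simp
  map_one' := by
    rw [tsum_eq_single 0]
    · simp
    · intro n hn
      simp [PowerSeries.coeff_one, hn]
  map_add' f g := by
    rw [← Summable.tsum_add (summable_polyGrowth f.2 hq).of_norm (summable_polyGrowth g.2 hq).of_norm]
    refine tsum_congr fun n => ?_
    simp [add_mul]
  map_mul' f g := by
    rw [tsum_mul_tsum_eq_tsum_sum_antidiagonal_of_summable_norm (summable_polyGrowth f.2 hq)
      (summable_polyGrowth g.2 hq)]
    refine tsum_congr fun n => ?_
    rw [Subring.coe_mul, PowerSeries.coeff_mul, Int.cast_sum, Finset.sum_mul]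
    refine Finset.sum_congr rfl fun ij hij => ?_
    rw [← Finset.HasAntidiagonal.mem_antidiagonal.1 hij, pow_add]
    push_cast; ring

lemma evalDisc_apply {q : ℂ} (hq : ‖q‖ < 1) (f : polyGrowthSubring) :
    evalDisc hq f = ∑' n, ((PowerSeries.coeff n f.1 : ℤ) : ℂ) * q ^ n := rfl

/-- The generating series of the number of solutions of `f i = n`. -/
def countSeries {ι : Type*} (f : ι → ℕ) : PowerSeries ℤ :=
  PowerSeries.mk fun n => (Nat.card {i // f i = n} : ℤ)

lemma finite_fiber {ι : Type*} {f : ι → ℕ} {g : ι → ℤ × ℤ} (hg : Function.Injective g) {B : ℕ}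
    (h : ∀ i, |(g i).1| ≤ B * f i ∧ |(g i).2| ≤ B * f i) (n : ℕ) :
    Finite {i // f i = n} ∧ Nat.card {i // f i = n} ≤ (2 * B * n + 1) ^ 2 := by
  let s : Finset (ℤ × ℤ) := Finset.Icc (-(B * n : ℤ)) (B * n) ×ˢ Finset.Icc (-(B * n : ℤ)) (B * n)
  let G : {i // f i = n} → s := fun i => ⟨g i, by
    have h1 := h i
    rw [i.2] at h1
    simp only [s, Finset.mem_product, Finset.mem_Icc]
    exact ⟨abs_le.1 h1.1, abs_le.1 h1.2⟩⟩
  have hG : Function.Injective G := by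
    intro i j hij
    exact Subtype.ext (hg (congrArg Subtype.val hij))
  refine ⟨Finite.of_injective G hG, (Nat.card_le_card_of_injective G hG).trans ?_⟩
  rw [Nat.card_eq_fintype_card, Fintype.card_coe, Finset.card_product, Int.card_Icc, sq]
  have : (B * n + 1 - -(B * n : ℤ)).toNat = 2 * B * n + 1 := by
    have : (B * n + 1 - -(B * n : ℤ)) = ((2 * B * n + 1 : ℕ) : ℤ) := by push_cast; ring
    rw [this, Int.toNat_natCast]
  rw [this]

lemma countSeries_mem {ι : Type*} {f : ι → ℕ} {g : ι → ℤ × ℤ} (hg : Function.Injective g) {B : ℕ}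
    (h : ∀ i, |(g i).1| ≤ B * f i ∧ |(g i).2| ≤ B * f i) : countSeries f ∈ polyGrowthSubring := by
  refine ⟨(2 * B + 1) ^ 2, 2, fun n => ?_⟩
  rw [countSeries, PowerSeries.coeff_mk, Nat.abs_cast]
  have h1 := (finite_fiber hg h n).2
  have h2 : 2 * B * n + 1 ≤ (2 * B + 1) * (1 + n) := by nlinarith
  have h3 := h1.trans (Nat.pow_le_pow_left h2 2)
  rw [mul_pow] at h3
  exact_mod_cast h3

lemma hasSum_countSeries {ι : Type*} {f : ι → ℕ} {g : ι → ℤ × ℤ} (hg : Function.Injective g)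
    {B : ℕ} (h : ∀ i, |(g i).1| ≤ B * f i ∧ |(g i).2| ≤ B * f i) {q : ℂ} (hq : ‖q‖ < 1) :
    HasSum (fun i => q ^ f i) (evalDisc hq ⟨countSeries f, countSeries_mem hg h⟩) := by
  have hfin := fun n => (finite_fiber hg h n).1
  have hcoeff : ∀ n, PowerSeries.coeff n (countSeries f) = Nat.card {i // f i = n} := fun n => by
    rw [countSeries, PowerSeries.coeff_mk]
  have hs := summable_polyGrowth (countSeries_mem hg h) hq
  rw [← (Equiv.sigmaFiberEquiv f).hasSum_iff]
  have hterm : ∀ x : (n : ℕ) × {i // f i = n},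
      ((fun i => q ^ f i) ∘ (Equiv.sigmaFiberEquiv f)) x = q ^ x.1 := by
    rintro ⟨n, i, rfl⟩; rfl
  rw [funext hterm]
  have hsum : Summable fun x : (n : ℕ) × {i // f i = n} => q ^ x.1 := by
    apply Summable.of_norm
    rw [summable_sigma_of_nonneg fun _ => norm_nonneg _]
    refine ⟨fun n => ?_, ?_⟩
    · have := hfin n
      exact (summable_of_hasFiniteSupport (Set.toFinite _))
    · refine hs.congr fun n => ?_
      simp only [tsum_const, hcoeff, norm_mul, nsmul_eq_mul]
      simp
  rw [evalDisc_apply]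
  convert hsum.hasSum using 1
  rw [hsum.tsum_sigma]
  refine tsum_congr fun n => ?_
  simp only [tsum_const, hcoeff, nsmul_eq_mul]
  simp

/-! ### Coefficients supported in a residue class -/

/-- The exponents of a power series lie in a residue class. -/
def SuppMod (D : ℕ) (r : ZMod D) (f : PowerSeries ℤ) : Prop :=
  ∀ n, PowerSeries.coeff n f ≠ 0 → (n : ZMod D) = r

lemma SuppMod.add {D : ℕ} {r : ZMod D} {f g : PowerSeries ℤ} (hf : SuppMod D r f)
    (hg : SuppMod D r g) : SuppMod D r (f + g) := by
  intro n hn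
  by_cases h : PowerSeries.coeff n f = 0
  · exact hg n (by simpa [h] using hn)
  · exact hf n h

lemma SuppMod.neg {D : ℕ} {r : ZMod D} {f : PowerSeries ℤ} (hf : SuppMod D r f) :
    SuppMod D r (-f) := fun n hn => hf n (by simpa using hn)

lemma SuppMod.sub {D : ℕ} {r : ZMod D} {f g : PowerSeries ℤ} (hf : SuppMod D r f)
    (hg : SuppMod D r g) : SuppMod D r (f - g) := by
  rw [sub_eq_add_neg]; exact hf.add hg.neg

lemma SuppMod.mul {D : ℕ} {r s : ZMod D} {f g : PowerSeries ℤ} (hf : SuppMod D r f)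
    (hg : SuppMod D s g) : SuppMod D (r + s) (f * g) := by
  intro n hn
  rw [PowerSeries.coeff_mul] at hn
  obtain ⟨ij, hij, h⟩ := Finset.exists_ne_zero_of_sum_ne_zero hn
  rw [← Finset.HasAntidiagonal.mem_antidiagonal.1 hij, Nat.cast_add, hf _ (left_ne_zero_of_mul h),
    hg _ (right_ne_zero_of_mul h)]

lemma SuppMod.intCast (D : ℕ) (a : ℤ) : SuppMod D 0 (a : PowerSeries ℤ) := by
  intro n hn
  by_cases h : n = 0
  · simp [h]
  · refine absurd ?_ hn
    rw [← map_intCast (PowerSeries.C (R := ℤ)), PowerSeries.coeff_C, if_neg h]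

lemma SuppMod.pow {D : ℕ} {r : ZMod D} {f : PowerSeries ℤ} (hf : SuppMod D r f) (n : ℕ) :
    SuppMod D (n * r) (f ^ n) := by
  induction n with
  | zero => simpa using SuppMod.intCast D 1
  | succ n ih =>
    rw [pow_succ]
    convert ih.mul hf using 1
    push_cast; ring

lemma SuppMod.countSeries {D : ℕ} {r : ZMod D} {ι : Type*} {f : ι → ℕ}
    (h : ∀ i, (f i : ZMod D) = r) : SuppMod D r (countSeries f) := by
  intro n hn
  rw [_root_.countSeries, PowerSeries.coeff_mk] at hn
  have : Nat.card {i // f i = n} ≠ 0 := by exact_mod_cast hn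
  obtain ⟨⟨i, hi⟩⟩ := (Nat.card_ne_zero.1 this).1
  rw [← hi, h]

/-- The coefficients of a power series as a function on the integers. -/
def coeffZ (f : PowerSeries ℤ) (l : ℤ) : ℤ := if 0 ≤ l then PowerSeries.coeff l.toNat f else 0

lemma isPolyGrowth_coeffZ {f : PowerSeries ℤ} (hf : f ∈ polyGrowthSubring) :
    IsPolyGrowth (coeffZ f) := by
  refine ⟨fun l hl => if_neg (by lia), ?_⟩
  obtain ⟨C, A, h⟩ := hf
  refine ⟨C, A, fun l hl => ?_⟩
  obtain ⟨n, rfl⟩ := Int.eq_ofNat_of_zero_le hl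
  rw [coeffZ, if_pos hl, Int.toNat_natCast]
  exact_mod_cast h n

/-! ### Theta decomposition of Jacobi functions -/

lemma eC_nsmul (x : ℂ) (n : ℕ) : eC (n * x) = eC x ^ n := by
  rw [eC, eC, ← Complex.exp_nat_mul]; congr 1; ring

lemma norm_eC_div_lt_one {τ : ℂ} (hτ : 0 < τ.im) {D : ℕ} (hD : 0 < D) : ‖eC (τ / D)‖ < 1 := by
  rw [norm_eC, Complex.div_natCast_im, Real.exp_lt_one_iff]
  have : 0 < τ.im / D := by positivity
  have := Real.pi_pos
  have : 0 < 2 * Real.pi * (τ.im / D) := by positivity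
  linarith

lemma coeffZ_natCast (f : PowerSeries ℤ) (n : ℕ) : coeffZ f n = PowerSeries.coeff n f := by
  rw [coeffZ, if_pos (by lia), Int.toNat_natCast]

lemma SuppMod.coeffZ_ne_zero {D : ℕ} {r : ZMod D} {f : PowerSeries ℤ} (hf : SuppMod D r f) {l : ℤ}
    (h : coeffZ f l ≠ 0) : (l : ZMod D) = r := by
  by_cases hl : 0 ≤ l
  · obtain ⟨n, rfl⟩ := Int.eq_ofNat_of_zero_le hl
    rw [coeffZ_natCast] at h
    exact_mod_cast hf n h
  · exact absurd (if_neg hl) h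

lemma coeffZ_add (f g : PowerSeries ℤ) (l : ℤ) : coeffZ (f + g) l = coeffZ f l + coeffZ g l := by
  by_cases hl : 0 ≤ l <;> simp [coeffZ, hl]

lemma tsum_coeffZ_class {τ : ℂ} {D : ℕ} (hD : 0 < D) (hq : ‖eC (τ / D)‖ < 1)
    (f : polyGrowthSubring) {r : ZMod D} (hf : SuppMod D r f.1) {N : ℤ} (hN : ((-N : ℤ) : ZMod D) = r) :
    ∑' n : ℤ, (coeffZ f.1 (D * n - N) : ℂ) * eC ((D * n - N : ℤ) * (τ / D)) = evalDisc hq f := by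
  have hinj : Function.Injective fun n : ℤ => (D : ℤ) * n - N := by
    intro a b h
    have h' : (D : ℤ) * a = D * b := by simpa using h
    exact mul_left_cancel₀ (by exact_mod_cast hD.ne') h'
  have h1 := hinj.tsum_eq (f := fun l : ℤ => (coeffZ f.1 l : ℂ) * eC (l * (τ / D))) (by
    intro l hl
    have h : coeffZ f.1 l ≠ 0 := by
      intro h0; apply hl; simp [h0]
    have h2 : ((l + N : ℤ) : ZMod D) = 0 := by
      rw [Int.cast_add, hf.coeffZ_ne_zero h, ← hN]; push_cast; ring
    obtain ⟨n, hn⟩ := (ZMod.intCast_zmod_eq_zero_iff_dvd _ _).1 h2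
    exact ⟨n, by dsimp only; lia⟩)
  have h2 := (Nat.cast_injective (R := ℤ)).tsum_eq
    (f := fun l : ℤ => (coeffZ f.1 l : ℂ) * eC (l * (τ / D))) (by
    intro l hl
    have h : 0 ≤ l := by
      by_contra h0; apply hl; simp [coeffZ, h0]
    exact ⟨l.toNat, by simp [h]⟩)
  rw [h1, ← h2, evalDisc_apply]
  refine tsum_congr fun n => ?_
  rw [coeffZ_natCast, Int.cast_natCast, eC_nsmul]

/-- A term of the theta series attached to the inverse different. -/
def thetaTerm (d : ℤ) (x : ℤ × ℤ) (τ z w : ℂ) : ℂ :=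
  eC (normForm d x.1 x.2 * (τ / -d) + dualElt d x.1 x.2 * w + (starRingEnd ℂ) (dualElt d x.1 x.2) * z)

lemma jacobiFun_eq_tsum {d : ℤ} (hd : d = -4 ∨ d = -3) {D : ℕ} (hD : (D : ℤ) = -d)
    {f : PowerSeries ℤ} (hf : f ∈ polyGrowthSubring) (part : ZMod D → polyGrowthSubring)
    (hpart : ∀ r, SuppMod D r (part r).1) (hfp : ∀ l : ℤ, coeffZ f l = coeffZ (part l).1 l)
    {τ : ℂ} (hτ : 0 < τ.im) (hq : ‖eC (τ / D)‖ < 1) (z w : ℂ) :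
    jacobiFun d (coeffZ f) τ z w =
      ∑' x : ℤ × ℤ, evalDisc hq (part ((-normForm d x.1 x.2 : ℤ) : ZMod D)) * thetaTerm d x τ z w := by
  have hD0 : 0 < D := by rcases hd with rfl | rfl <;> lia
  have hDC : (D : ℂ) = -d := by exact_mod_cast congrArg (Int.cast (R := ℂ)) hD
  have hD1 : (D : ℂ) ≠ 0 := by exact_mod_cast hD0.ne'
  have hs := (isPolyGrowth_coeffZ hf).summable_jacobi hd hτ z w
  rw [jacobiFun, ← (Equiv.prodComm (ℤ × ℤ) ℤ).tsum_eq]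
  have hs' : Summable fun y : (ℤ × ℤ) × ℤ =>
      (coeffZ f (-d * y.2 - normForm d y.1.1 y.1.2) : ℂ) * eC (jacobiExp d (y.2, y.1) τ z w) :=
    hs.prod_symm
  refine hs'.tsum_prod.trans (tsum_congr fun x => ?_)
  rw [← tsum_coeffZ_class hD0 hq (part _) (hpart _) rfl, ← tsum_mul_right]
  refine tsum_congr fun n => ?_
  dsimp only
  have hcast : (((D : ℤ) * n - normForm d x.1 x.2 : ℤ) : ZMod D) = (-normForm d x.1 x.2 : ℤ) := by
    push_cast; simp
  rw [mul_assoc, thetaTerm, ← eC_add, hfp, ← hD, hcast]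
  congr 2
  rw [jacobiExp, ← hDC]
  push_cast
  field_simp
  ring

lemma jacobiFun_translate (d : ℤ) (c : ℤ → ℤ) (τ z w : ℂ) :
    jacobiFun d c (τ + 1) z w = jacobiFun d c τ z w := by
  refine tsum_congr fun x => ?_
  rw [← eC_add_int (jacobiExp d x τ z w) x.1]
  congr 2
  rw [jacobiExp, jacobiExp]; ring

lemma hasSum_of_equiv_prod {J κ ι : Type*} [Fintype J] {f : ι → ℂ} (e : J × κ ≃ ι) {a : J → ℂ}
    (h : ∀ j, HasSum (fun k => f (e (j, k))) (a j)) : HasSum f (∑ j, a j) := by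
  classical
  rw [← e.hasSum_iff]
  have h1 : ∀ j ∈ (Finset.univ : Finset J),
      HasSum (fun x : J × κ => if x.1 = j then f (e x) else 0) (a j) := by
    intro j _
    rw [← (Prod.mk_right_injective j).hasSum_iff (by
      rintro ⟨i, k⟩ hx
      refine if_neg fun hij => hx ⟨k, ?_⟩
      rw [← hij])]
    convert h j using 2 with k
    simp
  convert hasSum_sum h1 using 2 with x
  simp

/-! ### Theta functions of characteristic zero and one half -/

/-- The theta series over the integers congruent to `ε` modulo two. -/
def thetaHalf (ε : ℤ) (τ ζ : ℂ) : ℂ :=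
  ∑' n : ℤ, eC ((2 * n + ε : ℤ) ^ 2 * (τ / 4) + (2 * n + ε : ℤ) * ζ)

lemma eC_theta_eq (m : ℤ) (τ ζ : ℂ) :
    eC (m ^ 2 * (τ / 4) + m * ζ) = jacobiTheta₂_term m ζ (τ / 2) := by
  rw [eC, jacobiTheta₂_term]; congr 1; ring

lemma summable_theta {τ : ℂ} (hτ : 0 < τ.im) (ζ : ℂ) :
    Summable fun m : ℤ => eC (m ^ 2 * (τ / 4) + m * ζ) := by
  simp_rw [eC_theta_eq]
  rw [summable_jacobiTheta₂_term_iff]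
  simpa using hτ

lemma two_mul_add_injective (ε : ℤ) : Function.Injective fun n : ℤ => 2 * n + ε :=
  fun a b h => by have : 2 * a + ε = 2 * b + ε := h; lia

lemma summable_thetaHalf {τ : ℂ} (hτ : 0 < τ.im) (ε : ℤ) (ζ : ℂ) :
    Summable fun n : ℤ => eC ((2 * n + ε : ℤ) ^ 2 * (τ / 4) + (2 * n + ε : ℤ) * ζ) :=
  (summable_theta hτ ζ).comp_injective (two_mul_add_injective ε)

lemma hasSum_thetaHalf_mul {τ τ' : ℂ} (hτ : 0 < τ.im) (hτ' : 0 < τ'.im) (ε ε' : ℤ) (ζ ζ' : ℂ) :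
    HasSum (fun x : ℤ × ℤ =>
      eC ((2 * x.1 + ε : ℤ) ^ 2 * (τ / 4) + (2 * x.1 + ε : ℤ) * ζ) *
        eC ((2 * x.2 + ε' : ℤ) ^ 2 * (τ' / 4) + (2 * x.2 + ε' : ℤ) * ζ'))
      (thetaHalf ε τ ζ * thetaHalf ε' τ' ζ') := by
  have h1 := (summable_thetaHalf hτ ε ζ).norm
  have h2 := (summable_thetaHalf hτ' ε' ζ').norm
  rw [thetaHalf, thetaHalf, tsum_mul_tsum_of_summable_norm h1 h2]
  exact (summable_mul_of_summable_norm h1 h2).hasSum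

/-- Integers as pairs of a parity and a quotient. -/
def parityEquiv : Fin 2 × ℤ ≃ ℤ where
  toFun x := 2 * x.2 + x.1.val
  invFun m := (if m % 2 = 0 then 0 else 1, m / 2)
  left_inv := by
    rintro ⟨i, n⟩
    fin_cases i
    · simp
    · have h1 : (2 * n + 1) % 2 = 1 := by lia
      have h2 : (2 * n + 1) / 2 = n := by lia
      simp [h1, h2]
  right_inv m := by
    rcases Int.emod_two_eq_zero_or_one m with h | h
    · simp [h]; lia
    · simp [h]; lia

lemma thetaHalf_zero_eq (τ ζ : ℂ) : thetaHalf 0 τ ζ = jacobiTheta₂ (2 * ζ) (2 * τ) := by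
  refine tsum_congr fun n => ?_
  rw [eC, jacobiTheta₂_term]; congr 1; push_cast; ring

lemma thetaHalf_add {τ : ℂ} (hτ : 0 < τ.im) (ζ : ℂ) :
    thetaHalf 0 τ ζ + thetaHalf 1 τ ζ = jacobiTheta₂ ζ (τ / 2) := by
  have h := hasSum_of_equiv_prod parityEquiv (f := fun m : ℤ => eC (m ^ 2 * (τ / 4) + m * ζ))
    (a := fun j => thetaHalf j.val τ ζ) (fun j => (summable_thetaHalf hτ j.val ζ).hasSum)
  rw [jacobiTheta₂]
  simp_rw [← eC_theta_eq]
  rw [h.tsum_eq, Fin.sum_univ_two]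
  simp

/-- The automorphy factor of the theta functions. -/
def thetaFactor (τ : ℂ) : ℂ := (-I * (τ / 2)) ^ (1 / 2 : ℂ)

lemma thetaFactor_sq (τ : ℂ) : thetaFactor τ ^ 2 = -I * (τ / 2) := by
  simp [thetaFactor]

lemma sq_mul_cpow_half {r : ℝ} (hr : 0 < r) {x : ℂ} (hx : x ≠ 0) :
    ((r : ℂ) ^ 2 * x) ^ (1 / 2 : ℂ) = r * x ^ (1 / 2 : ℂ) := by
  have hr' : (r : ℂ) ≠ 0 := by exact_mod_cast hr.ne'
  have h2 : Complex.log ((r : ℂ) ^ 2 * x) = 2 * Complex.log r + Complex.log x := by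
    rw [← Complex.ofReal_pow, Complex.log_ofReal_mul (by positivity) hx, Real.log_pow,
      ← Complex.ofReal_log hr.le]
    push_cast; ring
  rw [Complex.cpow_def_of_ne_zero (mul_ne_zero (pow_ne_zero 2 hr') hx),
    Complex.cpow_def_of_ne_zero hx, h2]
  rw [show (2 * Complex.log r + Complex.log x) * (1 / 2) = Complex.log r + Complex.log x * (1 / 2) by
    ring, Complex.exp_add, Complex.exp_log hr']

lemma thetaFactor_sq_mul {r : ℝ} (hr : 0 < r) {τ : ℂ} (hτ : τ ≠ 0) :
    thetaFactor ((r : ℂ) ^ 2 * τ) = r * thetaFactor τ := by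
  rw [thetaFactor, thetaFactor, ← sq_mul_cpow_half hr (by simpa using hτ)]
  congr 1; ring

lemma thetaFactor_ne_zero {τ : ℂ} (hτ : τ ≠ 0) : thetaFactor τ ≠ 0 := by
  rw [← pow_ne_zero_iff two_ne_zero, thetaFactor_sq]
  simpa using hτ

lemma im_neg_inv_pos {τ : ℂ} (hτ : 0 < τ.im) : 0 < (-1 / τ).im := by
  have : τ ≠ 0 := by rintro rfl; simp at hτ
  rw [neg_div, one_div, Complex.neg_im, Complex.inv_im, neg_div, neg_neg]
  exact div_pos hτ (Complex.normSq_pos.2 this)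

lemma thetaHalf_zero_invert {τ : ℂ} (hτ : 0 < τ.im) (ζ : ℂ) :
    thetaHalf 0 (-1 / τ) (ζ / τ) =
      thetaFactor τ * eC (ζ ^ 2 / τ) * (thetaHalf 0 τ ζ + thetaHalf 1 τ ζ) := by
  have h0 : τ ≠ 0 := by rintro rfl; simp at hτ
  have hs := thetaFactor_ne_zero h0
  rw [thetaHalf_add hτ, thetaHalf_zero_eq, jacobiTheta₂_functional_equation ζ (τ / 2), ← thetaFactor]
  rw [show 2 * (ζ / τ) = ζ / (τ / 2) by field_simp, show 2 * (-1 / τ) = -1 / (τ / 2) by field_simp]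
  have he : eC (ζ ^ 2 / τ) * cexp (-Real.pi * I * ζ ^ 2 / (τ / 2)) = 1 := by
    rw [eC, ← Complex.exp_add, ← Complex.exp_zero]
    congr 1; field_simp; ring
  linear_combination (norm := skip) (-jacobiTheta₂ (ζ / (τ / 2)) (-1 / (τ / 2))) * he
  field_simp
  ring

lemma thetaHalf_one_invert {τ : ℂ} (hτ : 0 < τ.im) (ζ : ℂ) :
    thetaHalf 1 (-1 / τ) (ζ / τ) =
      thetaFactor τ * eC (ζ ^ 2 / τ) * (thetaHalf 0 τ ζ - thetaHalf 1 τ ζ) := by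
  have h0 : τ ≠ 0 := by rintro rfl; simp at hτ
  have hs := thetaFactor_ne_zero h0
  have hf : (-I * (2 * τ)) ^ (1 / 2 : ℂ) = 2 * thetaFactor τ := by
    have := thetaFactor_sq_mul (r := 2) two_pos h0
    rw [Complex.ofReal_ofNat] at this
    rw [← this, thetaFactor]; congr 1; ring
  have he : eC (ζ ^ 2 / τ) * cexp (-Real.pi * I * (2 * ζ) ^ 2 / (2 * τ)) = 1 := by
    rw [eC, ← Complex.exp_add, ← Complex.exp_zero]
    congr 1; field_simp; ring
  have h := thetaHalf_add (im_neg_inv_pos hτ) (ζ / τ)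
  rw [thetaHalf_zero_invert hτ] at h
  have h2 := thetaHalf_zero_eq τ ζ
  rw [jacobiTheta₂_functional_equation, hf, show 2 * ζ / (2 * τ) = ζ / τ by field_simp,
    show -1 / (2 * τ) = -1 / τ / 2 by field_simp, ← h] at h2
  have h3 : 2 * thetaFactor τ * eC (ζ ^ 2 / τ) * thetaHalf 0 τ ζ =
      thetaFactor τ * eC (ζ ^ 2 / τ) * (thetaHalf 0 τ ζ + thetaHalf 1 τ ζ) +
        thetaHalf 1 (-1 / τ) (ζ / τ) := by
    generalize thetaFactor τ * eC (ζ ^ 2 / τ) * (thetaHalf 0 τ ζ + thetaHalf 1 τ ζ) +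
        thetaHalf 1 (-1 / τ) (ζ / τ) = S at h2 ⊢
    have h4 : 2 * thetaFactor τ * thetaHalf 0 τ ζ =
        cexp (-Real.pi * I * (2 * ζ) ^ 2 / (2 * τ)) * S := by
      rw [h2]; field_simp
    linear_combination eC (ζ ^ 2 / τ) * h4 + S * he
  linear_combination -h3

/-! ### Jacobi functions for the Gaussian integers -/

lemma sqrtD_neg_four : sqrtD (-4) = 2 * I := by
  have : Real.sqrt (-((-4 : ℤ) : ℝ)) = 2 := by
    rw [show (-((-4 : ℤ) : ℝ)) = 2 ^ 2 by norm_num, Real.sqrt_sq two_pos.le]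
  rw [sqrtD, this]; simp

/-- Coordinates of Gaussian integers according to the parity of both coordinates. -/
def gaussEquiv : (Fin 2 × Fin 2) × (ℤ × ℤ) ≃ ℤ × ℤ :=
  ((Equiv.prodProdProdComm (Fin 2) (Fin 2) ℤ ℤ).trans (parityEquiv.prodCongr parityEquiv)).trans
    { toFun := fun y => (y.1 + 2 * y.2, y.2)
      invFun := fun y => (y.1 - 2 * y.2, y.2)
      left_inv := fun y => by ext <;> simp
      right_inv := fun y => by ext <;> simp }

lemma gaussEquiv_apply (i j : Fin 2) (x : ℤ × ℤ) :
    gaussEquiv ((i, j), x) = (2 * x.1 + i.val + 2 * (2 * x.2 + j.val), 2 * x.2 + j.val) := rfl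

lemma normForm_gaussEquiv (i j : Fin 2) (x : ℤ × ℤ) :
    normForm (-4) (gaussEquiv ((i, j), x)).1 (gaussEquiv ((i, j), x)).2 =
      (2 * x.1 + i.val) ^ 2 + (2 * x.2 + j.val) ^ 2 := by
  rw [gaussEquiv_apply, normForm]
  norm_num
  ring

lemma thetaTerm_gaussEquiv (i j : Fin 2) (x : ℤ × ℤ) (τ z w : ℂ) :
    thetaTerm (-4) (gaussEquiv ((i, j), x)) τ z w =
      eC ((2 * x.1 + i.val : ℤ) ^ 2 * (τ / 4) + (2 * x.1 + i.val : ℤ) * (-I * (w - z) / 2)) *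
        eC ((2 * x.2 + j.val : ℤ) ^ 2 * (τ / 4) + (2 * x.2 + j.val : ℤ) * ((w + z) / 2)) := by
  rw [thetaTerm, conj_dualElt, normForm_gaussEquiv, gaussEquiv_apply, ← eC_add]
  congr 1
  simp only [dualElt, omegaD, sqrtD_neg_four]
  push_cast
  generalize (i.val : ℂ) = a
  generalize (j.val : ℂ) = b
  have hI : (I : ℂ) ≠ 0 := I_ne_zero
  field_simp
  linear_combination (norm := ring_nf) (8 * (2 * x.1 + a) * (w - z)) * I_sq

/-- Theta components of a Jacobi function of weight `k` over the Gaussian integers. -/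
structure GaussTriple (k : ℕ) (f₀ f₂ f₃ : polyGrowthSubring) : Prop where
  supp₀ : SuppMod 4 0 f₀.1
  supp₂ : SuppMod 4 2 f₂.1
  supp₃ : SuppMod 4 3 f₃.1
  const : PowerSeries.constantCoeff f₀.1 = 1
  invert : ∀ (τ : ℂ) (_ : 0 < τ.im) (hq : ‖eC (τ / (4 : ℕ))‖ < 1)
    (hq' : ‖eC (-1 / τ / (4 : ℕ))‖ < 1),
    -I * (τ / 2) * (evalDisc hq' f₀ + 2 * evalDisc hq' f₃ + evalDisc hq' f₂) =
        τ ^ k * evalDisc hq f₀ ∧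
      -I * (τ / 2) * (evalDisc hq' f₀ - evalDisc hq' f₂) = τ ^ k * evalDisc hq f₃ ∧
      -I * (τ / 2) * (evalDisc hq' f₀ - 2 * evalDisc hq' f₃ + evalDisc hq' f₂) =
        τ ^ k * evalDisc hq f₂

lemma SuppMod.coeffZ_eq_zero {D : ℕ} {r : ZMod D} {f : PowerSeries ℤ} (hf : SuppMod D r f) {l : ℤ}
    (h : (l : ZMod D) ≠ r) : coeffZ f l = 0 := by
  by_contra h0; exact h (hf.coeffZ_ne_zero h0)

lemma SuppMod.zero {D : ℕ} (r : ZMod D) : SuppMod D r 0 := fun _ hn => absurd (map_zero _) hn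

namespace GaussTriple

variable {k : ℕ} {f₀ f₂ f₃ : polyGrowthSubring}

/-- The component of a triple of series supported in a residue class. -/
def part (f₀ f₂ f₃ : polyGrowthSubring) : ZMod 4 → polyGrowthSubring := ![f₀, 0, f₂, f₃]

lemma jacobiFun_eq (h : GaussTriple k f₀ f₂ f₃) {τ : ℂ} (hτ : 0 < τ.im)
    (hq : ‖eC (τ / (4 : ℕ))‖ < 1) (z w : ℂ) :
    jacobiFun (-4) (coeffZ (f₀ + f₂ + f₃).1) τ z w =
      evalDisc hq f₀ * (thetaHalf 0 τ (-I * (w - z) / 2) * thetaHalf 0 τ ((w + z) / 2)) +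
      evalDisc hq f₃ * (thetaHalf 0 τ (-I * (w - z) / 2) * thetaHalf 1 τ ((w + z) / 2)) +
      evalDisc hq f₃ * (thetaHalf 1 τ (-I * (w - z) / 2) * thetaHalf 0 τ ((w + z) / 2)) +
      evalDisc hq f₂ * (thetaHalf 1 τ (-I * (w - z) / 2) * thetaHalf 1 τ ((w + z) / 2)) := by
  have hz : (0 : polyGrowthSubring).1 = 0 := rfl
  rw [jacobiFun_eq_tsum (Or.inl rfl) rfl (f₀ + f₂ + f₃).2 (part f₀ f₂ f₃) ?_ ?_ hτ hq]
  · have hsum := hasSum_of_equiv_prod gaussEquiv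
      (f := fun x : ℤ × ℤ => evalDisc hq (part f₀ f₂ f₃ ((-normForm (-4) x.1 x.2 : ℤ) : ZMod 4)) *
        thetaTerm (-4) x τ z w)
      (a := fun j => evalDisc hq (part f₀ f₂ f₃ (-(j.1.val ^ 2 + j.2.val ^ 2 : ℕ))) *
        (thetaHalf j.1.val τ (-I * (w - z) / 2) * thetaHalf j.2.val τ ((w + z) / 2))) (by
      rintro ⟨i, j⟩
      refine ((hasSum_thetaHalf_mul hτ hτ i.val j.val _ _).mul_left _).congr_fun fun x => ?_
      rw [thetaTerm_gaussEquiv, normForm_gaussEquiv]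
      congr 4
      have h4 : (4 : ZMod 4) = 0 := rfl
      push_cast
      linear_combination (-(x.1 : ZMod 4) ^ 2 - x.1 * i.val - x.2 ^ 2 - x.2 * j.val) * h4)
    rw [hsum.tsum_eq, Fintype.sum_prod_type, Fin.sum_univ_two, Fin.sum_univ_two, Fin.sum_univ_two,
      ← add_assoc]
    rfl
  · intro r
    fin_cases r
    · exact h.supp₀
    · exact SuppMod.zero _
    · exact h.supp₂
    · exact h.supp₃
  · intro l
    have h0 := fun hl => h.supp₀.coeffZ_eq_zero (l := l) hl
    have h2 := fun hl => h.supp₂.coeffZ_eq_zero (l := l) hl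
    have h3 := fun hl => h.supp₃.coeffZ_eq_zero (l := l) hl
    rw [Subring.coe_add, Subring.coe_add, coeffZ_add, coeffZ_add]
    generalize (l : ZMod 4) = r at *
    have hr : r = 0 ∨ r = 1 ∨ r = 2 ∨ r = 3 := by exact (by decide : ∀ r : ZMod 4, r = 0 ∨ r = 1 ∨ r = 2 ∨ r = 3) r
    rcases hr with rfl | rfl | rfl | rfl
    · rw [h2 (by decide), h3 (by decide), add_zero, add_zero]; rfl
    · rw [h0 (by decide), h2 (by decide), h3 (by decide)]
      show _ = coeffZ 0 l
      simp [coeffZ]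
    · rw [h0 (by decide), h3 (by decide), add_zero, zero_add]; rfl
    · rw [h0 (by decide), h2 (by decide), zero_add, zero_add]; rfl

lemma isJacobiType (h : GaussTriple k f₀ f₂ f₃) :
    IsJacobiType k (jacobiFun (-4) (coeffZ (f₀ + f₂ + f₃).1)) := by
  refine ⟨jacobiFun_translate _ _, fun τ z w hτ => ?_⟩
  have h0 : τ ≠ 0 := by rintro rfl; simp at hτ
  have hτ' := im_neg_inv_pos hτ
  have hq := norm_eC_div_lt_one hτ (D := 4) (by norm_num)
  have hq' := norm_eC_div_lt_one hτ' (D := 4) (by norm_num)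
  rw [h.jacobiFun_eq hτ hq, h.jacobiFun_eq hτ' hq']
  obtain ⟨h1, h2, h3⟩ := h.invert τ hτ hq hq'
  rw [show -I * (w / τ - z / τ) / 2 = (-I * (w - z) / 2) / τ by ring,
    show (w / τ + z / τ) / 2 = ((w + z) / 2) / τ by ring, thetaHalf_zero_invert hτ,
    thetaHalf_zero_invert hτ, thetaHalf_one_invert hτ, thetaHalf_one_invert hτ]
  have he : eC (z * w / τ) = eC ((-I * (w - z) / 2) ^ 2 / τ) * eC (((w + z) / 2) ^ 2 / τ) := by
    rw [← eC_add]
    congr 1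
    field_simp
    linear_combination (-(w - z) ^ 2) * I_sq
  have hs := thetaFactor_sq τ
  rw [he]
  set e₁ := eC ((-I * (w - z) / 2) ^ 2 / τ)
  set e₂ := eC (((w + z) / 2) ^ 2 / τ)
  set a := thetaHalf 0 τ (-I * (w - z) / 2)
  set b := thetaHalf 1 τ (-I * (w - z) / 2)
  set a' := thetaHalf 0 τ ((w + z) / 2)
  set b' := thetaHalf 1 τ ((w + z) / 2)
  rw [← hs] at h1 h2 h3
  linear_combination e₁ * e₂ * (a * a' * h1 + (a * b' + b * a') * h2 + b * b' * h3)

lemma coeffZ_zero (h : GaussTriple k f₀ f₂ f₃) : coeffZ (f₀ + f₂ + f₃).1 0 = 1 := by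
  rw [Subring.coe_add, Subring.coe_add, coeffZ_add, coeffZ_add,
    h.supp₂.coeffZ_eq_zero (by decide), h.supp₃.coeffZ_eq_zero (by decide)]
  simpa [coeffZ] using h.const

end GaussTriple

lemma coeff_countSeries {ι : Type*} (f : ι → ℕ) (n : ℕ) :
    PowerSeries.coeff n (countSeries f) = Nat.card {i // f i = n} := by
  rw [countSeries, PowerSeries.coeff_mk]

lemma natCast_natAbs_sq {R : Type*} [Ring R] (m : ℤ) : ((m.natAbs ^ 2 : ℕ) : R) = (m : R) ^ 2 := by
  have h : ((m.natAbs ^ 2 : ℕ) : ℤ) = m ^ 2 := by simp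
  rw [← Int.cast_natCast, h, Int.cast_pow]

lemma abs_le_natAbs_sq (i : Fin 2) (n : ℤ) :
    |n| ≤ ((1 : ℕ) : ℤ) * (((2 * n + i.val).natAbs ^ 2 : ℕ) : ℤ) := by
  rw [Nat.cast_pow, Int.natCast_natAbs, sq_abs, Nat.cast_one, one_mul, abs_le]
  have hi : (i.val : ℤ) = 0 ∨ (i.val : ℤ) = 1 := by have := i.isLt; lia
  rcases hi with h | h <;> rw [h] <;> constructor <;>
    nlinarith [Int.le_self_sq n, Int.le_self_sq (-n), sq_nonneg (n + 1)]

lemma halfSeries_bound (i : Fin 2) (n : ℤ) :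
    |((n, 0) : ℤ × ℤ).1| ≤ ((1 : ℕ) : ℤ) * (((2 * n + i.val).natAbs ^ 2 : ℕ) : ℤ) ∧
      |((n, 0) : ℤ × ℤ).2| ≤ ((1 : ℕ) : ℤ) * (((2 * n + i.val).natAbs ^ 2 : ℕ) : ℤ) :=
  ⟨abs_le_natAbs_sq i n, by
    rw [abs_zero]; positivity⟩

/-- The generating series of the squares of the integers congruent to `i` modulo two. -/
def halfSeries (i : Fin 2) : polyGrowthSubring :=
  ⟨countSeries fun n : ℤ => (2 * n + i.val).natAbs ^ 2,
    countSeries_mem (Prod.mk_left_injective (0 : ℤ)) (halfSeries_bound i)⟩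

lemma evalDisc_halfSeries (i : Fin 2) {τ : ℂ} (hq : ‖eC (τ / (4 : ℕ))‖ < 1) :
    evalDisc hq (halfSeries i) = thetaHalf i.val τ 0 := by
  rw [halfSeries, ← (hasSum_countSeries (Prod.mk_left_injective (0 : ℤ)) (halfSeries_bound i) hq).tsum_eq,
    thetaHalf]
  refine tsum_congr fun n => ?_
  rw [← eC_nsmul, mul_zero, add_zero]
  rw [natCast_natAbs_sq, Nat.cast_ofNat]

lemma suppMod_halfSeries (i : Fin 2) : SuppMod 4 i.val (halfSeries i).1 := by
  refine SuppMod.countSeries fun n => ?_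
  have h4 : (4 : ZMod 4) = 0 := rfl
  have hi : (i.val : ZMod 4) ^ 2 = i.val := by fin_cases i <;> rfl
  rw [natCast_natAbs_sq]
  push_cast
  linear_combination ((n : ZMod 4) ^ 2 + n * i.val) * h4 + hi

lemma constantCoeff_halfSeries_zero : PowerSeries.constantCoeff (halfSeries 0).1 = 1 := by
  rw [← PowerSeries.coeff_zero_eq_constantCoeff_apply]
  refine (coeff_countSeries _ _).trans ?_
  have : Nat.card {n : ℤ // (2 * n + (0 : Fin 2).val).natAbs ^ 2 = 0} = 1 := by
    rw [Nat.card_eq_one_iff_unique]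
    refine ⟨⟨fun a b => Subtype.ext ?_⟩, ⟨0, by simp⟩⟩
    have ha := a.2
    have hb := b.2
    simp at ha hb
    rw [ha, hb]
  rw [this]; rfl

lemma constantCoeff_halfSeries_one : PowerSeries.constantCoeff (halfSeries 1).1 = 0 := by
  rw [← PowerSeries.coeff_zero_eq_constantCoeff_apply]
  by_contra h
  have := suppMod_halfSeries 1 0 h
  revert this; decide

lemma evalDisc_halfSeries_invert {τ : ℂ} (hτ : 0 < τ.im) (hq : ‖eC (τ / (4 : ℕ))‖ < 1)
    (hq' : ‖eC (-1 / τ / (4 : ℕ))‖ < 1) :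
    evalDisc hq' (halfSeries 0) =
        thetaFactor τ * (evalDisc hq (halfSeries 0) + evalDisc hq (halfSeries 1)) ∧
      evalDisc hq' (halfSeries 1) =
        thetaFactor τ * (evalDisc hq (halfSeries 0) - evalDisc hq (halfSeries 1)) := by
  have h0 := thetaHalf_zero_invert hτ 0
  have h1 := thetaHalf_one_invert hτ 0
  simp only [zero_div, ne_eq, OfNat.ofNat_ne_zero, not_false_eq_true, zero_pow, eC_zero, mul_one]
    at h0 h1
  simp only [evalDisc_halfSeries]
  exact ⟨h0, h1⟩

namespace GaussTriple

lemma mul {k : ℕ} {f₀ f₂ f₃ : polyGrowthSubring} (h : GaussTriple k f₀ f₂ f₃)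
    {g : polyGrowthSubring} {m : ℕ} (hg : SuppMod 4 0 g.1)
    (hg1 : PowerSeries.constantCoeff g.1 = 1)
    (hinv : ∀ (τ : ℂ) (_ : 0 < τ.im) (hq : ‖eC (τ / (4 : ℕ))‖ < 1)
      (hq' : ‖eC (-1 / τ / (4 : ℕ))‖ < 1), evalDisc hq' g = τ ^ m * evalDisc hq g) :
    GaussTriple (k + m) (f₀ * g) (f₂ * g) (f₃ * g) where
  supp₀ := by simpa using h.supp₀.mul hg
  supp₂ := by simpa using h.supp₂.mul hg
  supp₃ := by simpa using h.supp₃.mul hg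
  const := by rw [Subring.coe_mul, map_mul, h.const, hg1, one_mul]
  invert τ hτ hq hq' := by
    obtain ⟨h1, h2, h3⟩ := h.invert τ hτ hq hq'
    simp only [map_mul, hinv τ hτ hq hq']
    refine ⟨?_, ?_, ?_⟩
    · linear_combination (τ ^ m * evalDisc hq g) * h1
    · linear_combination (τ ^ m * evalDisc hq g) * h2
    · linear_combination (τ ^ m * evalDisc hq g) * h3

lemma four : GaussTriple 4 (halfSeries 0 ^ 6 + 3 * halfSeries 0 ^ 2 * halfSeries 1 ^ 4)
    (halfSeries 1 ^ 6 + 3 * halfSeries 0 ^ 4 * halfSeries 1 ^ 2)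
    (4 * halfSeries 0 ^ 3 * halfSeries 1 ^ 3) where
  supp₀ := ((suppMod_halfSeries 0).pow 6).add
    (((SuppMod.intCast 4 3).mul ((suppMod_halfSeries 0).pow 2)).mul ((suppMod_halfSeries 1).pow 4))
  supp₂ := ((suppMod_halfSeries 1).pow 6).add
    (((SuppMod.intCast 4 3).mul ((suppMod_halfSeries 0).pow 4)).mul ((suppMod_halfSeries 1).pow 2))
  supp₃ := ((SuppMod.intCast 4 4).mul ((suppMod_halfSeries 0).pow 3)).mul
    ((suppMod_halfSeries 1).pow 3)
  const := by
    simp [constantCoeff_halfSeries_zero, constantCoeff_halfSeries_one]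
  invert τ hτ hq hq' := by
    obtain ⟨h0, h1⟩ := evalDisc_halfSeries_invert hτ hq hq'
    simp only [map_add, map_mul, map_pow, map_ofNat, h0, h1]
    have hs := thetaFactor_sq τ
    rw [← hs]
    have hs8 : thetaFactor τ ^ 8 = τ ^ 4 / 16 := by
      rw [show thetaFactor τ ^ 8 = (thetaFactor τ ^ 2) ^ 4 by ring, hs, mul_pow, neg_pow, I_pow_four]
      ring
    generalize evalDisc hq (halfSeries 0) = x
    generalize evalDisc hq (halfSeries 1) = y
    refine ⟨?_, ?_, ?_⟩
    · linear_combination (16 * (x ^ 6 + 3 * x ^ 2 * y ^ 4)) * hs8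
    · linear_combination (16 * (4 * x ^ 3 * y ^ 3)) * hs8
    · linear_combination (16 * (y ^ 6 + 3 * x ^ 4 * y ^ 2)) * hs8

lemma six : GaussTriple 6
    (halfSeries 0 ^ 10 - 14 * halfSeries 0 ^ 6 * halfSeries 1 ^ 4 -
      3 * halfSeries 0 ^ 2 * halfSeries 1 ^ 8)
    (halfSeries 1 ^ 10 - 14 * halfSeries 0 ^ 4 * halfSeries 1 ^ 6 -
      3 * halfSeries 0 ^ 8 * halfSeries 1 ^ 2)
    (-(8 * halfSeries 0 ^ 7 * halfSeries 1 ^ 3 + 8 * halfSeries 0 ^ 3 * halfSeries 1 ^ 7)) where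
  supp₀ := (((suppMod_halfSeries 0).pow 10).sub
    (((SuppMod.intCast 4 14).mul ((suppMod_halfSeries 0).pow 6)).mul
      ((suppMod_halfSeries 1).pow 4))).sub
    (((SuppMod.intCast 4 3).mul ((suppMod_halfSeries 0).pow 2)).mul ((suppMod_halfSeries 1).pow 8))
  supp₂ := (((suppMod_halfSeries 1).pow 10).sub
    (((SuppMod.intCast 4 14).mul ((suppMod_halfSeries 0).pow 4)).mul
      ((suppMod_halfSeries 1).pow 6))).sub
    (((SuppMod.intCast 4 3).mul ((suppMod_halfSeries 0).pow 8)).mul ((suppMod_halfSeries 1).pow 2))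
  supp₃ := ((((SuppMod.intCast 4 8).mul ((suppMod_halfSeries 0).pow 7)).mul
    ((suppMod_halfSeries 1).pow 3)).add
    (((SuppMod.intCast 4 8).mul ((suppMod_halfSeries 0).pow 3)).mul
      ((suppMod_halfSeries 1).pow 7))).neg
  const := by
    simp [constantCoeff_halfSeries_zero, constantCoeff_halfSeries_one]
  invert τ hτ hq hq' := by
    obtain ⟨h0, h1⟩ := evalDisc_halfSeries_invert hτ hq hq'
    simp only [map_add, map_sub, map_neg, map_mul, map_pow, map_ofNat, h0, h1]
    have hs := thetaFactor_sq τ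
    rw [← hs]
    have hs12 : thetaFactor τ ^ 12 = -(τ ^ 6 / 64) := by
      rw [show thetaFactor τ ^ 12 = (thetaFactor τ ^ 2) ^ 6 by ring, hs, mul_pow, neg_pow,
        show I ^ 6 = I ^ 4 * I ^ 2 by ring, I_pow_four, I_sq]
      ring
    generalize evalDisc hq (halfSeries 0) = x
    generalize evalDisc hq (halfSeries 1) = y
    refine ⟨?_, ?_, ?_⟩
    · linear_combination (-64 * (x ^ 10 - 14 * x ^ 6 * y ^ 4 - 3 * x ^ 2 * y ^ 8)) * hs12
    · linear_combination (64 * (8 * x ^ 7 * y ^ 3 + 8 * x ^ 3 * y ^ 7)) * hs12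
    · linear_combination (-64 * (y ^ 10 - 14 * x ^ 4 * y ^ 6 - 3 * x ^ 8 * y ^ 2)) * hs12

lemma add_four {k : ℕ} {f₀ f₂ f₃ : polyGrowthSubring} (h : GaussTriple k f₀ f₂ f₃) :
    ∃ g₀ g₂ g₃, GaussTriple (k + 4) g₀ g₂ g₃ := by
  refine ⟨_, _, _, h.mul (m := 4) (g := halfSeries 0 ^ 8 + 14 * halfSeries 0 ^ 4 * halfSeries 1 ^ 4 +
    halfSeries 1 ^ 8) ?_ ?_ ?_⟩
  · exact (((suppMod_halfSeries 0).pow 8).add (((SuppMod.intCast 4 14).mul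
      ((suppMod_halfSeries 0).pow 4)).mul ((suppMod_halfSeries 1).pow 4))).add
      ((suppMod_halfSeries 1).pow 8)
  · simp [constantCoeff_halfSeries_zero, constantCoeff_halfSeries_one]
  · intro τ hτ hq hq'
    obtain ⟨h0, h1⟩ := evalDisc_halfSeries_invert hτ hq hq'
    simp only [map_add, map_mul, map_pow, map_ofNat, h0, h1]
    have hs := thetaFactor_sq τ
    have hs8 : thetaFactor τ ^ 8 = τ ^ 4 / 16 := by
      rw [show thetaFactor τ ^ 8 = (thetaFactor τ ^ 2) ^ 4 by ring, hs, mul_pow, neg_pow, I_pow_four]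
      ring
    generalize evalDisc hq (halfSeries 0) = x
    generalize evalDisc hq (halfSeries 1) = y
    linear_combination (16 * (x ^ 8 + 14 * x ^ 4 * y ^ 4 + y ^ 8)) * hs8

end GaussTriple

lemma exists_gaussTriple (n : ℕ) : ∃ f₀ f₂ f₃, GaussTriple (2 * n + 4) f₀ f₂ f₃ := by
  induction n using Nat.twoStepInduction with
  | zero => exact ⟨_, _, _, GaussTriple.four⟩
  | one => exact ⟨_, _, _, GaussTriple.six⟩
  | more n h _ =>
    obtain ⟨f₀, f₂, f₃, h⟩ := h
    exact h.add_four

/-! ### Jacobi functions for the Eisenstein integers -/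

/-- Pairs of integers sheared according to the parity of the second coordinate. -/
def shearEquiv (g : Fin 2 → ℤ → ℤ) : Fin 2 × (ℤ × ℤ) ≃ ℤ × ℤ where
  toFun x := (g x.1 x.2.1 - x.2.2, parityEquiv (x.1, x.2.1))
  invFun y := ((parityEquiv.symm y.2).1, (parityEquiv.symm y.2).2,
    g (parityEquiv.symm y.2).1 (parityEquiv.symm y.2).2 - y.1)
  left_inv x := by simp
  right_inv y := by simp

lemma shearEquiv_apply (g : Fin 2 → ℤ → ℤ) (i : Fin 2) (x : ℤ × ℤ) :
    shearEquiv g (i, x) = (g i x.1 - x.2, 2 * x.1 + i.val) := rfl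

lemma sqrtD_neg_three_sq : sqrtD (-3) ^ 2 = -3 := by
  rw [sqrtD_sq (Or.inr rfl)]; norm_num

lemma sqrtD_neg_three_ne_zero : sqrtD (-3) ≠ 0 := by
  rw [← pow_ne_zero_iff two_ne_zero, sqrtD_neg_three_sq]; norm_num

lemma thetaTerm_neg_three (a b : ℤ) (τ z w : ℂ) :
    thetaTerm (-3) (a, b) τ z w = eC (b ^ 2 * (τ / 4) + b * ((w + z) / 2)) *
      eC ((3 * b - 2 * a) ^ 2 * (τ / 3 / 4) + (3 * b - 2 * a) * (sqrtD (-3) * (w - z) / 2 / 3)) := by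
  rw [thetaTerm, conj_dualElt, ← eC_add]
  congr 1
  have hN : normForm (-3) a b = a ^ 2 - 3 * a * b + 3 * b ^ 2 := by rw [normForm]; norm_num; ring
  simp only [dualElt, omegaD, hN]
  push_cast
  have h0 := sqrtD_neg_three_ne_zero
  have h2 := sqrtD_neg_three_sq
  generalize sqrtD (-3) = s at *
  field_simp
  linear_combination (norm := ring_nf) (8 * a - 12 * b) * (w - z) * h2

/-- The theta series of the ideal generated by the square root of `-3`. -/
def eisTheta (τ z w : ℂ) : ℂ :=
  thetaHalf 0 τ ((w + z) / 2) * thetaHalf 0 (3 * τ) (sqrtD (-3) * (w - z) / 2) +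
    thetaHalf 1 τ ((w + z) / 2) * thetaHalf 1 (3 * τ) (sqrtD (-3) * (w - z) / 2)

/-- The theta series of the inverse different of the Eisenstein integers. -/
def eisThetaDual (τ z w : ℂ) : ℂ :=
  thetaHalf 0 τ ((w + z) / 2) * thetaHalf 0 (τ / 3) (sqrtD (-3) * (w - z) / 2 / 3) +
    thetaHalf 1 τ ((w + z) / 2) * thetaHalf 1 (τ / 3) (sqrtD (-3) * (w - z) / 2 / 3)

lemma hasSum_eisTheta {τ : ℂ} (hτ : 0 < τ.im) (z w : ℂ) :
    HasSum (fun x : ℤ × ℤ => thetaTerm (-3) (3 * x.1, x.2) τ z w) (eisTheta τ z w) := by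
  have hτ' : 0 < (3 * τ).im := by simpa using hτ
  have := hasSum_of_equiv_prod (shearEquiv fun _ n => n)
    (f := fun x : ℤ × ℤ => thetaTerm (-3) (3 * x.1, x.2) τ z w)
    (a := fun i => thetaHalf i.val τ ((w + z) / 2) *
      thetaHalf i.val (3 * τ) (sqrtD (-3) * (w - z) / 2)) (fun i => by
      refine (hasSum_thetaHalf_mul hτ hτ' i.val i.val _ _).congr_fun fun x => ?_
      rw [shearEquiv_apply, thetaTerm_neg_three]
      congr 2
      push_cast
      ring)
  rwa [Fin.sum_univ_two] at this

lemma hasSum_eisThetaDual {τ : ℂ} (hτ : 0 < τ.im) (z w : ℂ) :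
    HasSum (fun x : ℤ × ℤ => thetaTerm (-3) x τ z w) (eisThetaDual τ z w) := by
  have hτ' : 0 < (τ / 3).im := by simpa using hτ
  have := hasSum_of_equiv_prod (shearEquiv fun i n => 3 * n + i.val)
    (f := fun x : ℤ × ℤ => thetaTerm (-3) x τ z w)
    (a := fun i => thetaHalf i.val τ ((w + z) / 2) *
      thetaHalf i.val (τ / 3) (sqrtD (-3) * (w - z) / 2 / 3)) (fun i => by
      refine (hasSum_thetaHalf_mul hτ hτ' i.val i.val _ _).congr_fun fun x => ?_
      rw [shearEquiv_apply, thetaTerm_neg_three]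
      congr 2
      push_cast
      ring)
  rwa [Fin.sum_univ_two] at this

/-- The automorphy factor of the theta series of the Eisenstein integers. -/
def eisFactor (τ : ℂ) : ℂ := -I * τ / (Real.sqrt 3 : ℝ)

lemma sqrt_three_sq : ((Real.sqrt 3 : ℝ) : ℂ) ^ 2 = 3 := by
  rw [← Complex.ofReal_pow, Real.sq_sqrt (by norm_num)]; norm_num

lemma sqrt_three_ne_zero : ((Real.sqrt 3 : ℝ) : ℂ) ≠ 0 := by
  rw [← pow_ne_zero_iff two_ne_zero, sqrt_three_sq]; norm_num

lemma eisFactor_sq (τ : ℂ) : eisFactor τ ^ 2 = -(τ ^ 2 / 3) := by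
  rw [eisFactor, div_pow, sqrt_three_sq, mul_pow, neg_sq, I_sq]; ring

lemma two_mul_thetaFactor_mul_div_three {τ : ℂ} (h0 : τ ≠ 0) :
    2 * (thetaFactor τ * thetaFactor (τ / 3)) = eisFactor τ := by
  have h := thetaFactor_sq_mul (r := (Real.sqrt 3)⁻¹) (by positivity) h0
  rw [Complex.ofReal_inv, inv_pow, sqrt_three_sq] at h
  rw [show τ / 3 = 3⁻¹ * τ by ring, h, eisFactor]
  linear_combination 2 * ((Real.sqrt 3 : ℝ) : ℂ)⁻¹ * thetaFactor_sq τ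

lemma two_mul_thetaFactor_mul_three {τ : ℂ} (h0 : τ ≠ 0) :
    2 * (thetaFactor τ * thetaFactor (3 * τ)) = 3 * eisFactor τ := by
  have h := thetaFactor_sq_mul (r := Real.sqrt 3) (by positivity) h0
  rw [sqrt_three_sq] at h
  rw [h, eisFactor]
  have h3 := sqrt_three_ne_zero
  have h4 := sqrt_three_sq
  have h5 := thetaFactor_sq τ
  field_simp
  linear_combination 2 * ((Real.sqrt 3 : ℝ) : ℂ) ^ 2 * h5 - I * τ * h4

lemma eC_eis (τ z w : ℂ) : eC (z * w / τ) =
    eC (((w + z) / 2) ^ 2 / τ) * eC ((sqrtD (-3) * (w - z) / 2) ^ 2 / (3 * τ)) := by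
  rw [← eC_add]
  congr 1
  rw [div_pow (sqrtD (-3) * (w - z)), mul_pow, sqrtD_neg_three_sq]
  by_cases h0 : τ = 0
  · simp [h0]
  · field_simp; ring

lemma eisTheta_invert {τ : ℂ} (hτ : 0 < τ.im) (z w : ℂ) :
    eisTheta (-1 / τ) (z / τ) (w / τ) =
      eisFactor τ * eC (z * w / τ) * eisThetaDual τ z w := by
  have h0 : τ ≠ 0 := by rintro rfl; simp at hτ
  have hτ' : 0 < (τ / 3).im := by simpa using hτ
  rw [eisTheta, eisThetaDual, eC_eis, ← two_mul_thetaFactor_mul_div_three h0,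
    show (w / τ + z / τ) / 2 = ((w + z) / 2) / τ by ring,
    show sqrtD (-3) * (w / τ - z / τ) / 2 = (sqrtD (-3) * (w - z) / 2 / 3) / (τ / 3) by
      field_simp,
    show 3 * (-1 / τ) = -1 / (τ / 3) by field_simp, thetaHalf_zero_invert hτ,
    thetaHalf_one_invert hτ, thetaHalf_zero_invert hτ', thetaHalf_one_invert hτ',
    show (sqrtD (-3) * (w - z) / 2 / 3) ^ 2 / (τ / 3) =
      (sqrtD (-3) * (w - z) / 2) ^ 2 / (3 * τ) by field_simp]
  ring

lemma eisThetaDual_invert {τ : ℂ} (hτ : 0 < τ.im) (z w : ℂ) :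
    eisThetaDual (-1 / τ) (z / τ) (w / τ) =
      3 * eisFactor τ * eC (z * w / τ) * eisTheta τ z w := by
  have h0 : τ ≠ 0 := by rintro rfl; simp at hτ
  have hτ' : 0 < (3 * τ).im := by simpa using hτ
  rw [eisTheta, eisThetaDual, eC_eis, ← two_mul_thetaFactor_mul_three h0,
    show (w / τ + z / τ) / 2 = ((w + z) / 2) / τ by ring,
    show sqrtD (-3) * (w / τ - z / τ) / 2 / 3 = (sqrtD (-3) * (w - z) / 2) / (3 * τ) by
      field_simp,
    show -1 / τ / 3 = -1 / (3 * τ) by field_simp, thetaHalf_zero_invert hτ,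
    thetaHalf_one_invert hτ, thetaHalf_zero_invert hτ', thetaHalf_one_invert hτ']
  ring

/-- Theta components of a Jacobi function of weight `k` over the Eisenstein integers. -/
structure EisPair (k : ℕ) (f₀ f₂ : polyGrowthSubring) : Prop where
  supp₀ : SuppMod 3 0 f₀.1
  supp₂ : SuppMod 3 2 f₂.1
  const : PowerSeries.constantCoeff f₀.1 = 1
  invert : ∀ (τ : ℂ) (_ : 0 < τ.im) (hq : ‖eC (τ / (3 : ℕ))‖ < 1)
    (hq' : ‖eC (-1 / τ / (3 : ℕ))‖ < 1),
    eisFactor τ * (evalDisc hq' f₀ + 2 * evalDisc hq' f₂) = τ ^ k * evalDisc hq f₀ ∧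
      eisFactor τ * (evalDisc hq' f₀ - evalDisc hq' f₂) = τ ^ k * evalDisc hq f₂

namespace EisPair

variable {k : ℕ} {f₀ f₂ : polyGrowthSubring}

/-- The component of a pair of series supported in a residue class. -/
def part (f₀ f₂ : polyGrowthSubring) : ZMod 3 → polyGrowthSubring := ![f₀, 0, f₂]

lemma part_neg_normForm (f₀ f₂ : polyGrowthSubring) (a b : ℤ) :
    part f₀ f₂ ((-normForm (-3) a b : ℤ) : ZMod 3) = if 3 ∣ a then f₀ else f₂ := by
  have hN : ((-normForm (-3) a b : ℤ) : ZMod 3) = -(a : ZMod 3) ^ 2 := by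
    have h3 : (3 : ZMod 3) = 0 := rfl
    rw [normForm]
    norm_num
    linear_combination (a * b - b ^ 2 : ZMod 3) * h3
  have hdvd : (3 ∣ a) ↔ (a : ZMod 3) = 0 := (ZMod.intCast_zmod_eq_zero_iff_dvd a 3).symm
  rw [hN]
  simp only [hdvd]
  have hr := (by decide : ∀ r : ZMod 3, r = 0 ∨ r = 1 ∨ r = 2) a
  rcases hr with h | h | h <;> rw [h] <;> rfl

lemma jacobiFun_eq (h : EisPair k f₀ f₂) {τ : ℂ} (hτ : 0 < τ.im)
    (hq : ‖eC (τ / (3 : ℕ))‖ < 1) (z w : ℂ) :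
    jacobiFun (-3) (coeffZ (f₀ + f₂).1) τ z w =
      evalDisc hq f₂ * eisThetaDual τ z w +
        (evalDisc hq f₀ - evalDisc hq f₂) * eisTheta τ z w := by
  rw [jacobiFun_eq_tsum (Or.inr rfl) rfl (f₀ + f₂).2 (part f₀ f₂) ?_ ?_ hτ hq]
  · have hinj : Function.Injective fun x : ℤ × ℤ => ((3 * x.1, x.2) : ℤ × ℤ) := by
      rintro ⟨a, b⟩ ⟨a', b'⟩ hx
      simpa using hx
    have h1 : HasSum (fun x : ℤ × ℤ => if 3 ∣ x.1 then thetaTerm (-3) x τ z w else 0)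
        (eisTheta τ z w) := by
      rw [← hinj.hasSum_iff (by
        rintro ⟨a, b⟩ hx
        refine if_neg fun hd => hx ?_
        obtain ⟨a', rfl⟩ := hd
        exact ⟨(a', b), rfl⟩)]
      refine (hasSum_eisTheta hτ z w).congr_fun fun x => ?_
      simp
    have h2 := ((hasSum_eisThetaDual hτ z w).mul_left (evalDisc hq f₂)).add
      (h1.mul_left (evalDisc hq f₀ - evalDisc hq f₂))
    rw [← h2.tsum_eq]
    refine tsum_congr fun x => ?_
    rw [part_neg_normForm]
    split_ifs <;> ring
  · intro r
    fin_cases r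
    · exact h.supp₀
    · exact SuppMod.zero _
    · exact h.supp₂
  · intro l
    have h0 := fun hl => h.supp₀.coeffZ_eq_zero (l := l) hl
    have h2 := fun hl => h.supp₂.coeffZ_eq_zero (l := l) hl
    rw [Subring.coe_add, coeffZ_add]
    generalize (l : ZMod 3) = r at *
    have hr := (by decide : ∀ r : ZMod 3, r = 0 ∨ r = 1 ∨ r = 2) r
    rcases hr with rfl | rfl | rfl
    · rw [h2 (by decide), add_zero]; rfl
    · rw [h0 (by decide), h2 (by decide)]
      show _ = coeffZ 0 l
      simp [coeffZ]
    · rw [h0 (by decide), zero_add]; rfl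

lemma isJacobiType (h : EisPair k f₀ f₂) :
    IsJacobiType k (jacobiFun (-3) (coeffZ (f₀ + f₂).1)) := by
  refine ⟨jacobiFun_translate _ _, fun τ z w hτ => ?_⟩
  have hτ' := im_neg_inv_pos hτ
  have hq := norm_eC_div_lt_one hτ (D := 3) (by norm_num)
  have hq' := norm_eC_div_lt_one hτ' (D := 3) (by norm_num)
  rw [h.jacobiFun_eq hτ hq, h.jacobiFun_eq hτ' hq', eisTheta_invert hτ, eisThetaDual_invert hτ]
  obtain ⟨h1, h2⟩ := h.invert τ hτ hq hq'
  linear_combination eC (z * w / τ) * (eisThetaDual τ z w * h2 + eisTheta τ z w * (h1 - h2))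

lemma coeffZ_zero (h : EisPair k f₀ f₂) : coeffZ (f₀ + f₂).1 0 = 1 := by
  rw [Subring.coe_add, coeffZ_add, h.supp₂.coeffZ_eq_zero (by decide)]
  simpa [coeffZ] using h.const

end EisPair

lemma normForm_neg_three (a b : ℤ) : normForm (-3) a b = a ^ 2 - 3 * a * b + 3 * b ^ 2 := by
  rw [normForm]; norm_num; ring

lemma eisSeries_bound (j : Fin 3) (x : ℤ × ℤ) :
    |x.1| ≤ ((4 : ℕ) : ℤ) * ((normForm (-3) (3 * x.1 + j.val) x.2).toNat : ℤ) ∧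
      |x.2| ≤ ((4 : ℕ) : ℤ) * ((normForm (-3) (3 * x.1 + j.val) x.2).toNat : ℤ) := by
  obtain ⟨a, b⟩ := x
  rw [Int.toNat_of_nonneg (normForm_nonneg (Or.inr rfl) _ _), normForm_neg_three]
  dsimp only
  have hj : (j.val : ℤ) = 0 ∨ (j.val : ℤ) = 1 ∨ (j.val : ℤ) = 2 := by have := j.isLt; lia
  have h1 : |a| ≤ |3 * a + j.val| := by
    rcases hj with h | h | h <;> rw [h] <;> cases abs_cases a <;> cases abs_cases (3 * a + (j.val : ℤ)) <;> grind
  have hsq : ∀ y : ℤ, |y| ≤ y ^ 2 := fun y => by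
    rw [← sq_abs]; exact Int.le_self_sq _
  generalize 3 * a + (j.val : ℤ) = y at h1
  have h2 := hsq y
  have h3 := hsq b
  push_cast
  constructor
  · nlinarith [sq_nonneg (y - 2 * b)]
  · nlinarith [sq_nonneg (2 * y - 3 * b), sq_nonneg b]

/-- The generating series of the norm form on the pairs with first coordinate congruent to `j`
modulo three. -/
def eisSeries (j : Fin 3) : polyGrowthSubring :=
  ⟨countSeries fun x : ℤ × ℤ => (normForm (-3) (3 * x.1 + j.val) x.2).toNat,
    countSeries_mem (g := id) Function.injective_id (eisSeries_bound j)⟩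

lemma hasSum_eisSeries (j : Fin 3) {τ : ℂ} (hq : ‖eC (τ / (3 : ℕ))‖ < 1) :
    HasSum (fun x : ℤ × ℤ => thetaTerm (-3) (3 * x.1 + j.val, x.2) τ 0 0)
      (evalDisc hq (eisSeries j)) := by
  refine (hasSum_countSeries (g := id) Function.injective_id (eisSeries_bound j) hq).congr_fun
    fun x => ?_
  have h : (((normForm (-3) (3 * x.1 + j.val) x.2).toNat : ℕ) : ℂ) =
      normForm (-3) (3 * x.1 + j.val) x.2 := by
    exact_mod_cast congrArg (Int.cast (R := ℂ))
      (Int.toNat_of_nonneg (normForm_nonneg (Or.inr rfl) (3 * x.1 + j.val) x.2))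
  rw [← eC_nsmul, h, thetaTerm]
  simp

lemma evalDisc_eisSeries_zero {τ : ℂ} (hτ : 0 < τ.im) (hq : ‖eC (τ / (3 : ℕ))‖ < 1) :
    evalDisc hq (eisSeries 0) = eisTheta τ 0 0 := by
  refine (hasSum_eisSeries 0 hq).unique ?_
  simpa using hasSum_eisTheta hτ 0 0

lemma thetaTerm_neg (d a b : ℤ) (τ : ℂ) :
    thetaTerm d (-a, -b) τ 0 0 = thetaTerm d (a, b) τ 0 0 := by
  have : normForm d (-a) (-b) = normForm d a b := by simp only [normForm]; ring
  simp [thetaTerm, this]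

lemma evalDisc_eisSeries_two {τ : ℂ} (hq : ‖eC (τ / (3 : ℕ))‖ < 1) :
    evalDisc hq (eisSeries 2) = evalDisc hq (eisSeries 1) := by
  refine (hasSum_eisSeries 2 hq).unique ?_
  let e : ℤ × ℤ ≃ ℤ × ℤ :=
    { toFun := fun x => (-x.1 - 1, -x.2)
      invFun := fun x => (-x.1 - 1, -x.2)
      left_inv := fun x => by ext <;> simp
      right_inv := fun x => by ext <;> simp }
  have h := hasSum_eisSeries 1 hq
  rw [← e.hasSum_iff] at h
  refine h.congr_fun fun x => ?_
  rw [Function.comp_apply, ← thetaTerm_neg]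
  congr 2
  simp [e]
  ring

/-- Pairs of integers according to the residue of the first coordinate modulo three. -/
def tripleEquiv : Fin 3 × (ℤ × ℤ) ≃ ℤ × ℤ :=
  (Equiv.prodAssoc (Fin 3) ℤ ℤ).symm.trans
    (((Equiv.prodComm (Fin 3) ℤ).trans (Int.divModEquiv 3).symm).prodCongr (Equiv.refl ℤ))

lemma tripleEquiv_apply (j : Fin 3) (x : ℤ × ℤ) :
    tripleEquiv (j, x) = (3 * x.1 + j.val, x.2) := by
  simp [tripleEquiv, Int.divModEquiv, mul_comm]

lemma evalDisc_eisSeries_add {τ : ℂ} (hτ : 0 < τ.im) (hq : ‖eC (τ / (3 : ℕ))‖ < 1) :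
    evalDisc hq (eisSeries 0) + 2 * evalDisc hq (eisSeries 1) = eisThetaDual τ 0 0 := by
  have h := hasSum_of_equiv_prod tripleEquiv (f := fun x => thetaTerm (-3) x τ 0 0)
    (a := fun j => evalDisc hq (eisSeries j)) (fun j => by
      simp_rw [tripleEquiv_apply]
      exact hasSum_eisSeries j hq)
  rw [(hasSum_eisThetaDual hτ 0 0).unique h, Fin.sum_univ_three, evalDisc_eisSeries_two]
  ring

lemma evalDisc_eisSeries_invert {τ : ℂ} (hτ : 0 < τ.im) (hq : ‖eC (τ / (3 : ℕ))‖ < 1)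
    (hq' : ‖eC (-1 / τ / (3 : ℕ))‖ < 1) :
    evalDisc hq' (eisSeries 0) =
        eisFactor τ * (evalDisc hq (eisSeries 0) + 2 * evalDisc hq (eisSeries 1)) ∧
      evalDisc hq' (eisSeries 1) =
        eisFactor τ * (evalDisc hq (eisSeries 0) - evalDisc hq (eisSeries 1)) := by
  have h0 := eisTheta_invert hτ 0 0
  have h1 := eisThetaDual_invert hτ 0 0
  simp only [zero_div, mul_zero, eC_zero, mul_one] at h0 h1
  rw [← evalDisc_eisSeries_zero (im_neg_inv_pos hτ) hq', ← evalDisc_eisSeries_add hτ hq] at h0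
  rw [← evalDisc_eisSeries_add (im_neg_inv_pos hτ) hq', ← evalDisc_eisSeries_zero hτ hq] at h1
  exact ⟨h0, by linear_combination (h1 - h0) / 2⟩

lemma suppMod_eisSeries (j : Fin 3) : SuppMod 3 (j.val ^ 2 : ℕ) (eisSeries j).1 := by
  refine SuppMod.countSeries fun x => ?_
  have h3 : (3 : ZMod 3) = 0 := rfl
  have h := congrArg (Int.cast (R := ZMod 3))
    (Int.toNat_of_nonneg (normForm_nonneg (d := -3) (Or.inr rfl) (3 * x.1 + j.val) x.2))
  rw [Int.cast_natCast] at h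
  rw [h, normForm_neg_three]
  push_cast
  linear_combination (3 * (x.1 : ZMod 3) ^ 2 + 2 * x.1 * j.val - (3 * x.1 + j.val) * x.2 + x.2 ^ 2) * h3

lemma constantCoeff_eisSeries_zero : PowerSeries.constantCoeff (eisSeries 0).1 = 1 := by
  rw [← PowerSeries.coeff_zero_eq_constantCoeff_apply]
  refine (coeff_countSeries _ _).trans ?_
  have : Nat.card {x : ℤ × ℤ // (normForm (-3) (3 * x.1 + (0 : Fin 3).val) x.2).toNat = 0} = 1 := by
    rw [Nat.card_eq_one_iff_unique]
    have key : ∀ x : ℤ × ℤ, (normForm (-3) (3 * x.1 + (0 : Fin 3).val) x.2).toNat = 0 → x = 0 := by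
      intro x hx
      by_contra h
      have := normForm_pos (d := -3) (a := 3 * x.1 + (0 : Fin 3).val) (b := x.2) (Or.inr rfl)
        (fun h' => h (Prod.ext (by simpa using h'.1) h'.2))
      lia
    refine ⟨⟨fun a b => Subtype.ext ((key _ a.2).trans (key _ b.2).symm)⟩, ⟨0, by simp [normForm]⟩⟩
  rw [this]; rfl

lemma constantCoeff_eisSeries_one : PowerSeries.constantCoeff (eisSeries 1).1 = 0 := by
  rw [← PowerSeries.coeff_zero_eq_constantCoeff_apply]
  by_contra h
  have := suppMod_eisSeries 1 0 h
  revert this; decide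

namespace EisPair

lemma mul {k : ℕ} {f₀ f₂ : polyGrowthSubring} (h : EisPair k f₀ f₂)
    {g : polyGrowthSubring} {m : ℕ} (hg : SuppMod 3 0 g.1)
    (hg1 : PowerSeries.constantCoeff g.1 = 1)
    (hinv : ∀ (τ : ℂ) (_ : 0 < τ.im) (hq : ‖eC (τ / (3 : ℕ))‖ < 1)
      (hq' : ‖eC (-1 / τ / (3 : ℕ))‖ < 1), evalDisc hq' g = τ ^ m * evalDisc hq g) :
    EisPair (k + m) (f₀ * g) (f₂ * g) where
  supp₀ := by simpa using h.supp₀.mul hg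
  supp₂ := by simpa using h.supp₂.mul hg
  const := by rw [Subring.coe_mul, map_mul, h.const, hg1, one_mul]
  invert τ hτ hq hq' := by
    obtain ⟨h1, h2⟩ := h.invert τ hτ hq hq'
    simp only [map_mul, hinv τ hτ hq hq']
    refine ⟨?_, ?_⟩
    · linear_combination (τ ^ m * evalDisc hq g) * h1
    · linear_combination (τ ^ m * evalDisc hq g) * h2

lemma four : EisPair 4 (eisSeries 0 ^ 3 + 2 * eisSeries 1 ^ 3)
    (3 * eisSeries 0 * eisSeries 1 ^ 2) where
  supp₀ := ((suppMod_eisSeries 0).pow 3).add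
    ((SuppMod.intCast 3 2).mul ((suppMod_eisSeries 1).pow 3))
  supp₂ := ((SuppMod.intCast 3 3).mul (suppMod_eisSeries 0)).mul ((suppMod_eisSeries 1).pow 2)
  const := by
    simp [constantCoeff_eisSeries_zero, constantCoeff_eisSeries_one]
  invert τ hτ hq hq' := by
    obtain ⟨h0, h1⟩ := evalDisc_eisSeries_invert hτ hq hq'
    simp only [map_add, map_mul, map_pow, map_ofNat, h0, h1]
    have hs : eisFactor τ ^ 4 = τ ^ 4 / 9 := by
      rw [show eisFactor τ ^ 4 = (eisFactor τ ^ 2) ^ 2 by ring, eisFactor_sq]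
      ring
    generalize evalDisc hq (eisSeries 0) = x
    generalize evalDisc hq (eisSeries 1) = y
    refine ⟨?_, ?_⟩
    · linear_combination (9 * (x ^ 3 + 2 * y ^ 3)) * hs
    · linear_combination (9 * (3 * x * y ^ 2)) * hs

lemma six : EisPair 6 (eisSeries 0 ^ 5 - 10 * eisSeries 0 ^ 2 * eisSeries 1 ^ 3)
    (-(5 * eisSeries 0 ^ 3 * eisSeries 1 ^ 2 + 4 * eisSeries 1 ^ 5)) where
  supp₀ := ((suppMod_eisSeries 0).pow 5).sub
    (((SuppMod.intCast 3 10).mul ((suppMod_eisSeries 0).pow 2)).mul ((suppMod_eisSeries 1).pow 3))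
  supp₂ := ((((SuppMod.intCast 3 5).mul ((suppMod_eisSeries 0).pow 3)).mul
    ((suppMod_eisSeries 1).pow 2)).add
    ((SuppMod.intCast 3 4).mul ((suppMod_eisSeries 1).pow 5))).neg
  const := by
    simp [constantCoeff_eisSeries_zero, constantCoeff_eisSeries_one]
  invert τ hτ hq hq' := by
    obtain ⟨h0, h1⟩ := evalDisc_eisSeries_invert hτ hq hq'
    simp only [map_add, map_sub, map_neg, map_mul, map_pow, map_ofNat, h0, h1]
    have hs : eisFactor τ ^ 6 = -(τ ^ 6 / 27) := by
      rw [show eisFactor τ ^ 6 = (eisFactor τ ^ 2) ^ 3 by ring, eisFactor_sq]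
      ring
    generalize evalDisc hq (eisSeries 0) = x
    generalize evalDisc hq (eisSeries 1) = y
    refine ⟨?_, ?_⟩
    · linear_combination (-27 * (x ^ 5 - 10 * x ^ 2 * y ^ 3)) * hs
    · linear_combination (27 * (5 * x ^ 3 * y ^ 2 + 4 * y ^ 5)) * hs

lemma add_four {k : ℕ} {f₀ f₂ : polyGrowthSubring} (h : EisPair k f₀ f₂) :
    ∃ g₀ g₂, EisPair (k + 4) g₀ g₂ := by
  refine ⟨_, _, h.mul (m := 4) (g := eisSeries 0 ^ 4 + 8 * eisSeries 0 * eisSeries 1 ^ 3) ?_ ?_ ?_⟩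
  · exact ((suppMod_eisSeries 0).pow 4).add
      (((SuppMod.intCast 3 8).mul (suppMod_eisSeries 0)).mul ((suppMod_eisSeries 1).pow 3))
  · simp [constantCoeff_eisSeries_zero, constantCoeff_eisSeries_one]
  · intro τ hτ hq hq'
    obtain ⟨h0, h1⟩ := evalDisc_eisSeries_invert hτ hq hq'
    simp only [map_add, map_mul, map_pow, map_ofNat, h0, h1]
    have hs : eisFactor τ ^ 4 = τ ^ 4 / 9 := by
      rw [show eisFactor τ ^ 4 = (eisFactor τ ^ 2) ^ 2 by ring, eisFactor_sq]
      ring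
    generalize evalDisc hq (eisSeries 0) = x
    generalize evalDisc hq (eisSeries 1) = y
    linear_combination (9 * (x ^ 4 + 8 * x * y ^ 3)) * hs

end EisPair

lemma exists_eisPair (n : ℕ) : ∃ f₀ f₂, EisPair (2 * n + 4) f₀ f₂ := by
  induction n using Nat.twoStepInduction with
  | zero => exact ⟨_, _, EisPair.four⟩
  | one => exact ⟨_, _, EisPair.six⟩
  | more n h _ =>
    obtain ⟨f₀, f₂, h⟩ := h
    exact h.add_four

/-- In every even weight at least four there is a Jacobi function of index one with integral
coefficients and constant term one. -/
lemma exists_jacobiFun {d : ℤ} (hd : d = -4 ∨ d = -3) (n : ℕ) :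
    ∃ c : ℤ → ℤ, IsPolyGrowth c ∧ c 0 = 1 ∧ IsJacobiType (2 * n + 4) (jacobiFun d c) := by
  rcases hd with rfl | rfl
  · obtain ⟨f₀, f₂, f₃, h⟩ := exists_gaussTriple n
    exact ⟨_, isPolyGrowth_coeffZ (f₀ + f₂ + f₃).2, h.coeffZ_zero, h.isJacobiType⟩
  · obtain ⟨f₀, f₂, h⟩ := exists_eisPair n
    exact ⟨_, isPolyGrowth_coeffZ (f₀ + f₂).2, h.coeffZ_zero, h.isJacobiType⟩

/-! ### The congruence -/

/-- `p` times the Bernoulli number of index `p - 1` is a unit at `p`. -/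
lemma exists_mul_bernoulli_eq {p k : ℕ} (hp : p.Prime) (hk : p = 2 * k + 1) :
    ∃ A Q : ℤ, ¬ (p : ℤ) ∣ A ∧ (A : ℚ) = p * Q * bernoulli (2 * k) := by
  obtain ⟨M, hM⟩ := Bernoulli.vonStaudt_clausen k
  set S := {q ∈ Finset.range (2 * k + 2) | q.Prime ∧ (q - 1) ∣ 2 * k} with hS
  have hpS : p ∈ S := by
    simp only [hS, Finset.mem_filter, Finset.mem_range]
    exact ⟨by lia, hp, by simp [hk]⟩
  set T := S.erase p with hT
  have hprime : ∀ q ∈ T, q.Prime ∧ q ≠ p := fun q hq => by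
    rw [hT, Finset.mem_erase, hS, Finset.mem_filter] at hq
    exact ⟨hq.2.2.1, hq.1⟩
  set P := ∏ q ∈ T, q with hP
  have hPp : ¬ p ∣ P := by
    rw [hP, hp.prime.dvd_finsetProd_iff]
    rintro ⟨q, hq, hdvd⟩
    exact (hprime q hq).2 ((Nat.prime_dvd_prime_iff_eq hp (hprime q hq).1).1 hdvd).symm
  have hsum : ((∑ q ∈ T, (P / q : ℕ) : ℕ) : ℚ) = P * ∑ q ∈ T, (1 : ℚ) / q := by
    rw [Nat.cast_sum, Finset.mul_sum]
    refine Finset.sum_congr rfl fun q hq => ?_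
    have hq0 : (q : ℚ) ≠ 0 := by exact_mod_cast (hprime q hq).1.ne_zero
    rw [Nat.cast_div (Finset.dvd_prod_of_mem (fun q => q) hq) hq0, mul_one_div]
  have hp0 : (p : ℚ) ≠ 0 := by exact_mod_cast hp.ne_zero
  rw [← Finset.add_sum_erase S _ hpS, ← hT] at hM
  obtain ⟨R, hR⟩ : ∃ R : ℕ, (R : ℚ) = P * ∑ q ∈ T, (1 : ℚ) / q := ⟨_, hsum⟩
  refine ⟨p * (P * M - R) - P, P, ?_, ?_⟩
  · rw [dvd_sub_right (dvd_mul_right _ _)]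
    exact_mod_cast hPp
  · have hB : bernoulli (2 * k) = M - (1 / p + ∑ q ∈ T, (1 : ℚ) / q) := by
      linear_combination -hM
    push_cast
    rw [hR, hB]
    field_simp
    ring

/-- **Existence of a mod-p-one Hermitian modular form of weight `p - 1`**
(Proposition 4.2, Kikuta–Nagaoka). For `K = ℚ(√-1)` or `ℚ(√-3)` and a prime
`p ≥ 5` there is a symmetric Hermitian modular form `F_{p-1}` of degree 2 and
weight `p - 1` with character `ν_{p-1}` and `p`-integral Fourier coefficients
such that `F_{p-1} ≡ 1 (mod p)`: its constant term is `≡ 1 (mod p)` and all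
other Fourier coefficients are `≡ 0 (mod p)`. -/
theorem exists_hermitian_form_congruent_one
    (d : ℤ) (hd : d = -4 ∨ d = -3) (p : ℕ) (hp : Nat.Prime p) (hp5 : 5 ≤ p) :
    ∃ F : HermitianModularForm d ((p : ℤ) - 1),
      IsSymmetricHMF F ∧
      (∀ H, IsPIntegral p (F.coeff H)) ∧
      ModCongr p 1 (F.coeff 0) 1 ∧
      ∀ H, H ≠ 0 → ModCongr p 1 (F.coeff H) 0 := by
  obtain ⟨n, hn⟩ : ∃ n, p = 2 * (n + 2) + 1 := by
    obtain ⟨m, hm⟩ := hp.odd_of_ne_two (by lia)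
    exact ⟨m - 2, by lia⟩
  obtain ⟨A, Q, hA, hAQ⟩ := exists_mul_bernoulli_eq hp hn
  rw [show 2 * (n + 2) = 2 * n + 4 by ring] at hAQ
  have hB : bernoulli (2 * n + 4) ≠ 0 := fun h => by
    rw [h, mul_zero, Int.cast_eq_zero] at hAQ
    exact hA (hAQ ▸ dvd_zero _)
  have hBC : (bernoulli (2 * n + 4) : ℂ) ≠ 0 := by exact_mod_cast hB
  have hAC : (A : ℂ) = p * Q * (bernoulli (2 * n + 4) : ℂ) := by exact_mod_cast hAQ
  have hp0 : (p : ℂ) ≠ 0 := by exact_mod_cast hp.ne_zero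
  have hp1 : ¬ (p : ℤ) ∣ 1 := by exact_mod_cast hp.one_lt.ne' ∘ Nat.dvd_one.1
  obtain ⟨c, hc, hc0, hφ⟩ := exists_jacobiFun hd n
  obtain ⟨F, hF, hF0, hFH⟩ := exists_maassLift hd (by lia) ⟨n + 2, by ring⟩ hB hc hc0 hφ
    (K := (p : ℤ) - 1) (by rw [hn]; push_cast; ring)
  have hcongr : ∀ H, H ≠ 0 → ModCongr p 1 (F.coeff H) 0 := fun H hH => by
    obtain ⟨N, hN⟩ := hFH H hH
    refine ⟨Q * (-(2 * (2 * n + 4))) * N, A, hA, ?_⟩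
    rw [hN, hAC]
    push_cast
    field_simp
    ring
  refine ⟨F, hF, fun H => ?_, ⟨0, 1, hp1, by simp [hF0]⟩, hcongr⟩
  rcases eq_or_ne H 0 with rfl | hH
  · exact ⟨1, 1, hp1, by simp [hF0]⟩
  · obtain ⟨a, b, hb, hab⟩ := hcongr H hH
    refine ⟨p * a, b, hb, ?_⟩
    push_cast
    rw [← hab]
    field_simp
    ring

end
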